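/- arXiv:2309.00097 — 5 statements merged into one kernel-verified Lean document; each statement's English description precedes it below -/
import Mathlib

section
/- For all integers k ≥ t ≥ 1 there exists ℓ₀ = ℓ₀(k,t) such that for all ℓ ≥ ℓ₀ the following holds. If 𝓕 ⊆ 𝓤_{k,ℓ} is a partially t-intersecting family of (k,ℓ)-partitions, then |𝓕| ≤ |𝓒_{k,ℓ}^T| for any t-element set T ⊆ [kℓ]. Moreover, equality holds if and only if 𝓕 = 𝓒_{k,ℓ}^T for some t-element set T. -/
open scoped Classical

/-- A partition of `[n]` (modeled as `Fin n`): a set of pairwise disjoint nonempty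
subsets whose union is everything. -/
def IsPartition {n : ℕ} (P : Finset (Finset (Fin n))) : Prop :=
  ∅ ∉ P ∧ (∀ p ∈ P, ∀ q ∈ P, p ≠ q → Disjoint p q) ∧ ∀ x : Fin n, ∃ p ∈ P, x ∈ p

/-- A `(k,ℓ)`-partition: a partition of `[kℓ]` into exactly `ℓ` parts, each of size `k`. -/
def IsKLPartition (k ℓ : ℕ) (P : Finset (Finset (Fin (k * ℓ)))) : Prop :=
  IsPartition P ∧ P.card = ℓ ∧ ∀ p ∈ P, p.card = k

/-- The canonically partially `t`-intersecting family `𝓒_{k,ℓ}^T`: all `(k,ℓ)`-partitions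
having a part containing `T`. -/
noncomputable def canonPartial (k ℓ : ℕ) (T : Finset (Fin (k * ℓ))) :
    Finset (Finset (Finset (Fin (k * ℓ)))) :=
  Finset.univ.filter fun P => IsKLPartition k ℓ P ∧ ∃ p ∈ P, T ⊆ p

/-- Bernstein-type bound for the total weight of the large subsets of a finite set. -/
theorem sum_large_subsets_le {α : Type*} (A : Finset α) (w g y m r : ℕ)
    (hw : 1 ≤ w) (hy : 2 ≤ y) (hA : A.card ≤ g * w) (hr : 0 < r) (hg : 2 * (g * y * m) ≤ r) :
    ∑ T ∈ A.powerset.filter (fun T => w ≤ T.card), ((m : ℝ) / r) ^ T.card ≤ 2 / y := by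
  have hy0 : (0 : ℝ) < y := by positivity
  have hr0 : (0 : ℝ) < r := by exact_mod_cast hr
  have h1 : ∑ T ∈ A.powerset.filter (fun T => w ≤ T.card), ((m : ℝ) / r) ^ T.card ≤
      ∑ T ∈ A.powerset, ((y : ℝ) * (m / r)) ^ T.card / y ^ w := by
    refine (Finset.sum_le_sum fun T hT => ?_).trans
      (Finset.sum_le_sum_of_subset_of_nonneg (Finset.filter_subset _ _) fun _ _ _ => by positivity)
    have hT' := (Finset.mem_filter.1 hT).2
    rw [le_div_iff₀ (by positivity), mul_pow, mul_comm]
    gcongr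
    exact_mod_cast (by omega : 1 ≤ y)
  have h2 : ∑ T ∈ A.powerset, ((y : ℝ) * (m / r)) ^ T.card = (y * (m / r) + 1) ^ A.card := by
    rw [← Finset.sum_pow_mul_eq_add_pow]
    simp
  rw [← Finset.sum_div, h2] at h1
  refine h1.trans ?_
  have h3 : ((y : ℝ) * (m / r) + 1) ^ A.card ≤ 2 ^ w := by
    calc ((y : ℝ) * (m / r) + 1) ^ A.card ≤ (y * (m / r) + 1) ^ (g * w) :=
          pow_le_pow_right₀ (by linarith [show (0 : ℝ) ≤ y * (m / r) by positivity]) hA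
      _ = ((y * (m / r) + 1) ^ g) ^ w := pow_mul _ _ _
      _ ≤ 2 ^ w := by
          refine pow_le_pow_left₀ (by positivity) ?_ _
          calc ((y : ℝ) * (m / r) + 1) ^ g ≤ (Real.exp (y * (m / r))) ^ g := by
                gcongr
                exact Real.add_one_le_exp _
            _ = Real.exp (g * (y * (m / r))) := (Real.exp_nat_mul _ _).symm
            _ ≤ Real.exp (1 / 2) := by
                gcongr
                have : (2 : ℝ) * (g * y * m) ≤ r := by exact_mod_cast hg
                rw [show (g : ℝ) * (y * (m / r)) = g * y * m / r by ring,
                  div_le_div_iff₀ hr0 (by norm_num)]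
                linarith
            _ ≤ 2 := by
                have h := Real.exp_one_lt_d9
                have h' : Real.exp (1 / 2) ^ 2 = Real.exp 1 := by
                  rw [← Real.exp_nat_mul]; norm_num
                nlinarith [Real.exp_pos (1 / 2)]
  calc ((y : ℝ) * (m / r) + 1) ^ A.card / y ^ w ≤ 2 ^ w / y ^ w := by gcongr
    _ = (2 / y) ^ w := (div_pow _ _ _).symm
    _ ≤ (2 / y) ^ 1 := by
        refine pow_le_pow_of_le_one (by positivity) ?_ hw
        rw [div_le_one hy0]
        exact_mod_cast hy
    _ = 2 / y := pow_one _

/-- A competitor of least size outside `W` among the small sets `τ b'` covered by `τ b ∪ W`. -/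
theorem exists_minimal_fragment {α β : Type*} (G : Finset β) (a : ℕ) (τ : β → Finset α)
    (W : Finset α) (b : β) :
    ∃ b', (b ∈ G → b' ∈ G ∧ τ b' ⊆ τ b ∪ W) ∧
      (b ∈ G → (τ b).card ≤ a → ∀ d ∈ G, (τ d).card ≤ a → τ d ⊆ τ b ∪ W →
        (τ b' \ W).card ≤ (τ d \ W).card) ∧
      (b ∈ G → (τ b).card ≤ a → (τ b').card ≤ a) := by
  by_cases hb : b ∈ G ∧ (τ b).card ≤ a
  · obtain ⟨b', hb', hmin⟩ := Finset.exists_min_image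
      (G.filter fun d => (τ d).card ≤ a ∧ τ d ⊆ τ b ∪ W) (fun d => (τ d \ W).card)
      ⟨b, by simp [hb.1, hb.2]⟩
    simp only [Finset.mem_filter] at hb' hmin
    exact ⟨b', fun _ => ⟨hb'.1, hb'.2.2⟩, fun _ _ d hd h1 h2 => hmin d ⟨hd, h1, h2⟩,
      fun _ _ => hb'.2.1⟩
  · exact ⟨b, fun h => ⟨h, Finset.subset_union_left⟩, fun h h' => absurd ⟨h, h'⟩ hb, fun _ h => h⟩

/-- The number of colourings agreeing with a given one off `T`. -/
theorem card_agree_off {α : Type*} [Fintype α] {m : ℕ} (T : Finset α) (c' : α → Fin m) :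
    (Finset.univ.filter fun c : α → Fin m => ∀ x ∉ T, c x = c' x).card = m ^ T.card := by
  have : (Finset.univ.filter fun c : α → Fin m => ∀ x ∉ T, c x = c' x) =
      Fintype.piFinset fun x => if x ∈ T then Finset.univ else {c' x} := by
    ext c
    simp only [Finset.mem_filter, Finset.mem_univ, true_and, Fintype.mem_piFinset]
    refine forall_congr' fun x => ?_
    by_cases hx : x ∈ T <;> simp [hx]
  rw [this, Fintype.card_piFinset]
  have h : ∀ x, (if x ∈ T then (Finset.univ : Finset (Fin m)) else {c' x}).card =
      if x ∈ T then m else 1 := fun x => by split_ifs <;> simp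
  simp_rw [h]
  rw [Finset.prod_ite_mem]
  simp

/-- Fragments after `j` colour classes have been absorbed: most fragments have shrunk by a
factor `g ^ j`. -/
theorem exists_fragments {α β : Type*} [Fintype α] (G : Finset β) (E : β → Finset α)
    (N g y m r : ℕ) (hg0 : 0 < g) (hy : 2 ≤ y) (hr : 0 < r) (hg : 2 * (g * y * m) ≤ r)
    (hN : ∀ b ∈ G, (E b).card ≤ N)
    (hspread : ∀ R : Finset α, (G.filter fun b => R ⊆ E b).card * r ^ R.card ≤ G.card)
    (j : ℕ) (hj : j ≤ m) :
    ∃ τ : (α → Fin m) → β → Finset α,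
      (∀ c, ∀ b ∈ G, τ c b ⊆ E b) ∧
      (∀ c, ∀ b ∈ G, ∀ x ∈ τ c b, j ≤ (c x : ℕ)) ∧
      (∀ c, ∀ b ∈ G, ∃ b' ∈ G, ∀ x ∈ E b', x ∈ τ c b ∨ (c x : ℕ) < j) ∧
      (∀ c c', (∀ x, c x = c' x ∨ (j ≤ (c x : ℕ) ∧ j ≤ (c' x : ℕ))) → τ c = τ c') ∧
      ((((G ×ˢ (Finset.univ : Finset (α → Fin m))).filter
        fun p => N / g ^ j < (τ p.2 p.1).card).card : ℝ) ≤
          j * (2 / y) * (G.card * (m : ℝ) ^ Fintype.card α)) := by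
  induction j with
  | zero =>
    refine ⟨fun _ b => E b, fun _ _ _ => subset_rfl, by simp, fun _ b hb => ⟨b, hb, by simp⟩,
      fun _ _ _ => rfl, ?_⟩
    rw [Finset.filter_false_of_mem]
    · simp
    · rintro ⟨b, c⟩ h
      simpa using hN b (Finset.mem_product.1 h).1
  | succ j ih =>
    obtain ⟨τ, hsub, havoid, hcov, hloc, hbad⟩ := ih (by omega)
    set a := N / g ^ j with ha
    choose pick hpick1 hpick2 hpick3 using
      fun (τ : β → Finset α) W b => exists_minimal_fragment G a τ W b
    let W : (α → Fin m) → Finset α := fun c => Finset.univ.filter fun x => (c x : ℕ) = j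
    let τ' : (α → Fin m) → β → Finset α := fun c b => τ c (pick (τ c) (W c) b) \ W c
    have hsub' : ∀ c, ∀ b ∈ G, τ' c b ⊆ τ c b := by
      intro c b hb x hx
      simp only [τ', Finset.mem_sdiff] at hx
      have := (hpick1 (τ c) (W c) b hb).2 hx.1
      simp only [Finset.mem_union] at this
      tauto
    have havoid' : ∀ c, ∀ b ∈ G, ∀ x ∈ τ' c b, j + 1 ≤ (c x : ℕ) := by
      intro c b hb x hx
      have h1 := havoid c b hb x (hsub' c b hb hx)
      simp only [τ', W, Finset.mem_sdiff, Finset.mem_filter, Finset.mem_univ, true_and] at hx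
      omega
    refine ⟨τ', fun c b hb => (hsub' c b hb).trans (hsub c b hb), havoid', ?_, ?_, ?_⟩
    · intro c b hb
      obtain ⟨b', hb', h⟩ := hcov c _ (hpick1 (τ c) (W c) b hb).1
      refine ⟨b', hb', fun x hx => ?_⟩
      simp only [τ', W, Finset.mem_sdiff, Finset.mem_filter, Finset.mem_univ, true_and]
      rcases h x hx with h | h
      · by_cases hj' : (c x : ℕ) = j
        · right; omega
        · exact Or.inl ⟨h, hj'⟩
      · right; omega
    · intro c c' h
      have h1 : τ c = τ c' := hloc c c' fun x => by
        rcases h x with h | h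
        · exact Or.inl h
        · right; omega
      have h2 : W c = W c' := by
        ext x
        simp only [W, Finset.mem_filter, Finset.mem_univ, true_and]
        rcases h x with h | h
        · rw [h]
        · omega
      simp only [τ', h1, h2]
    · set w := N / g ^ (j + 1) + 1 with hwdef
      have haw : a ≤ g * w := by
        rw [hwdef, pow_succ, ← Nat.div_div_eq_div_mul, ← ha]
        exact (Nat.lt_mul_div_succ a hg0).le
      have hjm : j < m := hj
      let recolor : (α → Fin m) → Finset α → (α → Fin m) :=
        fun c T x => if x ∈ T then ⟨j, hjm⟩ else c x
      have hcanon : ∀ c' : α → Fin m, ∃ A : Finset α, A.card ≤ a ∧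
          ((∃ d ∈ G, (τ c' d).card ≤ a ∧ τ c' d ⊆ W c') →
            ∃ d ∈ G, A = τ c' d ∧ τ c' d ⊆ W c') := by
        intro c'
        by_cases h : ∃ d ∈ G, (τ c' d).card ≤ a ∧ τ c' d ⊆ W c'
        · obtain ⟨d, hd, h1, h2⟩ := h
          exact ⟨τ c' d, h1, fun _ => ⟨d, hd, rfl, h2⟩⟩
        · exact ⟨∅, by simp, fun h' => absurd h' h⟩
      choose A hAcard hA using hcanon
      set B := (G ×ˢ (Finset.univ : Finset (α → Fin m))).filter
        fun p => (τ p.2 p.1).card ≤ a ∧ w ≤ (τ' p.2 p.1).card with hB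
      have hBcard : (B.card : ℝ) ≤ 2 / y * (G.card * (m : ℝ) ^ Fintype.card α) := by
        let Tgt : Finset (Σ _ : (α → Fin m), Finset α) :=
          Finset.univ.sigma fun c' => (A c').powerset.filter fun T => w ≤ T.card
        have hmaps : ∀ p ∈ B,
            (⟨recolor p.2 (τ' p.2 p.1), τ' p.2 p.1⟩ : Σ _ : (α → Fin m), Finset α) ∈ Tgt := by
          rintro ⟨b, c⟩ hp
          simp only [hB, Finset.mem_filter, Finset.mem_product, Finset.mem_univ, and_true] at hp
          obtain ⟨hb, hba, hbw⟩ := hp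
          simp only [Tgt, Finset.mem_sigma, Finset.mem_univ, true_and, Finset.mem_filter,
            Finset.mem_powerset]
          refine ⟨?_, hbw⟩
          set c' := recolor c (τ' c b) with hc'
          have hτ : τ c' = τ c := hloc _ _ fun x => by
            by_cases hx : x ∈ τ' c b
            · right
              have := havoid' c b hb x hx
              simp only [hc', recolor, hx, if_true]
              omega
            · left; simp [hc', recolor, hx]
          have hW : W c' = W c ∪ τ' c b := by
            ext x
            by_cases hx : x ∈ τ' c b <;> simp [W, hc', recolor, hx]
          have hp1 := hpick1 (τ c) (W c) b hb
          have hp3 := hpick3 (τ c) (W c) b hb hba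
          obtain ⟨d, hd, hAd, hdW⟩ := hA c' ⟨_, hp1.1, by rw [hτ]; exact hp3, by
            rw [hτ, hW]
            intro x hx
            by_cases hxW : x ∈ W c
            · simp [hxW]
            · simp [τ', hx, hxW]⟩
          have hda : (τ c d).card ≤ a := by
            have := hAcard c'
            rwa [hAd, hτ] at this
          rw [hτ, hW] at hdW
          rw [hAd, hτ]
          have hmin := hpick2 (τ c) (W c) b hb hba d hd hda (hdW.trans (by
            intro x hx
            rcases Finset.mem_union.1 hx with h | h
            · simp [h]
            · exact Finset.mem_union_left _ (hsub' c b hb h)))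
          have hsd : τ c d \ W c ⊆ τ' c b := by
            intro x hx
            have h1 := Finset.mem_sdiff.1 hx
            have := hdW h1.1
            simp only [Finset.mem_union] at this
            tauto
          rw [← Finset.eq_of_subset_of_card_le hsd hmin]
          exact Finset.sdiff_subset
        have hfib : ∀ q ∈ Tgt, ((B.filter fun p =>
            (⟨recolor p.2 (τ' p.2 p.1), τ' p.2 p.1⟩ : Σ _ : (α → Fin m), Finset α) = q).card : ℝ) ≤
            G.card * ((m : ℝ) / r) ^ q.2.card := by
          rintro ⟨c', T⟩ -
          have hsubset : (B.filter fun p =>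
              (⟨recolor p.2 (τ' p.2 p.1), τ' p.2 p.1⟩ : Σ _ : (α → Fin m), Finset α) = ⟨c', T⟩) ⊆
              (G.filter fun b => T ⊆ E b) ×ˢ
                (Finset.univ.filter fun c : α → Fin m => ∀ x ∉ T, c x = c' x) := by
            rintro ⟨b, c⟩ hp
            simp only [hB, Finset.mem_filter, Finset.mem_product, Finset.mem_univ, and_true,
              Sigma.mk.injEq, heq_eq_eq] at hp
            obtain ⟨⟨hb, -⟩, h1, h2⟩ := hp
            simp only [Finset.mem_filter, Finset.mem_product, Finset.mem_univ, true_and]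
            refine ⟨⟨hb, ?_⟩, fun x hx => ?_⟩
            · rw [← h2]
              exact (hsub' c b hb).trans (hsub c b hb)
            · rw [← h1]
              simp only [recolor]
              rw [h2, if_neg hx]
          have h1 := Finset.card_le_card hsubset
          rw [Finset.card_product, card_agree_off] at h1
          have h2 : ((G.filter fun b => T ⊆ E b).card : ℝ) * r ^ T.card ≤ G.card := by
            exact_mod_cast hspread T
          have hr0 : (0 : ℝ) < r := by exact_mod_cast hr
          calc _ ≤ ((G.filter fun b => T ⊆ E b).card : ℝ) * (m : ℝ) ^ T.card := by
                exact_mod_cast h1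
            _ ≤ (G.card / (r : ℝ) ^ T.card) * (m : ℝ) ^ T.card := by
                gcongr
                rwa [le_div_iff₀ (by positivity)]
            _ = _ := by rw [div_pow]; ring
        rw [Finset.card_eq_sum_card_fiberwise hmaps]
        push_cast
        refine (Finset.sum_le_sum hfib).trans ?_
        rw [Finset.sum_sigma]
        simp only
        have : ∀ c' ∈ (Finset.univ : Finset (α → Fin m)),
            ∑ T ∈ (A c').powerset.filter (fun T => w ≤ T.card),
              (G.card : ℝ) * ((m : ℝ) / r) ^ T.card ≤ G.card * (2 / y) := by
          intro c' _
          rw [← Finset.mul_sum]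
          exact mul_le_mul_of_nonneg_left (sum_large_subsets_le (A c') w g y m r
            (Nat.le_add_left 1 _) hy
            ((hAcard c').trans haw) hr hg) (by positivity)
        refine (Finset.sum_le_sum this).trans (le_of_eq ?_)
        rw [Finset.sum_const, nsmul_eq_mul]
        simp
        ring
      have hle : ((G ×ˢ (Finset.univ : Finset (α → Fin m))).filter
          fun p => N / g ^ (j + 1) < (τ' p.2 p.1).card) ⊆
          ((G ×ˢ (Finset.univ : Finset (α → Fin m))).filter
            fun p => a < (τ p.2 p.1).card) ∪ B := by
        rintro p hp
        simp only [Finset.mem_filter, Finset.mem_union, hB] at hp ⊢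
        by_cases h : a < (τ p.2 p.1).card
        · exact Or.inl ⟨hp.1, h⟩
        · exact Or.inr ⟨hp.1, by omega, by omega⟩
      have h1 := (Finset.card_le_card hle).trans (Finset.card_union_le _ _)
      calc _ ≤ ((((G ×ˢ (Finset.univ : Finset (α → Fin m))).filter
            fun p => a < (τ p.2 p.1).card).card : ℝ)) + B.card := by exact_mod_cast h1
        _ ≤ _ := add_le_add hbad hBcard
        _ = _ := by push_cast; ring

/-- A spread family has, for more than half of the colourings with `2 * J` colours, a member
coloured with the first `J` colours only. -/
theorem card_colorings_gt_half {α β : Type*} [Fintype α] (G : Finset β) (E : β → Finset α)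
    (N g J r : ℕ) (hJ : 0 < J) (hg0 : 0 < g) (hg : 32 * J ^ 2 * g ≤ r) (hNg : N < g ^ J)
    (hG : G.Nonempty) (hN : ∀ b ∈ G, (E b).card ≤ N)
    (hspread : ∀ R : Finset α, (G.filter fun b => R ⊆ E b).card * r ^ R.card ≤ G.card) :
    Fintype.card (α → Fin (2 * J)) <
      2 * (Finset.univ.filter fun c : α → Fin (2 * J) =>
        ∃ b ∈ G, ∀ x ∈ E b, (c x : ℕ) < J).card := by
  have hJ2 : 0 < J ^ 2 := by positivity
  obtain ⟨τ, -, -, hcov, -, hbad⟩ := exists_fragments G E N g (8 * J) (2 * J) r hg0 (by omega)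
    (by have := Nat.mul_pos hJ2 hg0; nlinarith) (by nlinarith) hN hspread J (by omega)
  rw [Nat.div_eq_of_lt hNg] at hbad
  set good := Finset.univ.filter fun c : α → Fin (2 * J) => ∃ b ∈ G, ∀ x ∈ E b, (c x : ℕ) < J
    with hgood
  have hsub : G ×ˢ goodᶜ ⊆ (G ×ˢ (Finset.univ : Finset (α → Fin (2 * J)))).filter
      fun p => 0 < (τ p.2 p.1).card := by
    rintro ⟨b, c⟩ hp
    simp only [hgood, Finset.mem_product, Finset.mem_compl, Finset.mem_filter, Finset.mem_univ,
      true_and, and_true] at hp ⊢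
    refine ⟨hp.1, Finset.card_pos.2 ?_⟩
    by_contra h
    rw [Finset.not_nonempty_iff_eq_empty] at h
    obtain ⟨b', hb', hx⟩ := hcov c b hp.1
    simp only [h, Finset.notMem_empty, false_or] at hx
    exact hp.2 ⟨b', hb', hx⟩
  have h1 := Finset.card_le_card hsub
  rw [Finset.card_product] at h1
  have hGpos : (0 : ℝ) < G.card := by exact_mod_cast hG.card_pos
  have hcard : (Fintype.card (α → Fin (2 * J)) : ℝ) = ((2 * J : ℕ) : ℝ) ^ Fintype.card α := by
    simp
  have hJ0 : (0 : ℝ) < J := by exact_mod_cast hJ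
  have hcpos : (0 : ℝ) < Fintype.card (α → Fin (2 * J)) := by
    rw [hcard]; positivity
  have h2 : (G.card : ℝ) * (goodᶜ).card ≤
      G.card * ((1 / 4) * Fintype.card (α → Fin (2 * J))) := by
    calc (G.card : ℝ) * (goodᶜ).card ≤ _ := by exact_mod_cast h1
      _ ≤ _ := hbad
      _ = _ := by
        rw [hcard]; push_cast; field_simp; norm_num
  have h3 := le_of_mul_le_mul_left h2 hGpos
  have h4 : (good.card : ℝ) + (goodᶜ).card = Fintype.card (α → Fin (2 * J)) := by
    exact_mod_cast Finset.card_add_card_compl good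
  have : (Fintype.card (α → Fin (2 * J)) : ℝ) < 2 * good.card := by linarith
  exact_mod_cast this

/-- Two spread families contain members with disjoint sets. -/
theorem exists_disjoint_of_spread {α β : Type*} [Fintype α] (G₁ G₂ : Finset β)
    (E₁ E₂ : β → Finset α)
    (N g J r : ℕ) (hJ : 0 < J) (hg0 : 0 < g) (hg : 32 * J ^ 2 * g ≤ r) (hNg : N < g ^ J)
    (hG₁ : G₁.Nonempty) (hN₁ : ∀ b ∈ G₁, (E₁ b).card ≤ N)
    (hs₁ : ∀ R : Finset α, (G₁.filter fun b => R ⊆ E₁ b).card * r ^ R.card ≤ G₁.card)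
    (hG₂ : G₂.Nonempty) (hN₂ : ∀ b ∈ G₂, (E₂ b).card ≤ N)
    (hs₂ : ∀ R : Finset α, (G₂.filter fun b => R ⊆ E₂ b).card * r ^ R.card ≤ G₂.card) :
    ∃ b₁ ∈ G₁, ∃ b₂ ∈ G₂, Disjoint (E₁ b₁) (E₂ b₂) := by
  have h1 := card_colorings_gt_half G₁ E₁ N g J r hJ hg0 hg hNg hG₁ hN₁ hs₁
  have h2 := card_colorings_gt_half G₂ E₂ N g J r hJ hg0 hg hNg hG₂ hN₂ hs₂
  set A := Finset.univ.filter fun c : α → Fin (2 * J) => ∃ b ∈ G₁, ∀ x ∈ E₁ b, (c x : ℕ) < J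
    with hA
  set B := Finset.univ.filter fun c : α → Fin (2 * J) => ∃ b ∈ G₂, ∀ x ∈ E₂ b, (c x : ℕ) < J
    with hB
  let φ : (α → Fin (2 * J)) → (α → Fin (2 * J)) := fun c x => (c x).rev
  have hφ : Function.Injective φ := fun c c' h => funext fun x => Fin.rev_injective (congrFun h x)
  have hBc : (B.image φ).card = B.card := Finset.card_image_of_injective _ hφ
  have hne : (A ∩ B.image φ).Nonempty := by
    rw [← Finset.card_pos]
    have h3 := Finset.card_union_add_card_inter A (B.image φ)
    have h4 := Finset.card_le_univ (A ∪ B.image φ)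
    omega
  obtain ⟨c, hc⟩ := hne
  obtain ⟨hcA, hcB⟩ := Finset.mem_inter.1 hc
  obtain ⟨d, hd, hdc⟩ := Finset.mem_image.1 hcB
  obtain ⟨b₁, hb₁, hx₁⟩ := (Finset.mem_filter.1 hcA).2
  obtain ⟨b₂, hb₂, hx₂⟩ := (Finset.mem_filter.1 hd).2
  refine ⟨b₁, hb₁, b₂, hb₂, Finset.disjoint_left.2 fun x h h' => ?_⟩
  have e1 := hx₁ x h
  have e2 := hx₂ x h'
  rw [← hdc] at e1
  simp only [φ, Fin.val_rev] at e1
  omega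

/-- Two points lie in a common part. -/
def SamePart {n : ℕ} (P : Finset (Finset (Fin n))) (x y : Fin n) : Prop :=
  ∃ p ∈ P, x ∈ p ∧ y ∈ p

/-- All points of `T` lie in a common part, stated pairwise. -/
def Together {n : ℕ} (P : Finset (Finset (Fin n))) (T : Finset (Fin n)) : Prop :=
  ∀ x ∈ T, ∀ y ∈ T, SamePart P x y

/-- The part of a point. -/
noncomputable def partOf {n : ℕ} (P : Finset (Finset (Fin n))) (x : Fin n) : Finset (Fin n) :=
  Finset.univ.filter fun y => SamePart P x y

/-- The ordered pairs of distinct points in a common part. -/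
noncomputable def partEdges {n : ℕ} (P : Finset (Finset (Fin n))) : Finset (Fin n × Fin n) :=
  Finset.univ.filter fun e => e.1 ≠ e.2 ∧ SamePart P e.1 e.2

/-- The image of a partition under a permutation of the ground set. -/
noncomputable def permuteParts {n : ℕ} (σ : Equiv.Perm (Fin n)) (P : Finset (Finset (Fin n))) :
    Finset (Finset (Fin n)) :=
  P.image fun p => p.image σ

/-- The set of all `(k,ℓ)`-partitions. -/
noncomputable def klPartitions (k ℓ : ℕ) : Finset (Finset (Finset (Fin (k * ℓ)))) :=
  Finset.univ.filter (IsKLPartition k ℓ)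

section Partitions

variable {n k ℓ t : ℕ}

theorem SamePart.symm {P : Finset (Finset (Fin n))} {x y : Fin n} (h : SamePart P x y) :
    SamePart P y x := by
  obtain ⟨p, hp, hx, hy⟩ := h
  exact ⟨p, hp, hy, hx⟩

theorem IsPartition.eq_of_mem {P : Finset (Finset (Fin n))} (hP : IsPartition P)
    {p q : Finset (Fin n)} (hp : p ∈ P) (hq : q ∈ P) {x : Fin n} (hxp : x ∈ p) (hxq : x ∈ q) :
    p = q := by
  by_contra h
  exact Finset.disjoint_left.1 (hP.2.1 p hp q hq h) hxp hxq

theorem IsPartition.samePart_refl {P : Finset (Finset (Fin n))} (hP : IsPartition P) (x : Fin n) :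
    SamePart P x x := by
  obtain ⟨p, hp, hx⟩ := hP.2.2 x
  exact ⟨p, hp, hx, hx⟩

theorem IsPartition.together_iff {P : Finset (Finset (Fin n))} (hP : IsPartition P)
    {T : Finset (Fin n)} (hT : T.Nonempty) : Together P T ↔ ∃ p ∈ P, T ⊆ p := by
  constructor
  · intro h
    obtain ⟨x, hx⟩ := hT
    obtain ⟨p, hp, hxp⟩ := hP.2.2 x
    refine ⟨p, hp, fun y hy => ?_⟩
    obtain ⟨q, hq, hxq, hyq⟩ := h x hx y hy
    rwa [hP.eq_of_mem hp hq hxp hxq]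
  · rintro ⟨p, hp, h⟩ x hx y hy
    exact ⟨p, hp, h hx, h hy⟩

theorem mem_partOf {P : Finset (Finset (Fin n))} {x y : Fin n} :
    y ∈ partOf P x ↔ SamePart P x y := by
  simp [partOf]

theorem IsKLPartition.card_partOf {P : Finset (Finset (Fin (k * ℓ)))} (hP : IsKLPartition k ℓ P)
    (x : Fin (k * ℓ)) : (partOf P x).card = k := by
  obtain ⟨p, hp, hx⟩ := hP.1.2.2 x
  have : partOf P x = p := by
    ext y
    rw [mem_partOf]
    constructor
    · rintro ⟨q, hq, hxq, hyq⟩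
      rwa [hP.1.eq_of_mem hp hq hx hxq]
    · exact fun hy => ⟨p, hp, hx, hy⟩
  rw [this, hP.2.2 p hp]

theorem samePart_permuteParts {σ : Equiv.Perm (Fin n)} {P : Finset (Finset (Fin n))} {x y : Fin n} :
    SamePart (permuteParts σ P) x y ↔ SamePart P (σ.symm x) (σ.symm y) := by
  constructor
  · rintro ⟨p, hp, hx, hy⟩
    obtain ⟨q, hq, rfl⟩ := Finset.mem_image.1 hp
    obtain ⟨a, ha, rfl⟩ := Finset.mem_image.1 hx
    obtain ⟨b, hb, rfl⟩ := Finset.mem_image.1 hy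
    exact ⟨q, hq, by simpa using ha, by simpa using hb⟩
  · rintro ⟨q, hq, hx, hy⟩
    exact ⟨q.image σ, Finset.mem_image_of_mem _ hq, Finset.mem_image.2 ⟨_, hx, by simp⟩,
      Finset.mem_image.2 ⟨_, hy, by simp⟩⟩

theorem permuteParts_injective (σ : Equiv.Perm (Fin n)) : Function.Injective (permuteParts σ) :=
  Finset.image_injective (Finset.image_injective σ.injective)

theorem IsKLPartition.permuteParts {P : Finset (Finset (Fin (k * ℓ)))} (hP : IsKLPartition k ℓ P)
    (σ : Equiv.Perm (Fin (k * ℓ))) : IsKLPartition k ℓ (permuteParts σ P) := by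
  obtain ⟨⟨h1, h2, h3⟩, h4, h5⟩ := hP
  refine ⟨⟨?_, ?_, ?_⟩, ?_, ?_⟩
  · intro h
    obtain ⟨p, hp, hpe⟩ := Finset.mem_image.1 h
    rw [Finset.image_eq_empty] at hpe
    exact h1 (hpe ▸ hp)
  · intro p hp q hq hpq
    obtain ⟨p', hp', rfl⟩ := Finset.mem_image.1 hp
    obtain ⟨q', hq', rfl⟩ := Finset.mem_image.1 hq
    rw [Finset.disjoint_image σ.injective]
    exact h2 p' hp' q' hq' fun h => hpq (by rw [h])
  · intro x
    obtain ⟨p, hp, hx⟩ := h3 (σ.symm x)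
    exact ⟨p.image σ, Finset.mem_image_of_mem _ hp, Finset.mem_image.2 ⟨_, hx, by simp⟩⟩
  · exact (Finset.card_image_of_injective _ (Finset.image_injective σ.injective)).trans h4
  · intro p hp
    obtain ⟨p', hp', rfl⟩ := Finset.mem_image.1 hp
    rw [Finset.card_image_of_injective _ σ.injective, h5 p' hp']

theorem mem_klPartitions {P : Finset (Finset (Fin (k * ℓ)))} :
    P ∈ klPartitions k ℓ ↔ IsKLPartition k ℓ P := by
  simp [klPartitions]

theorem mem_canonPartial {P : Finset (Finset (Fin (k * ℓ)))} {T : Finset (Fin (k * ℓ))}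
    (hT : T.Nonempty) : P ∈ canonPartial k ℓ T ↔ IsKLPartition k ℓ P ∧ Together P T := by
  simp only [canonPartial, Finset.mem_filter, Finset.mem_univ, true_and]
  exact and_congr_right fun h => (h.1.together_iff hT).symm

theorem mem_partEdges {P : Finset (Finset (Fin n))} {e : Fin n × Fin n} :
    e ∈ partEdges P ↔ e.1 ≠ e.2 ∧ SamePart P e.1 e.2 := by
  simp [partEdges]

theorem IsPartition.offDiag_subset_partEdges {P : Finset (Finset (Fin n))} (hP : IsPartition P)
    {T : Finset (Fin n)} : T.offDiag ⊆ partEdges P ↔ Together P T := by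
  constructor
  · intro h x hx y hy
    by_cases hxy : x = y
    · rw [hxy]; exact hP.samePart_refl y
    · exact (mem_partEdges.1
        (h (show (x, y) ∈ T.offDiag from Finset.mem_offDiag.2 ⟨hx, hy, hxy⟩))).2
  · intro h e he
    obtain ⟨h1, h2, h3⟩ := Finset.mem_offDiag.1 he
    exact mem_partEdges.2 ⟨h3, h _ h1 _ h2⟩

theorem IsKLPartition.card_partEdges_le {P : Finset (Finset (Fin (k * ℓ)))}
    (hP : IsKLPartition k ℓ P) : (partEdges P).card ≤ k * ℓ * k := by
  have hsub : partEdges P ⊆ Finset.univ.biUnion fun x => (partOf P x).image fun y => (x, y) := by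
    rintro ⟨x, y⟩ h
    have := (mem_partEdges.1 h).2
    simp only [Finset.mem_biUnion, Finset.mem_univ, true_and, Finset.mem_image]
    exact ⟨x, y, mem_partOf.2 this, rfl⟩
  refine (Finset.card_le_card hsub).trans ((Finset.card_biUnion_le_card_mul _ _ k ?_).trans ?_)
  · intro x _
    exact Finset.card_image_le.trans (hP.card_partOf x).le
  · simp

/-- Partially `t`-intersecting partitions have a common `t`-set inside parts. -/
theorem exists_together_of_inter {P Q : Finset (Finset (Fin n))}
    (h : ∃ p ∈ P, ∃ q ∈ Q, t ≤ (p ∩ q).card) :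
    ∃ S : Finset (Fin n), S.card = t ∧ Together P S ∧ Together Q S := by
  obtain ⟨p, hp, q, hq, ht⟩ := h
  obtain ⟨S, hS, hSt⟩ := Finset.exists_subset_card_eq ht
  refine ⟨S, hSt, fun x hx y hy => ⟨p, hp, ?_, ?_⟩, fun x hx y hy => ⟨q, hq, ?_, ?_⟩⟩
  · exact (Finset.mem_inter.1 (hS hx)).1
  · exact (Finset.mem_inter.1 (hS hy)).1
  · exact (Finset.mem_inter.1 (hS hx)).2
  · exact (Finset.mem_inter.1 (hS hy)).2

theorem card_canonPartial_le_of_card_eq {T T' : Finset (Fin (k * ℓ))} (h : T.card = T'.card) :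
    (canonPartial k ℓ T).card ≤ (canonPartial k ℓ T').card := by
  obtain ⟨σ, hσ⟩ : ∃ σ : Equiv.Perm (Fin (k * ℓ)), T.image σ = T' := by
    let e : {x // x ∈ T} ≃ {x // x ∈ T'} := Finset.equivOfCardEq h
    refine ⟨e.extendSubtype, Finset.eq_of_subset_of_card_le ?_ ?_⟩
    · intro y hy
      obtain ⟨x, hx, rfl⟩ := Finset.mem_image.1 hy
      exact Equiv.extendSubtype_mem e x hx
    · rw [Finset.card_image_of_injective _ (Equiv.injective _), h]
  refine Finset.card_le_card_of_injOn (permuteParts σ) ?_ (permuteParts_injective σ).injOn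
  intro P hP
  simp only [canonPartial, Finset.coe_filter, Finset.mem_univ, true_and, Set.mem_ofPred_eq] at hP ⊢
  obtain ⟨hP, p, hp, hTp⟩ := hP
  exact ⟨hP.permuteParts σ, p.image σ, Finset.mem_image_of_mem _ hp,
    hσ ▸ Finset.image_subset_image hTp⟩

theorem card_canonPartial_congr {T T' : Finset (Fin (k * ℓ))} (h : T.card = T'.card) :
    (canonPartial k ℓ T).card = (canonPartial k ℓ T').card :=
  (card_canonPartial_le_of_card_eq h).antisymm (card_canonPartial_le_of_card_eq h.symm)

/-- In a class of partitions closed under exchanging points outside `A`, few partitions put a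
given point outside `A` together with another given point. -/
theorem card_filter_samePart_mul_le (Y : Finset (Finset (Finset (Fin (k * ℓ)))))
    (hY : ∀ Q ∈ Y, IsKLPartition k ℓ Q) (A : Finset (Fin (k * ℓ)))
    (hA : ∀ Q ∈ Y, ∀ x ∉ A, ∀ z ∉ A, permuteParts (Equiv.swap x z) Q ∈ Y)
    {x y : Fin (k * ℓ)} (hx : x ∉ A) (hxy : x ≠ y) (hn : 2 * (A.card + 2) ≤ k * ℓ) :
    (Y.filter fun Q => SamePart Q x y).card * (k * ℓ) ≤ 2 * k * Y.card := by
  have hmain : ((Y.filter fun Q => SamePart Q x y) ×ˢ (A ∪ {x, y})ᶜ).card ≤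
      (Y.sigma fun Q => partOf Q y).card := by
    refine Finset.card_le_card_of_injOn
      (fun p => ⟨permuteParts (Equiv.swap x p.2) p.1, p.2⟩) ?_ ?_
    · rintro ⟨Q, z⟩ h
      simp only [Finset.coe_product, Set.mem_prod, Finset.mem_coe, Finset.mem_filter,
        Finset.mem_compl, Finset.mem_union, Finset.mem_insert, Finset.mem_singleton, not_or] at h
      obtain ⟨⟨hQ, hQxy⟩, hzA, hzx, hzy⟩ := h
      simp only [Finset.mem_coe, Finset.mem_sigma]
      refine ⟨hA Q hQ x hx z hzA, ?_⟩
      rw [mem_partOf, samePart_permuteParts]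
      simp only [Equiv.symm_swap, Equiv.swap_apply_right]
      rw [Equiv.swap_apply_of_ne_of_ne hxy.symm (Ne.symm hzy)]
      exact hQxy.symm
    · rintro ⟨Q, z⟩ _ ⟨Q', z'⟩ _ h
      simp only [Sigma.mk.injEq, heq_eq_eq] at h
      obtain ⟨h1, rfl⟩ := h
      rw [permuteParts_injective _ h1]
  rw [Finset.card_product, Finset.card_sigma, Finset.card_compl, Fintype.card_fin,
    Finset.sum_congr rfl fun Q hQ => (hY Q hQ).card_partOf y, Finset.sum_const,
    smul_eq_mul] at hmain
  have h1 : (A ∪ {x, y}).card ≤ A.card + 2 :=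
    (Finset.card_union_le _ _).trans (by gcongr; exact Finset.card_le_two)
  have h2 : k * ℓ ≤ 2 * (k * ℓ - (A ∪ {x, y}).card) := by omega
  calc _ ≤ (Y.filter fun Q => SamePart Q x y).card * (2 * (k * ℓ - (A ∪ {x, y}).card)) := by gcongr
    _ = 2 * ((Y.filter fun Q => SamePart Q x y).card * (k * ℓ - (A ∪ {x, y}).card)) := by ring
    _ ≤ 2 * (Y.card * k) := by gcongr
    _ = _ := by ring

theorem samePart_permuteParts_swap_of_ne {Q : Finset (Finset (Fin n))} {x z a b : Fin n}
    (hax : a ≠ x) (haz : a ≠ z) (hbx : b ≠ x) (hbz : b ≠ z) :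
    SamePart (permuteParts (Equiv.swap x z) Q) a b ↔ SamePart Q a b := by
  rw [samePart_permuteParts, Equiv.symm_swap, Equiv.swap_apply_of_ne_of_ne hax haz,
    Equiv.swap_apply_of_ne_of_ne hbx hbz]

theorem permuteParts_swap_mem_canonPartial {T : Finset (Fin (k * ℓ))} (hT : T.Nonempty)
    {Q : Finset (Finset (Fin (k * ℓ)))} (hQ : Q ∈ canonPartial k ℓ T) {x z : Fin (k * ℓ)}
    (hx : x ∉ T) (hz : z ∉ T) : permuteParts (Equiv.swap x z) Q ∈ canonPartial k ℓ T := by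
  rw [mem_canonPartial hT] at hQ ⊢
  refine ⟨hQ.1.permuteParts _, fun a ha b hb => ?_⟩
  rw [samePart_permuteParts_swap_of_ne] <;>
    first | exact hQ.2 a ha b hb | (rintro rfl; contradiction)

/-- Few members of a canonical family have a second `t`-set inside a part. -/
theorem card_canonPartial_together_mul_le {T S : Finset (Fin (k * ℓ))} (ht : 2 ≤ t)
    (hT : T.card = t) (hS : S.card = t) (hTS : S ≠ T) (hn : 2 * (t + 2) ≤ k * ℓ) :
    ((canonPartial k ℓ T).filter fun Q => Together Q S).card * (k * ℓ) ≤
      2 * k * (canonPartial k ℓ T).card := by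
  have hTne : T.Nonempty := Finset.card_pos.1 (by omega)
  obtain ⟨x, hxS, hxT⟩ : ∃ x ∈ S, x ∉ T := by
    by_contra! h
    exact hTS (Finset.eq_of_subset_of_card_le h (by omega))
  obtain ⟨y, hy, hyx⟩ := Finset.exists_mem_ne (by omega : 1 < S.card) x
  refine le_trans ?_ (card_filter_samePart_mul_le (canonPartial k ℓ T)
    (fun Q hQ => ((mem_canonPartial hTne).1 hQ).1) T
    (fun Q hQ x hx z hz => permuteParts_swap_mem_canonPartial hTne hQ hx hz) hxT hyx.symm
    (by rw [hT]; exact hn))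
  gcongr with Q hQ
  exact fun h => h x hxS y hy

/-- The family of all `(k,ℓ)`-partitions is weakly spread over small sets of pairs. -/
theorem card_containing_mul_pow_le_of_small (B : ℕ) (hB : 1 ≤ B) (hn : 8 ≤ k * ℓ)
    (hkB : 2 * k * B ^ (2 * k) ≤ k * ℓ) (s : ℕ) :
    ∀ S : Finset (Fin (k * ℓ) × Fin (k * ℓ)), S.card = s → 8 * S.card ≤ k * ℓ →
    ((klPartitions k ℓ).filter fun Q => S ⊆ partEdges Q).card * B ^ S.card ≤
      (klPartitions k ℓ).card := by
  induction s using Nat.strong_induction_on with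
  | _ s ih =>
    intro S hSs hS
    rcases S.eq_empty_or_nonempty with rfl | ⟨⟨x, y⟩, hxyS⟩
    · simp
    rcases ((klPartitions k ℓ).filter fun Q => S ⊆ partEdges Q).eq_empty_or_nonempty with
      h | ⟨Q₀, hQ₀⟩
    · simp [h]
    obtain ⟨hQ₀, hSQ₀⟩ := Finset.mem_filter.1 hQ₀
    rw [mem_klPartitions] at hQ₀
    have hxy : x ≠ y := (mem_partEdges.1 (hSQ₀ hxyS)).1
    set S₁ := S.filter fun e => e.1 ≠ x ∧ e.2 ≠ x with hS₁
    have hlt : S₁.card < S.card := Finset.card_lt_card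
      (Finset.filter_ssubset.2 ⟨(x, y), hxyS, by simp⟩)
    have hcard : S.card ≤ S₁.card + 2 * k := by
      have hsub : S ⊆ S₁ ∪ ((partOf Q₀ x).image (fun y => (x, y)) ∪
          (partOf Q₀ x).image (fun y => (y, x))) := by
        rintro ⟨a, b⟩ hab
        have hab' := (mem_partEdges.1 (hSQ₀ hab)).2
        simp only [hS₁, Finset.mem_union, Finset.mem_filter, Finset.mem_image, Prod.mk.injEq,
          mem_partOf]
        by_cases ha : a = x
        · subst ha
          exact Or.inr (Or.inl ⟨b, hab', rfl, rfl⟩)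
        · by_cases hb : b = x
          · subst hb
            exact Or.inr (Or.inr ⟨a, hab'.symm, rfl, rfl⟩)
          · exact Or.inl ⟨hab, ha, hb⟩
      have h1 := (Finset.card_le_card hsub).trans (Finset.card_union_le _ _)
      have h2 := Finset.card_union_le ((partOf Q₀ x).image (fun y => (x, y)))
        ((partOf Q₀ x).image (fun y => (y, x)))
      have h3 := Finset.card_image_le (s := partOf Q₀ x) (f := fun y => (x, y))
      have h4 := Finset.card_image_le (s := partOf Q₀ x) (f := fun y => (y, x))
      rw [hQ₀.card_partOf x] at h3 h4
      omega
    have hIH := ih S₁.card (hSs ▸ hlt) S₁ rfl (by omega)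
    set A := S₁.image Prod.fst ∪ S₁.image Prod.snd with hA
    have hAcard : A.card ≤ 2 * S₁.card := by
      refine (Finset.card_union_le _ _).trans ?_
      have h2 := Finset.card_image_le (s := S₁) (f := Prod.fst)
      have h3 := Finset.card_image_le (s := S₁) (f := Prod.snd)
      omega
    have hxA : x ∉ A := by
      simp only [hA, hS₁, Finset.mem_union, Finset.mem_image, Finset.mem_filter, not_or]
      constructor <;> rintro ⟨e, ⟨_, h1, h2⟩, rfl⟩ <;> contradiction
    have hstep := card_filter_samePart_mul_le
      ((klPartitions k ℓ).filter fun Q => S₁ ⊆ partEdges Q)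
      (fun Q hQ => mem_klPartitions.1 (Finset.mem_filter.1 hQ).1) A (by
        intro Q hQ u hu v hv
        rw [Finset.mem_filter, mem_klPartitions] at hQ ⊢
        refine ⟨hQ.1.permuteParts _, fun e he => ?_⟩
        have he' := mem_partEdges.1 (hQ.2 he)
        have h1 : e.1 ∈ A := Finset.mem_union_left _ (Finset.mem_image_of_mem _ he)
        have h2 : e.2 ∈ A := Finset.mem_union_right _ (Finset.mem_image_of_mem _ he)
        refine mem_partEdges.2 ⟨he'.1, ?_⟩
        exact (samePart_permuteParts_swap_of_ne (ne_of_mem_of_not_mem h1 hu)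
          (ne_of_mem_of_not_mem h1 hv)
          (ne_of_mem_of_not_mem h2 hu) (ne_of_mem_of_not_mem h2 hv)).2 he'.2) hxA hxy (by omega)
    set a := ((klPartitions k ℓ).filter fun Q => S ⊆ partEdges Q).card
    set b := ((klPartitions k ℓ).filter fun Q => S₁ ⊆ partEdges Q).card
    have hab : a * (k * ℓ) ≤ 2 * k * b := by
      refine le_trans (Nat.mul_le_mul_right _ (Finset.card_le_card ?_)) hstep
      intro Q hQ
      simp only [Finset.mem_filter] at hQ ⊢
      exact ⟨⟨hQ.1, (Finset.filter_subset _ _).trans hQ.2⟩, (mem_partEdges.1 (hQ.2 hxyS)).2⟩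
    refine Nat.le_of_mul_le_mul_right (c := k * ℓ) ?_ (by omega)
    calc a * B ^ S.card * (k * ℓ) = a * (k * ℓ) * B ^ S.card := by ring
      _ ≤ (2 * k * b) * B ^ (S₁.card + 2 * k) := by gcongr
      _ = b * B ^ S₁.card * (2 * k * B ^ (2 * k)) := by ring
      _ ≤ _ := Nat.mul_le_mul hIH hkB

/-- The family of all `(k,ℓ)`-partitions is weakly spread. -/
theorem card_containing_mul_pow_le (R : ℕ) (hR : 1 ≤ R) (hn : 8 ≤ k * ℓ)
    (hkR : 2 * k * R ^ (32 * k ^ 2) ≤ k * ℓ) (S : Finset (Fin (k * ℓ) × Fin (k * ℓ))) :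
    ((klPartitions k ℓ).filter fun Q => S ⊆ partEdges Q).card * R ^ S.card ≤
      (klPartitions k ℓ).card := by
  rcases ((klPartitions k ℓ).filter fun Q => S ⊆ partEdges Q).eq_empty_or_nonempty with
      h | ⟨Q₀, hQ₀⟩
  · simp [h]
  obtain ⟨hQ₀, hSQ₀⟩ := Finset.mem_filter.1 hQ₀
  rw [mem_klPartitions] at hQ₀
  have hScard := (Finset.card_le_card hSQ₀).trans hQ₀.card_partEdges_le
  have hk : 0 < k := Nat.pos_of_ne_zero (by rintro rfl; simp at hn)
  obtain ⟨S₀, hS₀, h8, h16⟩ : ∃ S₀ ⊆ S, 8 * S₀.card ≤ k * ℓ ∧ S.card ≤ 16 * k * S₀.card := by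
    by_cases h : 8 * S.card ≤ k * ℓ
    · exact ⟨S, subset_rfl, h, by nlinarith⟩
    · obtain ⟨S₀, hS₀, hc⟩ := Finset.exists_subset_card_eq (by omega : k * ℓ / 8 ≤ S.card)
      refine ⟨S₀, hS₀, by omega, hScard.trans ?_⟩
      rw [hc]
      have : k * ℓ ≤ 16 * (k * ℓ / 8) := by omega
      nlinarith
  have hmain := card_containing_mul_pow_le_of_small (R ^ (16 * k)) (Nat.one_le_pow _ _ hR) hn
    (by rw [← pow_mul, show 16 * k * (2 * k) = 32 * k ^ 2 by ring]; exact hkR) _ S₀ rfl h8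
  refine le_trans ?_ hmain
  rw [← pow_mul]
  gcongr with Q hQ

/-- Double counting gives a lower bound for canonical families. -/
theorem card_klPartitions_le_mul (ht : 1 ≤ t) (htk : t ≤ k) {T : Finset (Fin (k * ℓ))}
    (hT : T.card = t) :
    (klPartitions k ℓ).card ≤ (k * ℓ) ^ t * (canonPartial k ℓ T).card := by
  have hsub : klPartitions k ℓ ⊆
      (Finset.univ.powersetCard t).biUnion fun T' => canonPartial k ℓ T' := by
    intro Q hQ
    rw [mem_klPartitions] at hQ
    obtain ⟨x, -⟩ : T.Nonempty := Finset.card_pos.1 (by omega)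
    obtain ⟨p, hp, -⟩ := hQ.1.2.2 x
    obtain ⟨T', hT', hc⟩ := Finset.exists_subset_card_eq (htk.trans (hQ.2.2 p hp).ge)
    simp only [Finset.mem_biUnion, Finset.mem_powersetCard, Finset.subset_univ, true_and]
    exact ⟨T', hc, by simpa [canonPartial] using ⟨hQ, p, hp, hT'⟩⟩
  refine (Finset.card_le_card hsub).trans ((Finset.card_biUnion_le_card_mul _ _
    (canonPartial k ℓ T).card fun T' hT' => ?_).trans ?_)
  · exact card_canonPartial_le_of_card_eq ((Finset.mem_powersetCard.1 hT').2.trans hT.symm)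
  · gcongr
    rw [Finset.card_powersetCard, Finset.card_univ, Fintype.card_fin]
    exact Nat.choose_le_pow _ _

end Partitions

section Derangement

variable {n k ℓ t : ℕ}

/-- The `t`-sets lying inside a part of each of two partitions. -/
noncomputable def commonSets (t : ℕ) (P Q : Finset (Finset (Fin n))) : Finset (Finset (Fin n)) :=
  (Finset.univ.powersetCard t).filter fun S => Together P S ∧ Together Q S

theorem mem_commonSets {P Q : Finset (Finset (Fin n))} {S : Finset (Fin n)} :
    S ∈ commonSets t P Q ↔ S.card = t ∧ Together P S ∧ Together Q S := by
  simp [commonSets, Finset.mem_powersetCard]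

/-- If some `t`-set is common to `P` and `Q`, exchanging a suitable point of it with almost any
other point destroys a common `t`-set without creating new ones. -/
theorem exists_switch {P Q : Finset (Finset (Fin (k * ℓ)))} {T : Finset (Fin (k * ℓ))}
    (ht : 2 ≤ t) (hT : T.card = t) (hP : IsKLPartition k ℓ P) (hPT : ¬ Together P T)
    (hQ : Q ∈ canonPartial k ℓ T) (hPQ : (commonSets t P Q).Nonempty) :
    ∃ x, ∃ B : Finset (Fin (k * ℓ)), B.card ≤ 2 * k ^ 2 + t ∧ ∀ z ∉ B,
      permuteParts (Equiv.swap x z) Q ∈ canonPartial k ℓ T ∧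
      commonSets t P (permuteParts (Equiv.swap x z) Q) ⊂ commonSets t P Q ∧
      ∃ y, SamePart P x y ∧ SamePart (permuteParts (Equiv.swap x z) Q) z y := by
  have hTne : T.Nonempty := Finset.card_pos.1 (by omega)
  have hQ' := ((mem_canonPartial hTne).1 hQ).1
  obtain ⟨S, hS⟩ := hPQ
  obtain ⟨hSt, hPS, hQS⟩ := mem_commonSets.1 hS
  obtain ⟨x, hxS, hxT⟩ : ∃ x ∈ S, x ∉ T := by
    by_contra! h
    exact hPT ((Finset.eq_of_subset_of_card_le h (by omega)) ▸ hPS)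
  obtain ⟨y, hy, hyx⟩ := Finset.exists_mem_ne (by omega : 1 < S.card) x
  refine ⟨x, ((partOf P x).biUnion (partOf Q) ∪ (partOf Q x).biUnion (partOf P)) ∪ T, ?_, ?_⟩
  · have h1 : ((partOf P x).biUnion (partOf Q)).card ≤ k * k := by
      simpa [hP.card_partOf] using Finset.card_biUnion_le_card_mul (partOf P x) (partOf Q) k
        fun w _ => (hQ'.card_partOf w).le
    have h2 : ((partOf Q x).biUnion (partOf P)).card ≤ k * k := by
      simpa [hQ'.card_partOf] using Finset.card_biUnion_le_card_mul (partOf Q x) (partOf P) k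
        fun w _ => (hP.card_partOf w).le
    refine (Finset.card_union_le _ _).trans ?_
    refine (Nat.add_le_add_right (Finset.card_union_le _ _) _).trans ?_
    rw [hT]
    nlinarith
  · intro z hz
    simp only [Finset.mem_union, Finset.mem_biUnion, mem_partOf, not_or, not_exists,
      not_and] at hz
    obtain ⟨⟨hz1, hz2⟩, hzT⟩ := hz
    have hzQ : ¬ SamePart Q x z := hz1 x (hP.1.samePart_refl x)
    have hzP : ¬ SamePart P x z := hz2 x (hQ'.1.samePart_refl x)
    have hyz : y ≠ z := by
      rintro rfl
      exact hzQ (hQS x hxS y hy)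
    have hx_not : ∀ S' : Finset (Fin (k * ℓ)), S'.card = t → Together P S' →
        Together (permuteParts (Equiv.swap x z) Q) S' → x ∉ S' := by
      intro S' hS' hPS' hQS' hx
      obtain ⟨u, hu, hux⟩ := Finset.exists_mem_ne (by omega : 1 < S'.card) x
      have huz : u ≠ z := by
        rintro rfl
        exact hzP (hPS' x hx u hu)
      have h := hQS' x hx u hu
      rw [samePart_permuteParts, Equiv.symm_swap, Equiv.swap_apply_left,
        Equiv.swap_apply_of_ne_of_ne hux huz] at h
      exact hz1 u (hPS' x hx u hu) h.symm
    refine ⟨permuteParts_swap_mem_canonPartial hTne hQ hxT hzT, ?_, y, hPS x hxS y hy, ?_⟩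
    · refine (Finset.ssubset_iff_of_subset ?_).2 ⟨S, hS, fun h => ?_⟩
      · intro S' hS'
        obtain ⟨hSt', hPS', hQS'⟩ := mem_commonSets.1 hS'
        have hxS' := hx_not S' hSt' hPS' hQS'
        have hzS' : z ∉ S' := by
          intro hz
          obtain ⟨u, hu, huz⟩ := Finset.exists_mem_ne (by omega : 1 < S'.card) z
          have h := hQS' z hz u hu
          rw [samePart_permuteParts, Equiv.symm_swap, Equiv.swap_apply_right,
            Equiv.swap_apply_of_ne_of_ne (ne_of_mem_of_not_mem hu hxS') huz] at h
          exact hz2 u h (hPS' u hu z hz)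
        refine mem_commonSets.2 ⟨hSt', hPS', fun a ha b hb => ?_⟩
        exact (samePart_permuteParts_swap_of_ne (ne_of_mem_of_not_mem ha hxS')
          (ne_of_mem_of_not_mem ha hzS') (ne_of_mem_of_not_mem hb hxS')
          (ne_of_mem_of_not_mem hb hzS')).1 (hQS' a ha b hb)
      · obtain ⟨h1, h2, h3⟩ := mem_commonSets.1 h
        exact hx_not S h1 h2 h3 hxS
    · rw [samePart_permuteParts, Equiv.symm_swap, Equiv.swap_apply_right,
        Equiv.swap_apply_of_ne_of_ne hyx hyz]
      exact hQS x hxS y hy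

theorem card_commonSets_le_succ {P : Finset (Finset (Fin (k * ℓ)))} {T : Finset (Fin (k * ℓ))}
    (ht : 2 ≤ t) (hT : T.card = t) (hP : IsKLPartition k ℓ P) (hPT : ¬ Together P T)
    (hn : 2 * (2 * k ^ 2 + t) ≤ k * ℓ) (j : ℕ) :
    ((canonPartial k ℓ T).filter fun Q => (commonSets t P Q).card ≤ j + 1).card ≤
      (1 + 2 * k ^ 2) *
        ((canonPartial k ℓ T).filter fun Q => (commonSets t P Q).card ≤ j).card := by
  have hTne : T.Nonempty := Finset.card_pos.1 (by omega)
  set A := (canonPartial k ℓ T).filter fun Q => (commonSets t P Q).card ≤ j with hA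
  set X := (canonPartial k ℓ T).filter fun Q => (commonSets t P Q).card = j + 1 with hX
  have hsplit : ((canonPartial k ℓ T).filter fun Q => (commonSets t P Q).card ≤ j + 1).card ≤
      A.card + X.card := by
    refine le_trans (Finset.card_le_card ?_) (Finset.card_union_le _ _)
    intro Q hQ
    simp only [hA, hX, Finset.mem_union, Finset.mem_filter] at hQ ⊢
    obtain ⟨h1, h2⟩ := hQ
    rcases Nat.le_or_eq_of_le_succ h2 with h | h
    · exact Or.inl ⟨h1, h⟩
    · exact Or.inr ⟨h1, h⟩
  have hsw : ∀ Q : {Q // Q ∈ X}, ∃ x, ∃ B : Finset (Fin (k * ℓ)), B.card ≤ 2 * k ^ 2 + t ∧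
      ∀ z ∉ B, permuteParts (Equiv.swap x z) Q.1 ∈ canonPartial k ℓ T ∧
      commonSets t P (permuteParts (Equiv.swap x z) Q.1) ⊂ commonSets t P Q.1 ∧
      ∃ y, SamePart P x y ∧ SamePart (permuteParts (Equiv.swap x z) Q.1) z y := by
    rintro ⟨Q, hQ⟩
    simp only [hX, Finset.mem_filter] at hQ
    obtain ⟨hQ, hc⟩ := hQ
    exact exists_switch ht hT hP hPT hQ (Finset.card_pos.1 (hc ▸ Nat.succ_pos j))
  choose x B hB hz using hsw
  have hinj : (X.attach.sigma fun Q => (B Q)ᶜ).card ≤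
      (A.sigma fun Q' => Finset.univ.sigma fun y : Fin (k * ℓ) =>
        partOf P y ×ˢ partOf Q' y).card := by
    choose! y hy using fun Q z (h : z ∉ B Q) => (hz Q z h).2.2
    refine Finset.card_le_card_of_injOn
      (fun p => ⟨permuteParts (Equiv.swap (x p.1) p.2) p.1.1, y p.1 p.2, (x p.1, p.2)⟩) ?_ ?_
    · rintro ⟨Q, z⟩ h
      simp only [Finset.mem_coe, Finset.mem_sigma, Finset.mem_attach, true_and,
        Finset.mem_compl] at h
      have h1 := hz Q z h
      have h2 := hy Q z h
      have h3 := Finset.card_lt_card h1.2.1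
      have h4 := (Finset.mem_filter.1 Q.2).2
      simp only [hA, Finset.mem_coe, Finset.mem_sigma, Finset.mem_filter, Finset.mem_univ,
        true_and, Finset.mem_product, mem_partOf]
      exact ⟨⟨h1.1, by omega⟩, h2.1.symm, h2.2.symm⟩
    · rintro ⟨Q, z⟩ _ ⟨Q', z'⟩ _ h
      simp only [Sigma.mk.injEq, heq_eq_eq, Prod.mk.injEq] at h
      obtain ⟨h1, -, h2, rfl⟩ := h
      rw [← h2] at h1
      rw [Subtype.ext (permuteParts_injective _ h1)]
  rw [Finset.card_sigma, Finset.card_sigma] at hinj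
  have hlow : X.card * (k * ℓ) ≤ 2 * ∑ Q ∈ X.attach, ((B Q)ᶜ).card := by
    rw [Finset.mul_sum, ← Finset.card_attach, ← smul_eq_mul]
    refine Finset.card_nsmul_le_sum _ _ _ fun Q _ => ?_
    rw [Finset.card_compl, Fintype.card_fin]
    have := hB Q
    omega
  have hup : (∑ Q' ∈ A, (Finset.univ.sigma fun y : Fin (k * ℓ) =>
      partOf P y ×ˢ partOf Q' y).card) ≤ A.card * (k * ℓ * (k * k)) := by
    refine (Finset.sum_le_card_nsmul _ _ _ fun Q' hQ' => ?_).trans_eq (smul_eq_mul _ _)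
    have hQ' := ((mem_canonPartial hTne).1 (Finset.mem_filter.1 hQ').1).1
    simp [Finset.card_sigma, Finset.card_product, hP.card_partOf, hQ'.card_partOf]
  have hn0 : 0 < k * ℓ := by omega
  have hXA : X.card ≤ 2 * k ^ 2 * A.card := by
    refine Nat.le_of_mul_le_mul_right (c := k * ℓ) ?_ hn0
    calc _ ≤ 2 * (A.card * (k * ℓ * (k * k))) := hlow.trans (by gcongr; exact hinj.trans hup)
      _ = _ := by ring
  linarith

/-- A partition outside a canonical family misses a positive proportion of the family. -/
theorem card_canonPartial_le_mul_card_commonSets_eq_empty {P : Finset (Finset (Fin (k * ℓ)))}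
    {T : Finset (Fin (k * ℓ))} (ht : 2 ≤ t) (hT : T.card = t) (hP : IsKLPartition k ℓ P)
    (hPT : ¬ Together P T) (hn : 2 * (2 * k ^ 2 + t) ≤ k * ℓ) (hn' : 2 * (t + 2) ≤ k * ℓ) :
    (canonPartial k ℓ T).card ≤ 2 * (1 + 2 * k ^ 2) ^ (k * 2 ^ (k + 2)) *
      ((canonPartial k ℓ T).filter fun Q => commonSets t P Q = ∅).card := by
  set C := canonPartial k ℓ T with hC
  have hn0 : 0 < k * ℓ := by omega
  have hfirst : ∑ Q ∈ C, (commonSets t P Q).card ≤ k * 2 ^ (k + 1) * C.card := by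
    set 𝒮 := (Finset.univ.powersetCard t).filter (Together P) with h𝒮
    have h1 : ∑ Q ∈ C, (commonSets t P Q).card =
        ∑ S ∈ 𝒮, (C.filter fun Q => Together Q S).card := by
      simp only [commonSets, ← Finset.filter_filter]
      exact Finset.sum_card_bipartiteAbove_eq_sum_card_bipartiteBelow (fun Q S => Together Q S)
    have h2 : 𝒮.card ≤ k * ℓ * 2 ^ k := by
      have : 𝒮 ⊆ Finset.univ.biUnion fun x => (partOf P x).powerset := by
        intro S hS
        obtain ⟨hS, hPS⟩ := Finset.mem_filter.1 hS
        obtain ⟨x, hx⟩ : S.Nonempty :=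
          Finset.card_pos.1 (by have := (Finset.mem_powersetCard.1 hS).2; omega)
        simp only [Finset.mem_biUnion, Finset.mem_univ, true_and, Finset.mem_powerset]
        exact ⟨x, fun y hy => mem_partOf.2 (hPS x hx y hy)⟩
      refine (Finset.card_le_card this).trans
        ((Finset.card_biUnion_le_card_mul _ _ (2 ^ k) ?_).trans ?_)
      · intro x _
        rw [Finset.card_powerset, hP.card_partOf]
      · simp
    refine Nat.le_of_mul_le_mul_right (c := k * ℓ) ?_ hn0
    rw [h1, Finset.sum_mul]
    calc _ ≤ 𝒮.card • (2 * k * C.card) := by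
          refine Finset.sum_le_card_nsmul _ _ _ fun S hS => ?_
          obtain ⟨hS, hPS⟩ := Finset.mem_filter.1 hS
          exact card_canonPartial_together_mul_le ht hT (Finset.mem_powersetCard.1 hS).2
            (by rintro rfl; exact hPT hPS) hn'
      _ ≤ (k * ℓ * 2 ^ k) * (2 * k * C.card) := by rw [smul_eq_mul]; gcongr
      _ = _ := by ring
  have hhalf : C.card ≤ 2 * (C.filter fun Q => (commonSets t P Q).card ≤ k * 2 ^ (k + 2)).card := by
    have h1 := Finset.card_filter_add_card_filter_not (s := C)
      (fun Q => (commonSets t P Q).card ≤ k * 2 ^ (k + 2))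
    set X := C.filter fun Q => ¬ (commonSets t P Q).card ≤ k * 2 ^ (k + 2) with hX
    have h2 : X.card * (k * 2 ^ (k + 2)) ≤ k * 2 ^ (k + 1) * C.card := by
      refine le_trans ?_ ((Finset.sum_le_sum_of_subset (Finset.filter_subset
        (fun Q => ¬ (commonSets t P Q).card ≤ k * 2 ^ (k + 2)) C)).trans hfirst)
      rw [← smul_eq_mul]
      refine Finset.card_nsmul_le_sum _ _ _ fun Q hQ => ?_
      have := (Finset.mem_filter.1 hQ).2
      omega
    have hk : 0 < k * 2 ^ (k + 1) := by
      have : 0 < k := Nat.pos_of_mul_pos_right hn0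
      positivity
    have h3 : 2 * X.card ≤ C.card := by
      refine le_of_mul_le_mul_left ?_ hk
      calc _ = X.card * (k * 2 ^ (k + 2)) := by ring
        _ ≤ _ := h2
    omega
  have hiter : ∀ j, (C.filter fun Q => (commonSets t P Q).card ≤ j).card ≤
      (1 + 2 * k ^ 2) ^ j * (C.filter fun Q => commonSets t P Q = ∅).card := by
    intro j
    induction j with
    | zero => simp
    | succ j ih =>
      refine (card_commonSets_le_succ ht hT hP hPT hn j).trans ?_
      calc _ ≤ (1 + 2 * k ^ 2) * ((1 + 2 * k ^ 2) ^ j *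
            (C.filter fun Q => commonSets t P Q = ∅).card) := by gcongr
        _ = _ := by ring
  calc _ ≤ _ := hhalf
    _ ≤ 2 * ((1 + 2 * k ^ 2) ^ (k * 2 ^ (k + 2)) *
        (C.filter fun Q => commonSets t P Q = ∅).card) := by gcongr; exact hiter _
    _ = _ := by ring

end Derangement

section Approximation

variable {α β : Type*}

/-- A family that is spread relative to `S` stays spread, with half the spread, after discarding
the members that meet a small set `S'` outside `S`. -/
theorem spread_filter_disjoint (G : Finset β) (E : β → Finset α) (S S' : Finset α) (r : ℕ)
    (hr : 0 < r) (hS' : S'.card ≤ r) (hG : G.Nonempty)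
    (hs : ∀ R, S ⊆ R →
      (G.filter fun b => R ⊆ E b).card * (2 * r) ^ R.card ≤ G.card * (2 * r) ^ S.card)
    (hSE : ∀ b ∈ G, S ⊆ E b) :
    (G.filter fun b => Disjoint (E b \ S) S').Nonempty ∧ ∀ R : Finset α,
      ((G.filter fun b => Disjoint (E b \ S) S').filter fun b => R ⊆ E b \ S).card * r ^ R.card ≤
        (G.filter fun b => Disjoint (E b \ S) S').card := by
  set G' := G.filter fun b => Disjoint (E b \ S) S' with hG'
  have hpos : ∀ m : ℕ, 0 < (2 * r) ^ m := fun m => by positivity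
  have hhalf : G.card ≤ 2 * G'.card := by
    have h1 : G'.card + (G.filter fun b => ¬ Disjoint (E b \ S) S').card = G.card := by
      convert Finset.card_filter_add_card_filter_not (s := G) _
    have h2 : (G.filter fun b => ¬ Disjoint (E b \ S) S').card * (2 * r) ≤ r * G.card := by
      have hsub : (G.filter fun b => ¬ Disjoint (E b \ S) S') ⊆
          (S' \ S).biUnion fun e => G.filter fun b => insert e S ⊆ E b := by
        intro b hb
        obtain ⟨hb, hd⟩ := Finset.mem_filter.1 hb
        obtain ⟨e, he, he'⟩ := Finset.not_disjoint_iff.1 hd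
        obtain ⟨heE, heS⟩ := Finset.mem_sdiff.1 he
        simp only [Finset.mem_biUnion, Finset.mem_filter]
        exact ⟨e, Finset.mem_sdiff.2 ⟨he', heS⟩, hb, Finset.insert_subset heE (hSE b hb)⟩
      refine (Nat.mul_le_mul_right _
        ((Finset.card_le_card hsub).trans Finset.card_biUnion_le)).trans ?_
      rw [Finset.sum_mul]
      refine (Finset.sum_le_card_nsmul _ _ G.card fun e he => ?_).trans ?_
      · have h := hs (insert e S) (Finset.subset_insert _ _)
        rw [Finset.card_insert_of_notMem (Finset.mem_sdiff.1 he).2, pow_succ'] at h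
        refine le_of_mul_le_mul_right ?_ (hpos S.card)
        rw [mul_assoc]
        exact h
      · rw [smul_eq_mul]
        gcongr
        exact (Finset.card_le_card Finset.sdiff_subset).trans hS'
    have h3 : 2 * (G.filter fun b => ¬ Disjoint (E b \ S) S').card ≤ G.card := by
      refine le_of_mul_le_mul_left ?_ hr
      linarith
    omega
  refine ⟨Finset.card_pos.1 (by have := hG.card_pos; omega), fun R => ?_⟩
  rcases R.eq_empty_or_nonempty with rfl | hR
  · simp
  by_cases hRS : Disjoint R S
  · have h := hs (R ∪ S) Finset.subset_union_right
    rw [Finset.card_union_of_disjoint hRS, pow_add, ← mul_assoc] at h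
    have h := le_of_mul_le_mul_right h (hpos _)
    have hle : (G'.filter fun b => R ⊆ E b \ S).card ≤ (G.filter fun b => R ∪ S ⊆ E b).card := by
      refine Finset.card_le_card fun b hb => ?_
      simp only [hG', Finset.mem_filter] at hb ⊢
      exact ⟨hb.1.1, Finset.union_subset (hb.2.trans Finset.sdiff_subset) (hSE b hb.1.1)⟩
    have h2 : 2 ≤ 2 ^ R.card := Nat.le_self_pow hR.card_pos.ne' 2
    have h3 : 2 * ((G'.filter fun b => R ⊆ E b \ S).card * r ^ R.card) ≤ G.card := by
      calc _ ≤ 2 ^ R.card * ((G.filter fun b => R ∪ S ⊆ E b).card * r ^ R.card) := by gcongr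
        _ = (G.filter fun b => R ∪ S ⊆ E b).card * (2 * r) ^ R.card := by rw [mul_pow]; ring
        _ ≤ _ := h
    omega
  · obtain ⟨e, heR, heS⟩ := Finset.not_disjoint_iff.1 hRS
    rw [Finset.filter_eq_empty_iff.2 fun b _ h => (Finset.mem_sdiff.1 (h heR)).2 heS]
    simp

/-- Two families that are spread relative to `S₁` and `S₂` have members that intersect within
both `S₁` and `S₂`. -/
theorem exists_inter_of_spread [Fintype α] (G₁ G₂ : Finset β) (E : β → Finset α)
    (S₁ S₂ : Finset α) (N g J r : ℕ) (hJ : 0 < J) (hg0 : 0 < g) (hg : 32 * J ^ 2 * g ≤ r)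
    (hNg : N < g ^ J) (hS₁ : S₁.card ≤ r) (hS₂ : S₂.card ≤ r)
    (hN₁ : ∀ b ∈ G₁, (E b).card ≤ N) (hN₂ : ∀ b ∈ G₂, (E b).card ≤ N)
    (hG₁ : G₁.Nonempty) (hG₂ : G₂.Nonempty)
    (hs₁ : ∀ R, S₁ ⊆ R →
      (G₁.filter fun b => R ⊆ E b).card * (2 * r) ^ R.card ≤ G₁.card * (2 * r) ^ S₁.card)
    (hs₂ : ∀ R, S₂ ⊆ R →
      (G₂.filter fun b => R ⊆ E b).card * (2 * r) ^ R.card ≤ G₂.card * (2 * r) ^ S₂.card)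
    (hE₁ : ∀ b ∈ G₁, S₁ ⊆ E b) (hE₂ : ∀ b ∈ G₂, S₂ ⊆ E b) :
    ∃ b₁ ∈ G₁, ∃ b₂ ∈ G₂, ∀ e ∈ E b₁, e ∈ E b₂ → e ∈ S₁ ∧ e ∈ S₂ := by
  have hr : 0 < r := lt_of_lt_of_le (by positivity) hg
  obtain ⟨hne₁, hsp₁⟩ := spread_filter_disjoint G₁ E S₁ S₂ r hr hS₂ hG₁ hs₁ hE₁
  obtain ⟨hne₂, hsp₂⟩ := spread_filter_disjoint G₂ E S₂ S₁ r hr hS₁ hG₂ hs₂ hE₂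
  obtain ⟨b₁, hb₁, b₂, hb₂, hd⟩ := exists_disjoint_of_spread
    (G₁.filter fun b => Disjoint (E b \ S₁) S₂) (G₂.filter fun b => Disjoint (E b \ S₂) S₁)
    (fun b => E b \ S₁) (fun b => E b \ S₂) N g J r hJ hg0 hg hNg hne₁
    (fun b hb => (Finset.card_le_card Finset.sdiff_subset).trans (hN₁ b (Finset.mem_filter.1 hb).1))
    hsp₁ hne₂
    (fun b hb => (Finset.card_le_card Finset.sdiff_subset).trans (hN₂ b (Finset.mem_filter.1 hb).1))
    hsp₂
  obtain ⟨hb₁, hd₁⟩ := Finset.mem_filter.1 hb₁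
  obtain ⟨hb₂, hd₂⟩ := Finset.mem_filter.1 hb₂
  refine ⟨b₁, hb₁, b₂, hb₂, fun e he₁ he₂ => ?_⟩
  rw [Finset.disjoint_left] at hd hd₁ hd₂
  have h := @hd e
  have h₁ := @hd₁ e
  have h₂ := @hd₂ e
  simp only [Finset.mem_sdiff] at *
  tauto

/-- Every family of members of a weakly spread ground family is approximated by the up-set of
small sets over which it contains a spread subfamily. -/
theorem exists_spread_approximation [Fintype α] (U F : Finset β) (E : β → Finset α) (ρ q : ℕ)
    (hρ : 1 ≤ ρ) (hFU : F ⊆ U)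
    (hU : ∀ S : Finset α, (U.filter fun b => S ⊆ E b).card * (ρ ^ 2) ^ S.card ≤ U.card) :
    ∃ 𝓢 : Finset (Finset α), (∀ S ∈ 𝓢, S.card ≤ q ∧ ∃ G ⊆ F, G.Nonempty ∧ (∀ b ∈ G, S ⊆ E b) ∧
      ∀ R, S ⊆ R → (G.filter fun b => R ⊆ E b).card * ρ ^ R.card ≤ G.card * ρ ^ S.card) ∧
      (F.filter fun b => ∀ S ∈ 𝓢, ¬ S ⊆ E b).card * ρ ^ q ≤ U.card := by
  refine ⟨Finset.univ.filter fun S => S.card ≤ q ∧ ∃ G ⊆ F, G.Nonempty ∧ (∀ b ∈ G, S ⊆ E b) ∧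
      ∀ R, S ⊆ R → (G.filter fun b => R ⊆ E b).card * ρ ^ R.card ≤ G.card * ρ ^ S.card,
    fun S hS => (Finset.mem_filter.1 hS).2, ?_⟩
  set 𝓢 : Finset (Finset α) := Finset.univ.filter fun S => S.card ≤ q ∧ ∃ G ⊆ F, G.Nonempty ∧
    (∀ b ∈ G, S ⊆ E b) ∧
      ∀ R, S ⊆ R → (G.filter fun b => R ⊆ E b).card * ρ ^ R.card ≤ G.card * ρ ^ S.card with h𝓢
  set F' := F.filter fun b => ∀ S ∈ 𝓢, ¬ S ⊆ E b with hF'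
  rcases F'.eq_empty_or_nonempty with h | hne
  · simp [h]
  obtain ⟨S, -, hmax⟩ := Finset.exists_max_image (Finset.univ : Finset (Finset α))
    (fun S => (F'.filter fun b => S ⊆ E b).card * ρ ^ S.card) Finset.univ_nonempty
  have h0 : F'.card ≤ (F'.filter fun b => S ⊆ E b).card * ρ ^ S.card := by
    simpa using hmax ∅ (Finset.mem_univ _)
  have hSne : (F'.filter fun b => S ⊆ E b).Nonempty := by
    rw [← Finset.card_pos]
    have := hne.card_pos
    exact Nat.pos_of_mul_pos_right (lt_of_lt_of_le this h0)
  have hqS : q < S.card := by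
    by_contra! hSq
    obtain ⟨b, hb⟩ := hSne
    obtain ⟨hb', hbS⟩ := Finset.mem_filter.1 hb
    refine (Finset.mem_filter.1 hb').2 S ?_ hbS
    rw [h𝓢, Finset.mem_filter]
    refine ⟨Finset.mem_univ _, hSq, F'.filter fun b => S ⊆ E b,
      (Finset.filter_subset _ _).trans (Finset.filter_subset _ _), ⟨b, hb⟩,
      fun b hb => (Finset.mem_filter.1 hb).2, fun R hR => ?_⟩
    refine le_trans ?_ (hmax R (Finset.mem_univ _))
    gcongr
    exact Finset.filter_subset _ _
  have hle : (F'.filter fun b => S ⊆ E b).card ≤ (U.filter fun b => S ⊆ E b).card :=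
    Finset.card_le_card (Finset.filter_subset_filter _ ((Finset.filter_subset _ _).trans hFU))
  calc F'.card * ρ ^ q ≤ ((F'.filter fun b => S ⊆ E b).card * ρ ^ S.card) * ρ ^ S.card := by
        gcongr
    _ = (F'.filter fun b => S ⊆ E b).card * (ρ ^ 2) ^ S.card := by rw [← pow_mul]; ring
    _ ≤ (U.filter fun b => S ⊆ E b).card * (ρ ^ 2) ^ S.card := by gcongr
    _ ≤ _ := hU S

end Approximation

section Main

variable {k ℓ t : ℕ}

theorem card_offDiag_subset_le {n : ℕ} (ht : 2 ≤ t) (S : Finset (Fin n × Fin n)) :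
    ((Finset.univ.powersetCard t).filter fun T : Finset (Fin n) => T.offDiag ⊆ S).card ≤
      2 ^ S.card := by
  have hfst : ∀ T : Finset (Fin n), T.card = t → T.offDiag.image Prod.fst = T := by
    intro T hT
    ext x
    simp only [Finset.mem_image, Finset.mem_offDiag, Prod.exists, exists_and_right, exists_eq_right]
    refine ⟨fun ⟨y, h, _⟩ => h, fun hx => ?_⟩
    obtain ⟨y, hy, hyx⟩ := Finset.exists_mem_ne (by omega : 1 < T.card) x
    exact ⟨y, hx, hy, hyx.symm⟩
  rw [← Finset.card_powerset]
  refine Finset.card_le_card_of_injOn Finset.offDiag ?_ ?_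
  · intro T hT
    exact Finset.mem_powerset.2 (Finset.mem_filter.1 hT).2
  · intro T hT T' hT' h
    have h1 := hfst T (Finset.mem_powersetCard.1 (Finset.mem_filter.1 hT).1).2
    have h2 := hfst T' (Finset.mem_powersetCard.1 (Finset.mem_filter.1 hT').1).2
    rw [← h1, ← h2, h]

/-- Scales `g` with `g ^ M ≤ n < g ^ (2 * M)` exist for all large `n`. -/
theorem exists_scale (M g₀ n : ℕ) (hM : M ≠ 0) (hg₀ : 2 ≤ g₀) (hn : g₀ ^ M ≤ n) :
    ∃ g, g₀ ≤ g ∧ g ^ M ≤ n ∧ n < g ^ (2 * M) := by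
  have hex : ∃ m, n < (m + 1) ^ M :=
    ⟨n, (Nat.lt_succ_self n).trans_le (Nat.le_self_pow hM _)⟩
  have hlt := Nat.find_spec hex
  have hmin := fun m => Nat.find_min hex (m := m)
  set g := Nat.find hex
  have hg : g₀ ≤ g := by
    by_contra! h
    exact absurd (hlt.trans_le (Nat.pow_le_pow_left h M)) (by omega)
  refine ⟨g, hg, ?_, ?_⟩
  · have h := hmin (g - 1) (by omega)
    rw [Nat.sub_add_cancel (by omega)] at h
    exact not_lt.1 h
  · refine hlt.trans_le ?_
    rw [pow_mul]
    exact Nat.pow_le_pow_left (by nlinarith) M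

/-- When a set system `𝓢` of pairs approximates `F`, any two of
its members sharing the pairs of some `t`-set, then `F` is small or canonical. -/
theorem card_lt_or_subset_canonPartial (q : ℕ) (ht : 2 ≤ t)
    (F : Finset (Finset (Finset (Fin (k * ℓ)))))
    (hF : ∀ P ∈ F, IsKLPartition k ℓ P)
    (hFt : ∀ P ∈ F, ∀ Q ∈ F, ∃ p ∈ P, ∃ q ∈ Q, t ≤ (p ∩ q).card)
    {T : Finset (Fin (k * ℓ))} (hT : T.card = t) (hC : 0 < (canonPartial k ℓ T).card)
    (𝓢 : Finset (Finset (Fin (k * ℓ) × Fin (k * ℓ)))) (hq : ∀ S ∈ 𝓢, S.card ≤ q)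
    (h𝓢 : ∀ S₁ ∈ 𝓢, ∀ S₂ ∈ 𝓢, ∃ T' : Finset (Fin (k * ℓ)), T'.card = t ∧ T'.offDiag ⊆ S₁ ∩ S₂)
    (hsmall : (F.filter fun P => ∀ S ∈ 𝓢, ¬ S ⊆ partEdges P).card * (k * ℓ) ≤
      (canonPartial k ℓ T).card)
    (hn : 2 * (2 * k ^ 2 + t) ≤ k * ℓ) (hn' : 2 * (t + 2) ≤ k * ℓ)
    (hK : 2 * (1 + 2 * k ^ 2) ^ (k * 2 ^ (k + 2)) < k * ℓ)
    (hq' : 1 + 2 ^ q * 2 ^ q * (2 * k) < k * ℓ) :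
    F.card < (canonPartial k ℓ T).card ∨
      ∃ T' : Finset (Fin (k * ℓ)), T'.card = t ∧ F ⊆ canonPartial k ℓ T' := by
  set F' := F.filter fun P => ∀ S ∈ 𝓢, ¬ S ⊆ partEdges P with hF'
  have hTogether : ∀ P ∈ F, ∀ S ⊆ partEdges P, ∀ T' : Finset (Fin (k * ℓ)), T'.offDiag ⊆ S →
      Together P T' := fun P hP S hS T' hT' =>
    (hF P hP).1.offDiag_subset_partEdges.1 (hT'.trans hS)
  by_cases hcase : ∃ T' : Finset (Fin (k * ℓ)), T'.card = t ∧ ∀ S ∈ 𝓢, T'.offDiag ⊆ S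
  · obtain ⟨T', hT', hTS⟩ := hcase
    have hTne : T'.Nonempty := Finset.card_pos.1 (by omega)
    have hCeq := card_canonPartial_congr (hT.trans hT'.symm)
    by_cases hsub : F ⊆ canonPartial k ℓ T'
    · exact Or.inr ⟨T', hT', hsub⟩
    left
    obtain ⟨P, hP, hPC⟩ := Finset.not_subset.1 hsub
    have hPT : ¬ Together P T' := fun h => hPC ((mem_canonPartial hTne).2 ⟨hF P hP, h⟩)
    have hder := card_canonPartial_le_mul_card_commonSets_eq_empty ht hT' (hF P hP) hPT hn hn'
    have hout : F \ canonPartial k ℓ T' ⊆ F' := by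
      intro Q hQ
      obtain ⟨hQ, hQC⟩ := Finset.mem_sdiff.1 hQ
      refine Finset.mem_filter.2 ⟨hQ, fun S hS hSQ => hQC ?_⟩
      exact (mem_canonPartial hTne).2 ⟨hF Q hQ, hTogether Q hQ S hSQ T' (hTS S hS)⟩
    have hin : F ∩ canonPartial k ℓ T' ⊆
        (canonPartial k ℓ T').filter fun Q => ¬ commonSets t P Q = ∅ := by
      intro Q hQ
      obtain ⟨hQ, hQC⟩ := Finset.mem_inter.1 hQ
      refine Finset.mem_filter.2 ⟨hQC, ?_⟩
      obtain ⟨S, hS⟩ := exists_together_of_inter (hFt P hP Q hQ)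
      exact Finset.ne_empty_of_mem (mem_commonSets.2 hS)
    have hc1 := Finset.card_le_card hout
    have hc2 := Finset.card_le_card hin
    have hc3 := Finset.card_filter_add_card_filter_not (s := canonPartial k ℓ T')
      (fun Q => commonSets t P Q = ∅)
    have hc4 := Finset.card_inter_add_card_sdiff F (canonPartial k ℓ T')
    have hF'pos : 0 < F'.card :=
      Finset.card_pos.2 ⟨P, hout (Finset.mem_sdiff.2 ⟨hP, hPC⟩)⟩
    set m := ((canonPartial k ℓ T').filter fun Q => commonSets t P Q = ∅).card
    have hlt : F'.card < m := by
      set K := 2 * (1 + 2 * k ^ 2) ^ (k * 2 ^ (k + 2))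
      refine lt_of_mul_lt_mul_left (a := K) ?_ (Nat.zero_le _)
      calc K * F'.card < k * ℓ * F'.card := by gcongr
        _ ≤ _ := by linarith
    omega
  · left
    push Not at hcase
    obtain ⟨S₀, hS₀, -⟩ := hcase T hT
    choose! f hf𝓢 hf using hcase
    have hcover : F ⊆ F' ∪ ((Finset.univ.powersetCard t).filter fun T₁ : Finset (Fin (k * ℓ)) =>
          T₁.offDiag ⊆ S₀).biUnion fun T₁ =>
        (((Finset.univ.powersetCard t).filter fun T₂ : Finset (Fin (k * ℓ)) =>
          T₂.offDiag ⊆ f T₁).filter fun T₂ => T₂ ≠ T₁).biUnion fun T₂ =>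
        (canonPartial k ℓ T₁).filter fun Q => Together Q T₂ := by
      intro P hP
      by_cases hPF' : P ∈ F'
      · exact Finset.mem_union_left _ hPF'
      refine Finset.mem_union_right _ ?_
      obtain ⟨S, hS, hSP⟩ : ∃ S ∈ 𝓢, S ⊆ partEdges P := by
        by_contra! h
        exact hPF' (Finset.mem_filter.2 ⟨hP, h⟩)
      obtain ⟨T₁, hT₁, h₁⟩ := h𝓢 S hS S₀ hS₀
      obtain ⟨T₂, hT₂, h₂⟩ := h𝓢 S hS (f T₁) (hf𝓢 T₁ hT₁)
      rw [Finset.subset_inter_iff] at h₁ h₂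
      simp only [Finset.mem_biUnion, Finset.mem_filter, Finset.mem_powersetCard,
        Finset.subset_univ, true_and]
      refine ⟨T₁, ⟨hT₁, h₁.2⟩, T₂, ⟨⟨hT₂, h₂.2⟩, ?_⟩, ?_, hTogether P hP S hSP T₂ h₂.1⟩
      · rintro rfl
        exact hf T₂ hT₁ h₂.2
      · exact (mem_canonPartial (Finset.card_pos.1 (by omega))).2
          ⟨hF P hP, hTogether P hP S hSP T₁ h₁.1⟩
    have hcard := (Finset.card_le_card hcover).trans (Finset.card_union_le _ _)
    have hpairs : ((((Finset.univ.powersetCard t).filter fun T₁ : Finset (Fin (k * ℓ)) =>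
          T₁.offDiag ⊆ S₀).biUnion fun T₁ =>
        (((Finset.univ.powersetCard t).filter fun T₂ : Finset (Fin (k * ℓ)) =>
          T₂.offDiag ⊆ f T₁).filter fun T₂ => T₂ ≠ T₁).biUnion fun T₂ =>
        (canonPartial k ℓ T₁).filter fun Q => Together Q T₂)).card * (k * ℓ) ≤
        2 ^ q * (2 ^ q * (2 * k * (canonPartial k ℓ T).card)) := by
      have hpow : ∀ S ∈ 𝓢, ((Finset.univ.powersetCard t).filter
          fun T₁ : Finset (Fin (k * ℓ)) => T₁.offDiag ⊆ S).card ≤ 2 ^ q := fun S hS =>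
        (card_offDiag_subset_le ht S).trans (Nat.pow_le_pow_right (by omega) (hq S hS))
      refine (Nat.mul_le_mul_right _ Finset.card_biUnion_le).trans ?_
      rw [Finset.sum_mul]
      refine (Finset.sum_le_card_nsmul _ _ (2 ^ q * (2 * k * (canonPartial k ℓ T).card))
        fun T₁ hT₁ => ?_).trans ?_
      · obtain ⟨hT₁, -⟩ := Finset.mem_filter.1 hT₁
        have hT₁ := (Finset.mem_powersetCard.1 hT₁).2
        refine (Nat.mul_le_mul_right _ Finset.card_biUnion_le).trans ?_
        rw [Finset.sum_mul]
        refine (Finset.sum_le_card_nsmul _ _ (2 * k * (canonPartial k ℓ T).card)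
          fun T₂ hT₂ => ?_).trans ?_
        · obtain ⟨hT₂, hne⟩ := Finset.mem_filter.1 hT₂
          have hT₂ := (Finset.mem_powersetCard.1 (Finset.mem_filter.1 hT₂).1).2
          rw [card_canonPartial_congr (hT.trans hT₁.symm)]
          exact card_canonPartial_together_mul_le ht hT₁ hT₂ hne hn'
        · rw [smul_eq_mul]
          gcongr
          exact (Finset.card_le_card (Finset.filter_subset _ _)).trans (hpow _ (hf𝓢 T₁ hT₁))
      · rw [smul_eq_mul]
        gcongr
        exact hpow _ hS₀
    refine lt_of_mul_lt_mul_right (a := k * ℓ) ?_ (Nat.zero_le _)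
    calc F.card * (k * ℓ) ≤ (canonPartial k ℓ T).card +
          2 ^ q * (2 ^ q * (2 * k * (canonPartial k ℓ T).card)) := by
          refine (Nat.mul_le_mul_right _ hcard).trans ?_
          rw [add_mul]
          exact Nat.add_le_add hsmall hpairs
      _ = (1 + 2 ^ q * 2 ^ q * (2 * k)) * (canonPartial k ℓ T).card := by ring
      _ < k * ℓ * (canonPartial k ℓ T).card := by gcongr
      _ = _ := by ring

/-- A large partially `t`-intersecting family is contained in a canonical family. -/
theorem exists_forall_card_lt_or_subset_canonPartial (k t : ℕ) (ht : 2 ≤ t) (htk : t ≤ k) :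
    ∃ ℓ₀ : ℕ, ∀ ℓ : ℕ, ℓ₀ ≤ ℓ → ∀ F : Finset (Finset (Finset (Fin (k * ℓ)))), F.Nonempty →
      (∀ P ∈ F, IsKLPartition k ℓ P) →
      (∀ P ∈ F, ∀ Q ∈ F, ∃ p ∈ P, ∃ q ∈ Q, t ≤ (p ∩ q).card) →
      ∀ T : Finset (Fin (k * ℓ)), T.card = t →
        F.card < (canonPartial k ℓ T).card ∨
          ∃ T' : Finset (Fin (k * ℓ)), T'.card = t ∧ F ⊆ canonPartial k ℓ T' := by
  obtain ⟨M, hM⟩ : ∃ M, M = 128 * k ^ 2 + 1 := ⟨_, rfl⟩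
  obtain ⟨J, hJ⟩ : ∃ J, J = 2 * M + 1 := ⟨_, rfl⟩
  obtain ⟨q, hq⟩ : ∃ q, q = 2 * M * (t + 1) := ⟨_, rfl⟩
  obtain ⟨K, hK⟩ : ∃ K, K = 2 * (1 + 2 * k ^ 2) ^ (k * 2 ^ (k + 2)) := ⟨_, rfl⟩
  obtain ⟨D, hD⟩ : ∃ D, D = 1 + 2 ^ q * 2 ^ q * (2 * k) := ⟨_, rfl⟩
  obtain ⟨g₀, hg₀⟩ : ∃ g₀, g₀ = 64 * J ^ 2 + 2 * k + q + 2 := ⟨_, rfl⟩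
  refine ⟨g₀ ^ M + 2 * (2 * k ^ 2 + t) + 2 * (t + 2) + 8 + (K + 1) + (D + 1), ?_⟩
  intro ℓ hℓ F hFne hF hFt T hT
  have hn : ℓ ≤ k * ℓ := Nat.le_mul_of_pos_left _ (by omega)
  obtain ⟨g, hg, hgn, hng⟩ := exists_scale M g₀ (k * ℓ) (by omega) (by omega) (by omega)
  have hg1 : 1 ≤ g := by omega
  obtain ⟨r, hr⟩ : ∃ r, r = 32 * J ^ 2 * g := ⟨_, rfl⟩
  have hJ1 : 1 ≤ J ^ 2 := Nat.one_le_pow _ _ (by omega)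
  have hgr : g ≤ r := by rw [hr]; nlinarith
  have hrg : 2 * r ≤ g ^ 2 := by
    rw [hr, sq g, show 2 * (32 * J ^ 2 * g) = 64 * J ^ 2 * g by ring]
    gcongr
    omega
  have hU := card_containing_mul_pow_le (k := k) (ℓ := ℓ) ((2 * r) ^ 2)
    (Nat.one_le_pow _ _ (by omega)) (by omega) (by
      calc 2 * k * ((2 * r) ^ 2) ^ (32 * k ^ 2) ≤ g * ((g ^ 2) ^ 2) ^ (32 * k ^ 2) := by
            gcongr
            omega
        _ = g ^ M := by rw [hM, ← pow_mul, ← pow_mul, ← pow_succ']; congr 1; ring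
        _ ≤ _ := hgn)
  obtain ⟨𝓢, h𝓢, hF'⟩ := exists_spread_approximation (klPartitions k ℓ) F partEdges (2 * r) q
    (by omega) (fun P hP => mem_klPartitions.2 (hF P hP)) (fun S => by convert hU S)
  have hlow := card_klPartitions_le_mul (by omega) htk hT
  have hC : 0 < (canonPartial k ℓ T).card := by
    obtain ⟨P, hP⟩ := hFne
    have : 0 < (klPartitions k ℓ).card := Finset.card_pos.2 ⟨P, mem_klPartitions.2 (hF P hP)⟩
    exact Nat.pos_of_mul_pos_left (this.trans_le hlow)
  refine card_lt_or_subset_canonPartial q ht F hF hFt hT hC 𝓢 (fun S hS => (h𝓢 S hS).1) ?_ ?_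
    (by omega) (by omega) (by omega) (by omega)
  · intro S₁ hS₁ S₂ hS₂
    obtain ⟨hq₁, G₁, hGF₁, hG₁, hE₁, hs₁⟩ := h𝓢 S₁ hS₁
    obtain ⟨hq₂, G₂, hGF₂, hG₂, hE₂, hs₂⟩ := h𝓢 S₂ hS₂
    obtain ⟨P, hP, Q, hQ, hPQ⟩ := exists_inter_of_spread G₁ G₂ partEdges S₁ S₂ (k * ℓ * k)
      g J r (by omega) (by omega) hr.ge (by
        calc k * ℓ * k ≤ k * ℓ * g := by gcongr; omega
          _ < g ^ (2 * M) * g := by gcongr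
          _ = g ^ J := by rw [hJ, pow_succ]) (by omega) (by omega)
      (fun P hP => (hF P (hGF₁ hP)).card_partEdges_le)
      (fun P hP => (hF P (hGF₂ hP)).card_partEdges_le) hG₁ hG₂ hs₁ hs₂ hE₁ hE₂
    obtain ⟨T', hT', hPT, hQT⟩ := exists_together_of_inter (hFt P (hGF₁ hP) Q (hGF₂ hQ))
    refine ⟨T', hT', fun e he => Finset.mem_inter.2 (hPQ e ?_ ?_)⟩
    · exact (hF P (hGF₁ hP)).1.offDiag_subset_partEdges.2 hPT he
    · exact (hF Q (hGF₂ hQ)).1.offDiag_subset_partEdges.2 hQT he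
  · have hn0 : 0 < (k * ℓ) ^ t := Nat.pow_pos (by omega)
    refine le_of_mul_le_mul_left ?_ hn0
    set F' := F.filter fun P => ∀ S ∈ 𝓢, ¬ S ⊆ partEdges P with hF'def
    have hF'' : F'.card * (2 * r) ^ q ≤ (klPartitions k ℓ).card := by
      rw [hF'def]
      convert hF'
    calc _ = F'.card * (k * ℓ) ^ (t + 1) := by ring
      _ ≤ F'.card * (g ^ (2 * M)) ^ (t + 1) := by gcongr
      _ = F'.card * g ^ q := by rw [← pow_mul, hq]
      _ ≤ F'.card * (2 * r) ^ q := by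
        gcongr
        omega
      _ ≤ _ := hF''.trans hlow

end Main

theorem stmt3 (k t : ℕ) (ht : 1 ≤ t) (htk : t ≤ k) :
    ∃ ℓ₀ : ℕ, ∀ ℓ : ℕ, ℓ₀ ≤ ℓ →
      ∀ 𝓕 : Finset (Finset (Finset (Fin (k * ℓ)))),
        (∀ P ∈ 𝓕, IsKLPartition k ℓ P) →
        -- partially `t`-intersecting
        (∀ P ∈ 𝓕, ∀ Q ∈ 𝓕, ∃ p ∈ P, ∃ q ∈ Q, t ≤ (p ∩ q).card) →
        ∀ T : Finset (Fin (k * ℓ)), T.card = t →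
          𝓕.card ≤ (canonPartial k ℓ T).card ∧
            (𝓕.card = (canonPartial k ℓ T).card ↔
              ∃ T' : Finset (Fin (k * ℓ)), T'.card = t ∧ 𝓕 = canonPartial k ℓ T') := by
  obtain ⟨ℓ₀, hℓ₀⟩ : ∃ ℓ₀ : ℕ, ∀ ℓ : ℕ, ℓ₀ ≤ ℓ →
      ∀ F : Finset (Finset (Finset (Fin (k * ℓ)))), F.Nonempty →
      (∀ P ∈ F, IsKLPartition k ℓ P) →
      (∀ P ∈ F, ∀ Q ∈ F, ∃ p ∈ P, ∃ q ∈ Q, t ≤ (p ∩ q).card) →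
      ∀ T : Finset (Fin (k * ℓ)), T.card = t →
        F.card < (canonPartial k ℓ T).card ∨
          ∃ T' : Finset (Fin (k * ℓ)), T'.card = t ∧ F ⊆ canonPartial k ℓ T' := by
    rcases ht.eq_or_lt with rfl | ht
    · refine ⟨0, fun ℓ _ F _ hF _ T hT => Or.inr ⟨T, hT, fun P hP => ?_⟩⟩
      obtain ⟨x, rfl⟩ := Finset.card_eq_one.1 hT
      refine (mem_canonPartial (Finset.singleton_nonempty x)).2 ⟨hF P hP, fun a ha b hb => ?_⟩
      rw [Finset.mem_singleton.1 ha, Finset.mem_singleton.1 hb]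
      exact (hF P hP).1.samePart_refl x
    · exact exists_forall_card_lt_or_subset_canonPartial k t ht htk
  refine ⟨ℓ₀, fun ℓ hℓ 𝓕 h𝓕 h𝓕t T hT => ?_⟩
  have hcanon : ∀ T' : Finset (Fin (k * ℓ)), T'.card = t →
      (canonPartial k ℓ T').card = (canonPartial k ℓ T).card :=
    fun T' hT' => card_canonPartial_congr (hT'.trans hT.symm)
  have hkey : 𝓕.card < (canonPartial k ℓ T).card ∨
      ∃ T' : Finset (Fin (k * ℓ)), T'.card = t ∧ 𝓕 ⊆ canonPartial k ℓ T' := by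
    rcases 𝓕.eq_empty_or_nonempty with rfl | hne
    · exact Or.inr ⟨T, hT, Finset.empty_subset _⟩
    · exact hℓ₀ ℓ hℓ 𝓕 hne h𝓕 h𝓕t T hT
  have hrev : (∃ T' : Finset (Fin (k * ℓ)), T'.card = t ∧ 𝓕 = canonPartial k ℓ T') →
      𝓕.card = (canonPartial k ℓ T).card := by
    rintro ⟨T', hT', h⟩
    rw [h, hcanon T' hT']
  rcases hkey with hlt | ⟨T', hT', hsub⟩
  · exact ⟨hlt.le, fun h => absurd h hlt.ne, hrev⟩
  · exact ⟨(Finset.card_le_card hsub).trans (hcanon T' hT').le, fun h =>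
      ⟨T', hT', Finset.eq_of_subset_of_card_le hsub ((hcanon T' hT').trans h.symm).le⟩, hrev⟩
end

section
/- For all integers k ≥ t ≥ 1 there exists ℓ₀ = ℓ₀(k,t) such that the following holds for all ℓ ≥ ℓ₀. Let P = (k₁ ≤ … ≤ k_ℓ) be a non-decreasing sequence of positive integers with largest entry k_ℓ = k, and put n = k₁+…+k_ℓ. Then every partially t-intersecting family 𝓕 ⊆ 𝓤_P of maximum size equals 𝓒_P^T for some t-element set T ⊆ [n]. -/
open scoped Classical

namespace PartiallyIntersecting

section Spread

variable {α ι : Type*}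

/-- The sets `h A`, `A ∈ G`, are `R`-spread up to the factor `K`. -/
def IsSpread (G : Finset ι) (h : ι → Finset α) (R K : ℕ) : Prop :=
  ∀ Y : Finset α, (G.filter fun A => Y ⊆ h A).card * R ^ Y.card ≤ K * G.card

/-- Overwriting a colouring on `T` by a constant is at most `|D| ^ |T|`-to-one. -/
lemma card_recolour_le [Fintype α] {D : Type*} [Fintype D] (d : D) (T : Finset α)
    (P : (α → D) → Prop) [DecidablePred P] :
    (Finset.univ.filter fun w : α → D => P fun x => if x ∈ T then d else w x).card ≤
      Fintype.card D ^ T.card * (Finset.univ.filter P).card := by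
  refine Finset.card_le_mul_card_image_of_maps_to
    (f := fun w x => if x ∈ T then d else w x) (by simp) _ fun w' _ => ?_
  have : Fintype.card D ^ T.card = Fintype.card (T → D) := by simp
  rw [this, ← Finset.card_univ]
  refine Finset.card_le_card_of_injOn (fun w x => w x) (by simp) ?_
  intro w hw v hv hwv
  simp only [Finset.coe_filter, Finset.mem_filter, Finset.mem_univ, true_and, Set.mem_ofPred_eq]
    at hw hv
  funext x
  by_cases hx : x ∈ T
  · exact congrFun hwv ⟨x, hx⟩
  · have := congrFun (hw.2.trans hv.2.symm) x
    simpa [hx] using this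

lemma sum_powerset_pow_le (H : Finset α) {L lam m : ℕ} (hL : 0 < L) (hlam : 3 ≤ lam)
    (hm : 0 < m) (hH : H.card ≤ L * m) :
    ∑ T ∈ H.powerset.filter (fun T => m ≤ T.card), (1 / ((L : ℝ) * lam)) ^ T.card ≤ 3 / lam := by
  have hL' : (0 : ℝ) < L := by exact_mod_cast hL
  have hlam' : (3 : ℝ) ≤ lam := by exact_mod_cast hlam
  have h1 : ∀ T ∈ H.powerset.filter (fun T => m ≤ T.card),
      (1 / ((L : ℝ) * lam)) ^ T.card ≤ (1 / (lam : ℝ)) ^ m * (1 / (L : ℝ)) ^ T.card := by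
    intro T hT
    rw [Finset.mem_filter] at hT
    rw [← one_div_mul_one_div, mul_pow, mul_comm]
    gcongr ?_ * _
    exact pow_le_pow_of_le_one (by positivity)
      (by rw [div_le_one (by linarith)]; linarith) hT.2
  calc _ ≤ ∑ T ∈ H.powerset, (1 / (lam : ℝ)) ^ m * (1 / (L : ℝ)) ^ T.card :=
        (Finset.sum_le_sum h1).trans (Finset.sum_le_sum_of_subset_of_nonneg
          (Finset.filter_subset _ _) fun _ _ _ => by positivity)
    _ = (1 / (lam : ℝ)) ^ m * (1 / (L : ℝ) + 1) ^ H.card := by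
        rw [← Finset.mul_sum, ← Finset.sum_pow_mul_eq_add_pow]
        simp
    _ ≤ (1 / (lam : ℝ)) ^ m * Real.exp 1 ^ m := by
        gcongr
        calc (1 / (L : ℝ) + 1) ^ H.card ≤ (Real.exp (1 / L)) ^ (L * m) := by
              refine (pow_le_pow_right₀ (by simp) hH).trans ?_
              gcongr
              exact Real.add_one_le_exp _
          _ = Real.exp 1 ^ m := by
              rw [pow_mul, ← Real.exp_nat_mul]
              congr 2
              field_simp
    _ ≤ (3 / lam) ^ m := by
        rw [← mul_pow]
        gcongr
        rw [one_div_mul_eq_div]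
        gcongr
        exact Real.exp_one_lt_three.le
    _ ≤ 3 / lam := pow_le_of_le_one (by positivity)
          (by rw [div_le_one (by linarith)]; linarith) hm.ne'

/-- One round of the fragment argument: all but a `3 * K / lam` proportion of the pairs
`(w, A)` have a fragment `f w A` (the part of some member of the family that lies inside
`h A` and outside of the random set `{x | w x = d}`) of fewer than `m` elements. -/
lemma exists_fragments [Fintype α] {D : Type*} [Fintype D] (d : D)
    (G : Finset ι) (h : ι → Finset α) {L lam m K : ℕ} (hL : 0 < L) (hlam : 3 ≤ lam)
    (hm : 0 < m) (hh : ∀ A ∈ G, (h A).card ≤ L * m)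
    (hG : IsSpread G h (L * lam * Fintype.card D) K) :
    ∃ f : (α → D) → ι → Finset α,
      (∀ w, ∀ A ∈ G, f w A ⊆ h A ∧ ∃ A' ∈ G, ∀ x ∈ h A', x ∈ f w A ∨ w x = d) ∧
      ((∑ w, (G.filter fun A => m ≤ (f w A).card).card) * lam : ℕ) ≤
        3 * K * G.card * Fintype.card D ^ Fintype.card α := by
  have hex : ∀ (w : α → D) (A : ι), A ∈ G → ∃ A' ∈ G,
      (h A').filter (fun x => w x ≠ d) ⊆ h A ∧
      ∀ B ∈ G, (h B).filter (fun x => w x ≠ d) ⊆ h A →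
        ((h A').filter fun x => w x ≠ d).card ≤ ((h B).filter fun x => w x ≠ d).card := by
    intro w A hA
    obtain ⟨A', hA', hmin⟩ := Finset.exists_min_image
      (G.filter fun B => (h B).filter (fun x => w x ≠ d) ⊆ h A)
      (fun B => ((h B).filter fun x => w x ≠ d).card)
      ⟨A, by simp [hA]⟩
    rw [Finset.mem_filter] at hA'
    exact ⟨A', hA'.1, hA'.2, fun B hB hBA => hmin B (by simp [hB, hBA])⟩
  choose! g hgG hgsub hgmin using hex
  let f : (α → D) → ι → Finset α := fun w A => (h (g w A)).filter fun x => w x ≠ d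
  let hs : (α → D) → Finset α := fun w =>
    if hw : ∃ B ∈ G, ∀ x ∈ h B, w x = d then h hw.choose else ∅
  have hs_card : ∀ w, (hs w).card ≤ L * m := by
    intro w
    by_cases hw : ∃ B ∈ G, ∀ x ∈ h B, w x = d
    · simp only [hs, dif_pos hw]
      exact hh _ hw.choose_spec.1
    · simp [hs, dif_neg hw]
  have hfs : ∀ w, ∀ A ∈ G, f w A ⊆ hs fun x => if x ∈ f w A then d else w x := by
    intro w A hA
    have hw : ∃ B ∈ G, ∀ x ∈ h B, (if x ∈ f w A then d else w x) = d := by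
      refine ⟨g w A, hgG w A hA, fun x hx => ?_⟩
      by_cases hxd : w x = d
      · simp [hxd]
      · simp [f, hx, hxd]
    simp only [hs, dif_pos hw]
    obtain ⟨hBG, hB⟩ := hw.choose_spec
    set B := hw.choose
    have hsub : (h B).filter (fun x => w x ≠ d) ⊆ f w A := by
      intro x hx
      rw [Finset.mem_filter] at hx
      by_contra hxf
      have := hB x hx.1
      rw [if_neg hxf] at this
      exact hx.2 this
    have := Finset.eq_of_subset_of_card_le hsub
      (hgmin w A hA B hBG (hsub.trans (hgsub w A hA)))
    rw [← this]
    exact Finset.filter_subset _ _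
  refine ⟨f, fun w A hA => ⟨hgsub w A hA, g w A, hgG w A hA, fun x hx => ?_⟩, ?_⟩
  · by_cases hxd : w x = d
    · exact Or.inr hxd
    · exact Or.inl (by simp [f, hx, hxd])
  set M := Fintype.card D
  have hM : 0 < M := Fintype.card_pos_iff.2 ⟨d⟩
  have hcount : ∑ w, (G.filter fun A => m ≤ (f w A).card).card ≤
      ∑ w, ∑ T ∈ (hs w).powerset.filter (fun T => m ≤ T.card),
        M ^ T.card * (G.filter fun A => T ⊆ h A).card := by
    calc ∑ w, (G.filter fun A => m ≤ (f w A).card).card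
        = ∑ A ∈ G, ∑ w : α → D, if m ≤ (f w A).card then 1 else 0 := by
          simp only [Finset.card_filter]
          exact Finset.sum_comm
      _ ≤ ∑ A ∈ G, ∑ w : α → D, ∑ T ∈ (h A).powerset.filter (fun T => m ≤ T.card),
            if T ⊆ hs (fun x => if x ∈ T then d else w x) then 1 else 0 := by
          refine Finset.sum_le_sum fun A hA => Finset.sum_le_sum fun w _ => ?_
          split_ifs with hmw
          · have := Finset.single_le_sum (s := (h A).powerset.filter (fun T => m ≤ T.card))
              (f := fun T => if T ⊆ hs (fun x => if x ∈ T then d else w x) then 1 else 0)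
              (fun _ _ => Nat.zero_le _) (a := f w A)
              (by simpa [hmw] using hgsub w A hA)
            simpa [hfs w A hA] using this
          · exact Nat.zero_le _
      _ = ∑ A ∈ G, ∑ T ∈ (h A).powerset.filter (fun T => m ≤ T.card),
            (Finset.univ.filter fun w : α → D =>
              T ⊆ hs (fun x => if x ∈ T then d else w x)).card := by
          refine Finset.sum_congr rfl fun A _ => ?_
          rw [Finset.sum_comm]
          simp only [Finset.card_filter]
      _ ≤ ∑ A ∈ G, ∑ T ∈ (h A).powerset.filter (fun T => m ≤ T.card),
            M ^ T.card * (Finset.univ.filter fun w : α → D => T ⊆ hs w).card :=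
          Finset.sum_le_sum fun A _ => Finset.sum_le_sum fun T _ =>
            card_recolour_le d T fun w => T ⊆ hs w
      _ = ∑ A ∈ G, ∑ T ∈ Finset.univ.filter (fun T => m ≤ T.card), ∑ w : α → D,
            if T ⊆ h A ∧ T ⊆ hs w then M ^ T.card else 0 := by
          refine Finset.sum_congr rfl fun A _ => ?_
          have : (h A).powerset.filter (fun T => m ≤ T.card) =
              (Finset.univ.filter (fun T : Finset α => m ≤ T.card)).filter (fun T => T ⊆ h A) := by
            ext T; simp [and_comm]
          rw [this, Finset.sum_filter]
          refine Finset.sum_congr rfl fun T _ => ?_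
          by_cases hT : T ⊆ h A
          · simp [hT, ← Finset.sum_filter, mul_comm]
          · simp [hT]
      _ = ∑ w, ∑ T ∈ Finset.univ.filter (fun T => m ≤ T.card), ∑ A ∈ G,
            if T ⊆ h A ∧ T ⊆ hs w then M ^ T.card else 0 := by
          rw [Finset.sum_comm]
          conv_rhs => rw [Finset.sum_comm]
          exact Finset.sum_congr rfl fun T _ => Finset.sum_comm
      _ = _ := by
          refine Finset.sum_congr rfl fun w _ => ?_
          have : (hs w).powerset.filter (fun T => m ≤ T.card) =
              (Finset.univ.filter (fun T : Finset α => m ≤ T.card)).filter (fun T => T ⊆ hs w) := by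
            ext T; simp [and_comm]
          rw [this, Finset.sum_filter (p := fun T => T ⊆ hs w)]
          refine Finset.sum_congr rfl fun T _ => ?_
          by_cases hT : T ⊆ hs w
          · simp [hT, ← Finset.sum_filter, mul_comm]
          · simp [hT]
  have hlam' : (0 : ℝ) < lam := by exact_mod_cast (by omega : 0 < lam)
  have hL' : (0 : ℝ) < L := by exact_mod_cast hL
  have hM' : (0 : ℝ) < M := by exact_mod_cast hM
  have hterm : ∀ T : Finset α, ((M ^ T.card * (G.filter fun A => T ⊆ h A).card : ℕ) : ℝ) ≤
      K * G.card * (1 / ((L : ℝ) * lam)) ^ T.card := by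
    intro T
    have h1 : (((G.filter fun A => T ⊆ h A).card : ℝ)) * ((L : ℝ) * lam * M) ^ T.card ≤
        K * G.card := by exact_mod_cast hG T
    rw [one_div, inv_pow, ← div_eq_mul_inv, le_div_iff₀ (by positivity)]
    refine le_trans (le_of_eq ?_) h1
    push_cast
    rw [mul_pow ((L : ℝ) * lam)]
    ring
  have hreal : ((∑ w, (G.filter fun A => m ≤ (f w A).card).card : ℕ) : ℝ) ≤
      M ^ Fintype.card α * (K * G.card * (3 / lam)) := by
    calc _ ≤ ((∑ w, ∑ T ∈ (hs w).powerset.filter (fun T => m ≤ T.card),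
              M ^ T.card * (G.filter fun A => T ⊆ h A).card : ℕ) : ℝ) := by exact_mod_cast hcount
      _ = ∑ w, ∑ T ∈ (hs w).powerset.filter (fun T => m ≤ T.card),
              ((M ^ T.card * (G.filter fun A => T ⊆ h A).card : ℕ) : ℝ) := by push_cast; rfl
      _ ≤ ∑ _w : α → D, (K : ℝ) * G.card * (3 / lam) := by
          refine Finset.sum_le_sum fun w _ => ?_
          refine (Finset.sum_le_sum fun T _ => hterm T).trans ?_
          rw [← Finset.mul_sum]
          gcongr
          exact sum_powerset_pow_le (hs w) hL hlam hm (hs_card w)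
      _ = _ := by simp [M]
  have : ((∑ w, (G.filter fun A => m ≤ (f w A).card).card : ℕ) : ℝ) * lam ≤
      3 * K * G.card * M ^ Fintype.card α := by
    calc _ ≤ (M : ℝ) ^ Fintype.card α * (K * G.card * (3 / lam)) * lam := by gcongr
      _ = _ := by field_simp
  exact_mod_cast this

/-- There is a palette in which a proportion `s / M` of the colours is marked such that, for a
spread family of sets of fewer than `L ^ s` elements, almost every colouring gives only marked
colours to the elements of some member. -/
lemma exists_palette (α ι : Type*) [Fintype α] {L lam M : ℕ} (hL : 0 < L) (hlam : 3 ≤ lam)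
    (hM : 0 < M) (s : ℕ) :
    ∃ (C : Type) (_ : Fintype C) (_ : Nonempty C) (S : Finset C),
      S.card * M ≤ s * Fintype.card C ∧
      ∀ (K : ℕ) (G : Finset ι) (h : ι → Finset α), G.Nonempty →
        (∀ A ∈ G, (h A).card < L ^ s) → IsSpread G h (L * lam * M) K →
        (Finset.univ.filter fun c : α → C => ∀ A ∈ G, ∃ x ∈ h A, c x ∉ S).card * lam ≤
          6 * K * (2 ^ s - 1) * Fintype.card C ^ Fintype.card α := by
  induction s with
  | zero =>
    refine ⟨Unit, inferInstance, inferInstance, ∅, by simp, ?_⟩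
    rintro K G h ⟨A, hA⟩ hcard -
    have : h A = ∅ := by simpa using hcard A hA
    rw [Finset.filter_false_of_mem]
    · simp
    · intro c _ hc
      obtain ⟨x, hx, -⟩ := hc A hA
      simp [this] at hx
  | succ s ih =>
    obtain ⟨C, _, _, S, hS, hC⟩ := ih
    have : NeZero M := ⟨hM.ne'⟩
    obtain ⟨S', hS'⟩ : ∃ S' : Finset (Fin M × C), ∀ a, a ∈ S' ↔ a.1 = 0 ∨ a.2 ∈ S :=
      ⟨Finset.univ.filter fun a => a.1 = 0 ∨ a.2 ∈ S, by simp⟩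
    refine ⟨Fin M × C, inferInstance, inferInstance, S', ?_, ?_⟩
    · have hsub : S' ⊆ ({0} ×ˢ Finset.univ) ∪ (Finset.univ ×ˢ S) := by
        intro a ha
        simpa only [Finset.mem_union, Finset.mem_product, Finset.mem_singleton, Finset.mem_univ,
          and_true, true_and] using (hS' a).1 ha
      have hle := (Finset.card_le_card hsub).trans (Finset.card_union_le _ _)
      simp only [Finset.card_product, Finset.card_singleton, Finset.card_univ,
        Fintype.card_fin, one_mul] at hle
      calc _ ≤ (Fintype.card C + M * S.card) * M := Nat.mul_le_mul_right _ hle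
        _ = M * Fintype.card C + M * (S.card * M) := by ring
        _ ≤ M * Fintype.card C + M * (s * Fintype.card C) := by gcongr
        _ = (s + 1) * Fintype.card (Fin M × C) := by simp; ring
    · intro K G h hne hcard hG
      obtain ⟨f, hf, hbad⟩ := exists_fragments (0 : Fin M) G h hL hlam
        (m := L ^ s) (K := K) (by positivity)
        (fun A hA => by rw [← pow_succ']; exact (hcard A hA).le) (by simpa using hG)
      rw [Fintype.card_fin] at hbad
      let Gw : (α → Fin M) → Finset ι := fun w => G.filter fun A => (f w A).card < L ^ s
      let Bw : (α → Fin M) → Finset ι := fun w => G.filter fun A => L ^ s ≤ (f w A).card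
      have hsplit : ∀ w, (Gw w).card + (Bw w).card = G.card := by
        intro w
        simp only [Gw, Bw, ← not_lt]
        exact Finset.card_filter_add_card_filter_not _
      have hbadw : (Finset.univ.filter fun w => G.card < 2 * (Bw w).card).card * lam ≤
          6 * K * M ^ Fintype.card α := by
        have h1 : (Finset.univ.filter fun w => G.card < 2 * (Bw w).card).card * G.card ≤
            2 * ∑ w, (Bw w).card := by
          rw [← smul_eq_mul, ← Finset.sum_const, Finset.mul_sum]
          exact (Finset.sum_le_sum fun w hw => (Finset.mem_filter.1 hw).2.le).trans
            (Finset.sum_le_sum_of_subset (Finset.filter_subset _ _))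
        refine Nat.le_of_mul_le_mul_right ?_ hne.card_pos
        calc _ = (Finset.univ.filter fun w => G.card < 2 * (Bw w).card).card * G.card * lam := by
              ring
          _ ≤ (2 * ∑ w, (Bw w).card) * lam := by gcongr
          _ = 2 * ((∑ w, (Bw w).card) * lam) := by ring
          _ ≤ 2 * (3 * K * G.card * M ^ Fintype.card α) := by gcongr
          _ = _ := by ring
      have hgood : ∀ w, ¬ G.card < 2 * (Bw w).card →
          (Finset.univ.filter fun c : α → C => ∀ A ∈ Gw w, ∃ x ∈ f w A, c x ∉ S).card * lam ≤
            6 * (2 * K) * (2 ^ s - 1) * Fintype.card C ^ Fintype.card α := by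
        intro w hw
        have hle : G.card ≤ 2 * (Gw w).card := by have := hsplit w; omega
        refine hC (2 * K) (Gw w) (f w) ?_ (fun A hA => (Finset.mem_filter.1 hA).2) ?_
        · rw [← Finset.card_pos]
          have := hne.card_pos
          omega
        · intro Y
          calc _ ≤ (G.filter fun A => Y ⊆ h A).card * (L * lam * M) ^ Y.card := by
                gcongr ?_ * _
                refine Finset.card_le_card fun A hA => ?_
                simp only [Gw, Finset.mem_filter] at hA ⊢
                exact ⟨hA.1.1, hA.2.trans (hf w A hA.1.1).1⟩
            _ ≤ K * G.card := hG Y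
            _ ≤ K * (2 * (Gw w).card) := by gcongr
            _ = _ := by ring
      let Good : (α → Fin M) → (α → C) → Prop := fun w c =>
        ∀ A ∈ G, ∃ x ∈ h A, ¬ (w x = 0 ∨ c x ∈ S)
      have hequiv : (Finset.univ.filter fun c : α → Fin M × C => ∀ A ∈ G, ∃ x ∈ h A,
            c x ∉ S').card =
          ∑ w, (Finset.univ.filter fun c => Good w c).card := by
        simp_rw [Finset.card_filter]
        rw [← Finset.sum_product', Finset.univ_product_univ]
        exact Fintype.sum_equiv (Equiv.arrowProdEquivProdArrow _ _ _) _ _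
          (fun c => by simp [Good, hS', Equiv.arrowProdEquivProdArrow])
      suffices hmain : (∑ w, (Finset.univ.filter fun c => Good w c).card) * lam ≤
          6 * K * (2 ^ (s + 1) - 1) * Fintype.card (Fin M × C) ^ Fintype.card α by
        rw [← hequiv] at hmain
        convert hmain
      have hpt : ∀ w, (Finset.univ.filter fun c => Good w c).card * lam ≤
          (if G.card < 2 * (Bw w).card then Fintype.card C ^ Fintype.card α * lam else 0) +
            6 * (2 * K) * (2 ^ s - 1) * Fintype.card C ^ Fintype.card α := by
        intro w
        split_ifs with hw
        · refine le_add_right ?_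
          gcongr
          refine (Finset.card_le_univ _).trans (by simp)
        · rw [zero_add]
          refine le_trans ?_ (hgood w hw)
          gcongr ?_ * _
          refine Finset.card_le_card fun c hc => ?_
          simp only [Finset.mem_filter, Finset.mem_univ, true_and, Good] at hc ⊢
          intro A hA
          have hAG := (Finset.mem_filter.1 hA).1
          obtain ⟨A', hA', hcov⟩ := (hf w A hAG).2
          obtain ⟨x, hx, hxn⟩ := hc A' hA'
          rw [not_or] at hxn
          exact ⟨x, (hcov x hx).resolve_right hxn.1, hxn.2⟩
      rw [Finset.sum_mul]
      refine (Finset.sum_le_sum fun w _ => hpt w).trans ?_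
      rw [Finset.sum_add_distrib, ← Finset.sum_filter, Finset.sum_const, Finset.sum_const,
        smul_eq_mul, smul_eq_mul, Finset.card_univ, Fintype.card_fun, Fintype.card_fin,
        Fintype.card_prod, Fintype.card_fin, mul_pow]
      have hs := Nat.one_le_two_pow (n := s)
      obtain ⟨u, hu⟩ : ∃ u, 2 ^ s = u + 1 := ⟨2 ^ s - 1, by omega⟩
      have hu' : 2 ^ (s + 1) - 1 = 2 * u + 1 := by rw [pow_succ, hu]; omega
      rw [hu', hu, Nat.add_sub_cancel]
      calc _ = (Finset.univ.filter fun w => G.card < 2 * (Bw w).card).card * lam *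
              Fintype.card C ^ Fintype.card α +
              M ^ Fintype.card α * (6 * (2 * K) * u * Fintype.card C ^ Fintype.card α) := by ring
        _ ≤ 6 * K * M ^ Fintype.card α * Fintype.card C ^ Fintype.card α +
              M ^ Fintype.card α * (6 * (2 * K) * u * Fintype.card C ^ Fintype.card α) := by gcongr
        _ = _ := by ring

/-- A set with at most half of the elements can be moved off itself by a permutation. -/
lemma exists_perm_disjoint {C : Type*} [Fintype C] (S : Finset C)
    (hS : 2 * S.card ≤ Fintype.card C) : ∃ e : Equiv.Perm C, ∀ a ∈ S, e a ∉ S := by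
  obtain ⟨S', hS', hcard⟩ := Finset.exists_subset_card_eq (s := Sᶜ) (n := S.card)
    (by rw [Finset.card_compl]; omega)
  let e₀ : {a // a ∈ S} ≃ {a // a ∈ S'} := Finset.equivOfCardEq hcard.symm
  refine ⟨e₀.extendSubtype, fun a ha => ?_⟩
  exact Finset.mem_compl.1 (hS' (e₀.extendSubtype_mem a ha))

/-- Two sufficiently spread families have disjoint members. -/
lemma exists_disjoint_of_isSpread [Fintype α] {L s : ℕ} (hL : 0 < L) (hs : 0 < s)
    (G₁ G₂ : Finset ι) (h₁ h₂ : ι → Finset α) (hne₁ : G₁.Nonempty) (hne₂ : G₂.Nonempty)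
    (hcard₁ : ∀ A ∈ G₁, (h₁ A).card < L ^ s) (hcard₂ : ∀ A ∈ G₂, (h₂ A).card < L ^ s)
    (hG₁ : IsSpread G₁ h₁ (L * 2 ^ (s + 5) * (2 * s)) 2)
    (hG₂ : IsSpread G₂ h₂ (L * 2 ^ (s + 5) * (2 * s)) 2) :
    ∃ A ∈ G₁, ∃ B ∈ G₂, Disjoint (h₁ A) (h₂ B) := by
  have hlam : 3 ≤ 2 ^ (s + 5) := by
    have := Nat.one_le_two_pow (n := s)
    rw [pow_add]; omega
  obtain ⟨C, _, _, S, hS, hC⟩ := exists_palette α ι hL hlam (M := 2 * s) (by omega) s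
  obtain ⟨e, he⟩ := exists_perm_disjoint S (by nlinarith)
  have hb₁ := hC 2 G₁ h₁ hne₁ hcard₁ hG₁
  have hb₂ := hC 2 G₂ h₂ hne₂ hcard₂ hG₂
  have hb₂' : (Finset.univ.filter fun c : α → C => ∀ A ∈ G₂, ∃ x ∈ h₂ A, e (c x) ∉ S).card =
      (Finset.univ.filter fun c : α → C => ∀ A ∈ G₂, ∃ x ∈ h₂ A, c x ∉ S).card := by
    simp_rw [Finset.card_filter]
    exact Fintype.sum_equiv (Equiv.arrowCongr (Equiv.refl α) e) _ _ fun c => by simp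
  by_contra! hno
  have hcover : (Finset.univ : Finset (α → C)) ⊆
      (Finset.univ.filter fun c : α → C => ∀ A ∈ G₁, ∃ x ∈ h₁ A, c x ∉ S) ∪
      (Finset.univ.filter fun c : α → C => ∀ A ∈ G₂, ∃ x ∈ h₂ A, e (c x) ∉ S) := by
    intro c _
    simp only [Finset.mem_union, Finset.mem_filter, Finset.mem_univ, true_and]
    by_contra! hc
    obtain ⟨⟨A, hA, hAS⟩, B, hB, hBS⟩ := hc
    refine hno A hA B hB (Finset.disjoint_left.2 fun x hxA hxB => ?_)
    exact he _ (hAS x hxA) (hBS x hxB)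
  have hle := (Finset.card_le_card hcover).trans (Finset.card_union_le _ _)
  rw [hb₂', Finset.card_univ, Fintype.card_fun] at hle
  have hpos : 0 < Fintype.card C ^ Fintype.card α := pow_pos Fintype.card_pos _
  have h1 := Nat.one_le_two_pow (n := s)
  set N := Fintype.card C ^ Fintype.card α
  set b := (Finset.univ.filter fun c : α → C => ∀ A ∈ G₁, ∃ x ∈ h₁ A, c x ∉ S).card
  set b' := (Finset.univ.filter fun c : α → C => ∀ A ∈ G₂, ∃ x ∈ h₂ A, c x ∉ S).card
  have h2 : (2 : ℕ) ^ (s + 5) = 32 * 2 ^ s := by ring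
  obtain ⟨u, hu⟩ : ∃ u, 2 ^ s = u + 1 := ⟨2 ^ s - 1, by omega⟩
  rw [h2, hu, Nat.add_sub_cancel] at hb₁ hb₂
  have h3 : N * (32 * (u + 1)) ≤ 24 * u * N := by
    calc N * (32 * (u + 1)) ≤ (b + b') * (32 * (u + 1)) := by gcongr
      _ ≤ 6 * 2 * u * N + 6 * 2 * u * N := by rw [add_mul]; gcongr
      _ = _ := by ring
  nlinarith

/-- `X` is a kernel of the family if some subfamily consists of supersets of `X` and is spread
outside of `X`. -/
def IsKernel (F : Finset ι) (E : ι → Finset α) (R : ℕ) (X : Finset α) : Prop :=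
  ∃ G ⊆ F, G.Nonempty ∧ (∀ A ∈ G, X ⊆ E A) ∧ IsSpread G (fun A => E A \ X) R 1

lemma exists_isKernel [Fintype α] {F : Finset ι} {E : ι → Finset α} {R q u : ℕ}
    (hR : 0 < R) (hF : ∀ X, (F.filter fun A => X ⊆ E A).card * R ^ (2 * X.card) ≤ u)
    (hu : u < F.card * R ^ q) : ∃ X, X.card < q ∧ IsKernel F E R X := by
  obtain ⟨X, -, hX⟩ := Finset.exists_max_image (Finset.univ : Finset (Finset α))
    (fun X => (F.filter fun A => X ⊆ E A).card * R ^ X.card) Finset.univ_nonempty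
  have hFX : F.card ≤ (F.filter fun A => X ⊆ E A).card * R ^ X.card := by
    simpa using hX ∅ (Finset.mem_univ _)
  refine ⟨X, ?_, F.filter fun A => X ⊆ E A, Finset.filter_subset _ _, ?_,
    fun A hA => (Finset.mem_filter.1 hA).2, fun Y => ?_⟩
  · by_contra! hq
    refine hu.not_ge ?_
    calc F.card * R ^ q ≤ (F.filter fun A => X ⊆ E A).card * R ^ X.card * R ^ X.card := by
          gcongr
      _ = (F.filter fun A => X ⊆ E A).card * R ^ (2 * X.card) := by ring
      _ ≤ u := hF X
  · rw [Finset.nonempty_iff_ne_empty]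
    intro h0
    rw [h0, Finset.card_empty, zero_mul] at hFX
    simp [Nat.le_zero.1 hFX] at hu
  · by_cases hXY : Disjoint X Y
    · refine Nat.le_of_mul_le_mul_right ?_ (pow_pos hR X.card)
      have h1 : ((F.filter fun A => X ⊆ E A).filter fun A => Y ⊆ E A \ X).card ≤
          (F.filter fun A => X ∪ Y ⊆ E A).card := by
        refine Finset.card_le_card fun A hA => ?_
        simp only [Finset.mem_filter] at hA ⊢
        exact ⟨hA.1.1, Finset.union_subset hA.1.2 (hA.2.trans Finset.sdiff_subset)⟩
      calc _ ≤ (F.filter fun A => X ∪ Y ⊆ E A).card * R ^ Y.card * R ^ X.card := by gcongr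
        _ = (F.filter fun A => X ∪ Y ⊆ E A).card * R ^ (X ∪ Y).card := by
            rw [Finset.card_union_of_disjoint hXY]; ring
        _ ≤ (F.filter fun A => X ⊆ E A).card * R ^ X.card := hX _ (Finset.mem_univ _)
        _ = _ := by ring
    · rw [Finset.filter_false_of_mem]
      · simp
      · intro A _ hY
        exact hXY (Finset.disjoint_of_subset_right hY Finset.disjoint_sdiff)

lemma IsKernel.mono {F F' : Finset ι} {E : ι → Finset α} {R : ℕ} {X : Finset α}
    (h : IsKernel F E R X) (hF : F ⊆ F') : IsKernel F' E R X := by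
  obtain ⟨G, hG, h⟩ := h
  exact ⟨G, hG.trans hF, h⟩

/-- Only few members of a family contain no small kernel. -/
lemma card_no_kernel_le [Fintype α] {F : Finset ι} {E : ι → Finset α}
    {R q u : ℕ} (hR : 0 < R)
    (hF : ∀ X, (F.filter fun A => X ⊆ E A).card * R ^ (2 * X.card) ≤ u) :
    (F.filter fun A => ¬ ∃ X, X.card < q ∧ IsKernel F E R X ∧ X ⊆ E A).card * R ^ q ≤ u := by
  by_contra hu
  rw [not_le] at hu
  set F' := F.filter fun A => ¬ ∃ X, X.card < q ∧ IsKernel F E R X ∧ X ⊆ E A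
  have hF' : F' ⊆ F := Finset.filter_subset _ _
  obtain ⟨X, hXq, hX⟩ := exists_isKernel hR (fun X => le_trans (by gcongr) (hF X)) hu
  have hX' := hX.mono hF'
  obtain ⟨G, hG, ⟨A, hA⟩, hGX, -⟩ := hX
  exact (Finset.mem_filter.1 (hG hA)).2 ⟨X, hXq, hX', hGX A hA⟩

/-- A family that is spread outside of `X` remains spread when only the members avoiding a
small set `Y` disjoint from `X` are kept. -/
lemma IsSpread.filter_disjoint {G : Finset ι} {E : ι → Finset α} {R : ℕ}
    {X Y : Finset α} (hne : G.Nonempty) (hG : IsSpread G (fun A => E A \ X) R 1)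
    (hXY : Disjoint X Y) (hY : 2 * Y.card ≤ R) (hR : 0 < R) :
    (G.filter fun A => Disjoint (E A) Y).Nonempty ∧
      IsSpread (G.filter fun A => Disjoint (E A) Y) (fun A => E A \ X) R 2 := by
  have hsum : (G.filter fun A => ¬ Disjoint (E A) Y).card * R ≤ Y.card * G.card := by
    have hsub : (G.filter fun A => ¬ Disjoint (E A) Y) ⊆
        Y.biUnion fun y => G.filter fun A => {y} ⊆ E A \ X := by
      intro A hA
      rw [Finset.mem_filter, Finset.not_disjoint_iff] at hA
      obtain ⟨hAG, y, hyA, hyY⟩ := hA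
      simp only [Finset.mem_biUnion, Finset.mem_filter, Finset.singleton_subset_iff,
        Finset.mem_sdiff]
      exact ⟨y, hyY, hAG, hyA, Finset.disjoint_right.1 hXY hyY⟩
    calc _ ≤ (∑ y ∈ Y, (G.filter fun A => {y} ⊆ E A \ X).card) * R := by
          gcongr
          exact (Finset.card_le_card hsub).trans Finset.card_biUnion_le
      _ ≤ ∑ _y ∈ Y, G.card := by
          rw [Finset.sum_mul]
          exact Finset.sum_le_sum fun y _ => by simpa using hG {y}
      _ = _ := by simp
  have hhalf : 2 * (G.filter fun A => ¬ Disjoint (E A) Y).card ≤ G.card := by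
    refine Nat.le_of_mul_le_mul_right ?_ hR
    calc _ = 2 * ((G.filter fun A => ¬ Disjoint (E A) Y).card * R) := by ring
      _ ≤ 2 * (Y.card * G.card) := by gcongr
      _ = (2 * Y.card) * G.card := by ring
      _ ≤ R * G.card := by gcongr
      _ = _ := mul_comm _ _
  have hsplit := Finset.card_filter_add_card_filter_not (s := G) (fun A => Disjoint (E A) Y)
  have hle : G.card ≤ 2 * (G.filter fun A => Disjoint (E A) Y).card := by omega
  refine ⟨?_, fun Z => ?_⟩
  · rw [← Finset.card_pos]
    have := hne.card_pos
    omega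
  · calc _ ≤ (G.filter fun A => Z ⊆ E A \ X).card * R ^ Z.card := by
          gcongr
          exact Finset.filter_subset _ _
      _ ≤ 1 * G.card := hG Z
      _ ≤ _ := by rw [one_mul]; exact hle

/-- Small kernels of an intersecting family intersect. -/
lemma IsKernel.not_disjoint [Fintype α] {F : Finset ι} {E : ι → Finset α}
    {L s : ℕ} {X Y : Finset α} (hL : 0 < L) (hs : 0 < s) (hE : ∀ A ∈ F, (E A).card < L ^ s)
    (hF : ∀ A ∈ F, ∀ B ∈ F, ¬ Disjoint (E A) (E B))
    (hX : IsKernel F E (L * 2 ^ (s + 5) * (2 * s)) X)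
    (hY : IsKernel F E (L * 2 ^ (s + 5) * (2 * s)) Y)
    (hXR : 2 * X.card ≤ L * 2 ^ (s + 5) * (2 * s))
    (hYR : 2 * Y.card ≤ L * 2 ^ (s + 5) * (2 * s)) : ¬ Disjoint X Y := by
  intro hXY
  obtain ⟨G₁, hG₁F, hne₁, hX₁, hG₁⟩ := hX
  obtain ⟨G₂, hG₂F, hne₂, hY₂, hG₂⟩ := hY
  have hR : 0 < L * 2 ^ (s + 5) * (2 * s) := by positivity
  obtain ⟨hne₁', hG₁'⟩ := hG₁.filter_disjoint hne₁ hXY hYR hR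
  obtain ⟨hne₂', hG₂'⟩ := hG₂.filter_disjoint hne₂ hXY.symm hXR hR
  obtain ⟨A, hA, B, hB, hAB⟩ := exists_disjoint_of_isSpread hL hs _ _ _ _ hne₁' hne₂'
    (fun A hA => (Finset.card_le_card Finset.sdiff_subset).trans_lt
      (hE A (hG₁F (Finset.mem_filter.1 hA).1)))
    (fun A hA => (Finset.card_le_card Finset.sdiff_subset).trans_lt
      (hE A (hG₂F (Finset.mem_filter.1 hA).1))) hG₁' hG₂'
  rw [Finset.mem_filter] at hA hB
  refine hF A (hG₁F hA.1) B (hG₂F hB.1) (Finset.disjoint_left.2 fun x hxA hxB => ?_)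
  by_cases hxX : x ∈ X
  · exact Finset.disjoint_left.1 hB.2 hxB hxX
  · by_cases hxY : x ∈ Y
    · exact Finset.disjoint_left.1 hA.2 hxA hxY
    · exact Finset.disjoint_left.1 hAB (Finset.mem_sdiff.2 ⟨hxA, hxX⟩)
        (Finset.mem_sdiff.2 ⟨hxB, hxY⟩)

end Spread

section Partitions

variable {n : ℕ}

/-- `x` and `y` lie in a common part of `A`. -/
def Same (A : Finset (Finset (Fin n))) (x y : Fin n) : Prop := ∃ p ∈ A, x ∈ p ∧ y ∈ p

/-- Exchange the elements `y` and `z` in all parts of `A`. -/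
def exchange (y z : Fin n) (A : Finset (Finset (Fin n))) : Finset (Finset (Fin n)) :=
  A.image fun p => p.image (Equiv.swap y z)

/-- The `t`-element subsets of parts of `A`. -/
def traces (t : ℕ) (A : Finset (Finset (Fin n))) : Finset (Finset (Fin n)) :=
  Finset.univ.filter fun T => T.card = t ∧ ∃ p ∈ A, T ⊆ p

/-- The part of `A` that contains `x`. -/
noncomputable def part (A : Finset (Finset (Fin n))) (x : Fin n) : Finset (Fin n) :=
  Finset.univ.filter fun y => Same A x y

lemma mem_part {A : Finset (Finset (Fin n))} {x y : Fin n} : y ∈ part A x ↔ Same A x y := by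
  simp [part]

lemma Same.symm {A : Finset (Finset (Fin n))} {x y : Fin n} (h : Same A x y) : Same A y x := by
  obtain ⟨p, hp, hx, hy⟩ := h
  exact ⟨p, hp, hy, hx⟩

lemma _root_.IsPartition.same_refl {A : Finset (Finset (Fin n))} (hA : IsPartition A)
    (x : Fin n) : Same A x x := by
  obtain ⟨p, hp, hx⟩ := hA.2.2 x
  exact ⟨p, hp, hx, hx⟩

lemma _root_.IsPartition.eq_of_mem_s4 {A : Finset (Finset (Fin n))} (hA : IsPartition A)
    {p q : Finset (Fin n)} (hp : p ∈ A) (hq : q ∈ A) {x : Fin n} (hxp : x ∈ p) (hxq : x ∈ q) :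
    p = q := by
  by_contra hpq
  exact Finset.disjoint_left.1 (hA.2.1 p hp q hq hpq) hxp hxq

lemma _root_.IsPartition.part_eq {A : Finset (Finset (Fin n))} (hA : IsPartition A)
    {p : Finset (Fin n)} (hp : p ∈ A) {x : Fin n} (hx : x ∈ p) : part A x = p := by
  ext y
  rw [mem_part]
  refine ⟨fun ⟨q, hq, hxq, hyq⟩ => ?_, fun hy => ⟨p, hp, hx, hy⟩⟩
  rwa [hA.eq_of_mem_s4 hp hq hx hxq]

lemma mem_traces_iff {t : ℕ} (ht : 1 ≤ t) {A : Finset (Finset (Fin n))} (hA : IsPartition A)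
    {T : Finset (Fin n)} :
    T ∈ traces t A ↔ T.card = t ∧ ∀ x ∈ T, ∀ y ∈ T, Same A x y := by
  simp only [traces, Finset.mem_filter, Finset.mem_univ, true_and]
  refine and_congr_right fun hT => ⟨fun ⟨p, hp, hTp⟩ x hx y hy => ⟨p, hp, hTp hx, hTp hy⟩,
    fun h => ?_⟩
  obtain ⟨x, hx⟩ := Finset.card_pos.1 (by omega : 0 < T.card)
  obtain ⟨p, hp, hxp⟩ := hA.2.2 x
  refine ⟨p, hp, fun y hy => ?_⟩
  rw [← hA.part_eq hp hxp, mem_part]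
  exact h x hx y hy

lemma not_disjoint_traces {t : ℕ} {A B : Finset (Finset (Fin n))} :
    ¬ Disjoint (traces t A) (traces t B) ↔ ∃ p ∈ A, ∃ q ∈ B, t ≤ (p ∩ q).card := by
  rw [Finset.not_disjoint_iff]
  simp only [traces, Finset.mem_filter, Finset.mem_univ, true_and]
  constructor
  · rintro ⟨T, ⟨hT, p, hp, hTp⟩, -, q, hq, hTq⟩
    exact ⟨p, hp, q, hq, hT ▸ Finset.card_le_card (Finset.subset_inter hTp hTq)⟩
  · rintro ⟨p, hp, q, hq, h⟩
    obtain ⟨T, hT, hTt⟩ := Finset.exists_subset_card_eq h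
    exact ⟨T, ⟨hTt, p, hp, hT.trans Finset.inter_subset_left⟩,
      hTt, q, hq, hT.trans Finset.inter_subset_right⟩

lemma exchange_exchange (y z : Fin n) (A : Finset (Finset (Fin n))) :
    exchange y z (exchange y z A) = A := by
  simp [exchange, Finset.image_image, Function.comp_def]

lemma exchange_self (y : Fin n) (A : Finset (Finset (Fin n))) : exchange y y A = A := by
  simp [exchange]

lemma same_exchange {y z a b : Fin n} {A : Finset (Finset (Fin n))} :
    Same (exchange y z A) a b ↔ Same A (Equiv.swap y z a) (Equiv.swap y z b) := by
  have key : ∀ (p : Finset (Fin n)) (c : Fin n),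
      c ∈ p.image (Equiv.swap y z) ↔ Equiv.swap y z c ∈ p := by
    intro p c
    rw [Finset.mem_image]
    exact ⟨fun ⟨d, hd, h⟩ => by simpa [← h] using hd, fun h => ⟨_, h, by simp⟩⟩
  simp [Same, exchange, key]

lemma _root_.IsPartition.exchange {A : Finset (Finset (Fin n))} (hA : IsPartition A)
    (y z : Fin n) : IsPartition (exchange y z A) := by
  refine ⟨?_, ?_, fun x => ?_⟩
  · simp [PartiallyIntersecting.exchange, hA.1]
  · simp only [PartiallyIntersecting.exchange, Finset.forall_mem_image]
    intro p hp q hq hpq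
    rw [Finset.disjoint_image (Equiv.swap y z).injective]
    exact hA.2.1 p hp q hq fun h => hpq (by rw [h])
  · obtain ⟨p, hp, -, hx⟩ := same_exchange.2 (hA.same_refl (Equiv.swap y z x))
    exact ⟨p, hp, hx⟩

lemma map_card_exchange (y z : Fin n) (A : Finset (Finset (Fin n))) :
    Multiset.map Finset.card (exchange y z A).val = Multiset.map Finset.card A.val := by
  have hinj := Finset.image_injective (Equiv.swap y z).injective
  rw [exchange, Finset.image_val_of_injOn hinj.injOn, Multiset.map_map]
  congr 1
  funext p
  exact Finset.card_image_of_injective _ (Equiv.swap y z).injective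

/-- The properties of `𝓤_P` used in the proof. -/
structure Admissible (k t : ℕ) (U : Finset (Finset (Finset (Fin n)))) : Prop where
  isPartition : ∀ A ∈ U, IsPartition A
  card_le : ∀ A ∈ U, ∀ p ∈ A, p.card ≤ k
  le_card : ∀ A ∈ U, ∃ p ∈ A, t ≤ p.card
  exchange_mem : ∀ A ∈ U, ∀ y z, exchange y z A ∈ U

variable {k t : ℕ} {U : Finset (Finset (Finset (Fin n)))}

lemma Admissible.card_part_le (hU : Admissible k t U) {A : Finset (Finset (Fin n))} (hA : A ∈ U)
    (x : Fin n) : (part A x).card ≤ k := by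
  obtain ⟨p, hp, hx⟩ := (hU.isPartition A hA).2.2 x
  rw [(hU.isPartition A hA).part_eq hp hx]
  exact hU.card_le A hA p hp

lemma Admissible.card_traces_le (hU : Admissible k t U) (ht : 1 ≤ t)
    {A : Finset (Finset (Fin n))} (hA : A ∈ U) : (traces t A).card ≤ n * 2 ^ k := by
  have hsub : traces t A ⊆ Finset.univ.biUnion fun x => (part A x).powerset := by
    intro T hT
    rw [mem_traces_iff ht (hU.isPartition A hA)] at hT
    obtain ⟨x, hx⟩ := Finset.card_pos.1 (by omega : 0 < T.card)
    simp only [Finset.mem_biUnion, Finset.mem_univ, true_and, Finset.mem_powerset]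
    exact ⟨x, fun y hy => mem_part.2 (hT.2 x hx y hy)⟩
  refine (Finset.card_le_card hsub).trans (Finset.card_biUnion_le.trans ?_)
  calc _ ≤ ∑ _x : Fin n, 2 ^ k := Finset.sum_le_sum fun x _ => by
        rw [Finset.card_powerset]
        exact Nat.pow_le_pow_right (by norm_num) (hU.card_part_le hA x)
    _ = _ := by simp

/-- Double counting of exchanges: in a family with `x` and `y` always in the same part, moving
`y` away in many ways shows that the family is sparse. -/
lemma Admissible.card_mul_le_of_exchange (hU : Admissible k t U)
    {V V' : Finset (Finset (Finset (Fin n)))} (hV : V ⊆ U) {x y : Fin n} (hxy : x ≠ y)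
    {Z : Finset (Fin n)} (hsame : ∀ A ∈ V', Same A x y)
    (hZ : ∀ A ∈ V', ∀ z ∈ Z, exchange y z A ∈ V) : V'.card * Z.card ≤ k * V.card := by
  calc V'.card * Z.card = (V' ×ˢ Z).card := (Finset.card_product _ _).symm
    _ ≤ (V.sigma fun A => part A x).card := by
        refine Finset.card_le_card_of_injOn (fun a => ⟨exchange y a.2 a.1, a.2⟩) ?_ ?_
        · rintro ⟨A, z⟩ h
          simp only [Finset.coe_product, Set.mem_prod, Finset.mem_coe] at h
          simp only [Finset.coe_sigma, Set.mem_sigma_iff, Finset.mem_coe]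
          have hm := hZ A h.1 z h.2
          refine ⟨hm, mem_part.2 ?_⟩
          by_cases hxz : x = z
          · subst hxz
            exact (hU.isPartition _ (hV hm)).same_refl x
          · rw [same_exchange, Equiv.swap_apply_right, Equiv.swap_apply_of_ne_of_ne hxy hxz]
            exact hsame A h.1
        · rintro ⟨A, z⟩ - ⟨B, w⟩ - h
          simp only [Sigma.mk.injEq] at h
          obtain ⟨h1, h2⟩ := h
          have h2 := eq_of_heq h2
          subst h2
          rw [← exchange_exchange y z A, h1, exchange_exchange]
    _ = ∑ A ∈ V, (part A x).card := Finset.card_sigma _ _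
    _ ≤ ∑ _A ∈ V, k := Finset.sum_le_sum fun A hA => hU.card_part_le (hV hA) x
    _ = k * V.card := by simp [mul_comm]

lemma Admissible.card_pairs_le (hU : Admissible k t U) {ι : Type*} (x y : ι → Fin n)
    (I : Finset ι) (hy : Set.InjOn y I) (hxy : ∀ i ∈ I, ∀ j ∈ I, x i ≠ y j)
    (hI : 4 * I.card ≤ n) :
    (U.filter fun A => ∀ i ∈ I, Same A (x i) (y i)).card * n ^ I.card ≤
      (2 * k) ^ I.card * U.card := by
  induction I using Finset.induction_on with
  | empty => simp
  | insert i I hi ih =>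
    rw [Finset.card_insert_of_notMem hi] at hI ⊢
    have ih := ih (hy.mono (by simp)) (fun i hi j hj => hxy i (by simp [hi]) j (by simp [hj]))
      (by omega)
    set V := U.filter fun A => ∀ i ∈ I, Same A (x i) (y i)
    set V' := U.filter fun A => ∀ j ∈ insert i I, Same A (x j) (y j)
    have hstep : V'.card * (I.image x ∪ I.image y)ᶜ.card ≤ k * V.card := by
      refine hU.card_mul_le_of_exchange (Finset.filter_subset _ _) (x := x i) (y := y i)
        (hxy i (by simp) i (by simp)) (fun A hA => (Finset.mem_filter.1 hA).2 i (by simp)) ?_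
      intro A hA z hz
      rw [Finset.mem_filter] at hA
      refine Finset.mem_filter.2 ⟨hU.exchange_mem A hA.1 _ _, fun j hj => ?_⟩
      simp only [Finset.mem_compl, Finset.mem_union, Finset.mem_image, not_or, not_exists,
        not_and] at hz
      have hji : j ≠ i := fun h => hi (h ▸ hj)
      have h1 : x j ≠ y i := hxy j (by simp [hj]) i (by simp)
      have h2 : y j ≠ y i := fun h => hji (hy (by simp [hj]) (by simp) h)
      rw [same_exchange, Equiv.swap_apply_of_ne_of_ne h1 (hz.1 j hj),
        Equiv.swap_apply_of_ne_of_ne h2 (hz.2 j hj)]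
      exact hA.2 j (by simp [hj])
    have hcompl : n ≤ 2 * (I.image x ∪ I.image y)ᶜ.card := by
      rw [Finset.card_compl, Fintype.card_fin]
      have := (Finset.card_union_le (I.image x) (I.image y)).trans
        (add_le_add Finset.card_image_le Finset.card_image_le)
      omega
    calc V'.card * n ^ (I.card + 1) = V'.card * n * n ^ I.card := by ring
      _ ≤ V'.card * (2 * (I.image x ∪ I.image y)ᶜ.card) * n ^ I.card := by gcongr
      _ = 2 * (V'.card * (I.image x ∪ I.image y)ᶜ.card) * n ^ I.card := by ring
      _ ≤ 2 * (k * V.card) * n ^ I.card := by gcongr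
      _ = 2 * k * (V.card * n ^ I.card) := by ring
      _ ≤ 2 * k * ((2 * k) ^ I.card * U.card) := by gcongr
      _ = _ := by ring

set_option maxHeartbeats 1000000 in
/-- The whole family is spread. -/
lemma Admissible.card_superset_traces_le (hU : Admissible k t U) (ht : 2 ≤ t) (hk : 0 < k)
    {R : ℕ} (hR : 0 < R) (hn : 4 ≤ n) (hRn : 2 * k * R ^ 2 ^ (k + 4) ≤ n)
    (X : Finset (Finset (Fin n))) :
    (U.filter fun A => X ⊆ traces t A).card * R ^ (2 * X.card) ≤ U.card := by
  obtain h0 | ⟨A₀, hA₀⟩ := (U.filter fun A => X ⊆ traces t A).eq_empty_or_nonempty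
  · simp [h0]
  rw [Finset.mem_filter] at hA₀
  obtain ⟨hA₀, hX⟩ := hA₀
  have hP := hU.isPartition A₀ hA₀
  have hpart : ∀ T ∈ X, ∃ p ∈ A₀, T ⊆ p := fun T hT => by
    have := hX hT
    simp only [traces, Finset.mem_filter] at this
    exact this.2.2
  choose! g hgA hgT using hpart
  set I := X.image g
  have hIA : ∀ p ∈ I, p ∈ A₀ := by
    simp only [I, Finset.forall_mem_image]
    exact hgA
  have hXI : X.card ≤ 2 ^ k * I.card := by
    refine Finset.card_le_mul_card_image_of_maps_to (f := g)
      (fun T hT => Finset.mem_image_of_mem g hT) _ fun p hp => ?_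
    have hsub : X.filter (fun T => g T = p) ⊆ p.powerset := by
      intro T hT
      rw [Finset.mem_filter] at hT
      rw [Finset.mem_powerset, ← hT.2]
      exact hgT T hT.1
    refine (Finset.card_le_card hsub).trans ?_
    rw [Finset.card_powerset]
    exact Nat.pow_le_pow_right (by norm_num) (hU.card_le A₀ hA₀ p (hIA p hp))
  have hxy : ∀ p ∈ I, ∃ x y, x ≠ y ∧ x ∈ p ∧ y ∈ p ∧ ∃ T ∈ X, x ∈ T ∧ y ∈ T := by
    simp only [I, Finset.forall_mem_image]
    intro T hT
    have hTt : T.card = t := ((mem_traces_iff (by omega) hP).1 (hX hT)).1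
    obtain ⟨x, hx, y, hy, hne⟩ := Finset.one_lt_card.1 (by omega : 1 < T.card)
    exact ⟨x, y, hne, hgT T hT hx, hgT T hT hy, T, hT, hx, hy⟩
  have : Nonempty (Fin n) := ⟨⟨0, by omega⟩⟩
  choose! x y hne hxp hyp hTX using hxy
  have hyinj : Set.InjOn y I := fun p hp q hq h =>
    hP.eq_of_mem_s4 (hIA p hp) (hIA q hq) (hyp p hp) (h ▸ hyp q hq)
  have hIn : I.card ≤ n := by
    simpa using Finset.card_le_card_of_injOn y (fun _ _ => Finset.mem_univ _) hyinj
  obtain ⟨J, hJI, hJ⟩ := Finset.exists_subset_card_eq (min_le_left I.card (n / 4))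
  have hbound := hU.card_pairs_le x y J (hyinj.mono (by exact_mod_cast hJI))
    (fun p hp q hq h => by
      obtain rfl := hP.eq_of_mem_s4 (hIA p (hJI hp)) (hIA q (hJI hq)) (hxp p (hJI hp))
        (h ▸ hyp q (hJI hq))
      exact hne p (hJI hp) h) (by omega)
  have hsub : (U.filter fun A => X ⊆ traces t A).card ≤
      (U.filter fun A => ∀ p ∈ J, Same A (x p) (y p)).card := by
    refine Finset.card_le_card fun A hA => ?_
    rw [Finset.mem_filter] at hA ⊢
    refine ⟨hA.1, fun p hp => ?_⟩
    obtain ⟨T, hT, hxT, hyT⟩ := hTX p (hJI hp)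
    exact ((mem_traces_iff (by omega) (hU.isPartition A hA.1)).1 (hA.2 hT)).2 _ hxT _ hyT
  have hIJ : I.card ≤ 8 * J.card := by omega
  have hexp : 2 * X.card ≤ 2 ^ (k + 4) * J.card := by
    calc 2 * X.card ≤ 2 * (2 ^ k * (8 * J.card)) := by gcongr; exact hXI.trans (by gcongr)
      _ = _ := by ring
  refine Nat.le_of_mul_le_mul_left ?_ (pow_pos (by omega : 0 < 2 * k) J.card)
  calc (2 * k) ^ J.card * ((U.filter fun A => X ⊆ traces t A).card * R ^ (2 * X.card))
      ≤ (2 * k) ^ J.card * ((U.filter fun A => ∀ p ∈ J, Same A (x p) (y p)).card *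
          R ^ (2 ^ (k + 4) * J.card)) := by gcongr
    _ = (U.filter fun A => ∀ p ∈ J, Same A (x p) (y p)).card *
          (2 * k * R ^ 2 ^ (k + 4)) ^ J.card := by
          rw [mul_pow (2 * k), ← pow_mul]; ring
    _ ≤ (U.filter fun A => ∀ p ∈ J, Same A (x p) (y p)).card * n ^ J.card := by gcongr
    _ ≤ _ := by convert hbound

lemma mem_traces_exchange {A : Finset (Finset (Fin n))} {T : Finset (Fin n)} {y z : Fin n}
    (hy : y ∉ T) (hz : z ∉ T) : T ∈ traces t (exchange y z A) ↔ T ∈ traces t A := by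
  have hT : T.image (Equiv.swap y z) = T := by
    refine (Finset.image_congr fun x hx => ?_).trans Finset.image_id
    exact Equiv.swap_apply_of_ne_of_ne (fun h => hy (h ▸ hx)) (fun h => hz (h ▸ hx))
  simp only [traces, exchange, Finset.mem_filter, Finset.mem_univ, true_and,
    Finset.exists_mem_image]
  refine and_congr_right fun _ => exists_congr fun p => and_congr_right fun _ => ?_
  nth_rw 1 [← hT]
  exact Finset.image_subset_image_iff (Equiv.swap y z).injective

/-- Few members of `U` have two given traces, compared with those having one of them. -/
lemma Admissible.card_filter_pair_le (hU : Admissible k t U) (ht : 2 ≤ t)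
    {T T' : Finset (Fin n)} (hT : T.card = t) (hT' : T'.card = t) (hne : T ≠ T') :
    (U.filter fun A => T ∈ traces t A ∧ T' ∈ traces t A).card * (n - t) ≤
      k * (U.filter fun A => T ∈ traces t A).card := by
  have hsub : ¬ T' ⊆ T := fun h => hne (Finset.eq_of_subset_of_card_le h (by omega)).symm
  obtain ⟨y, hyT', hyT⟩ := Finset.not_subset.1 hsub
  obtain ⟨x, hx, hxy⟩ := Finset.exists_mem_ne (by omega : 1 < T'.card) y
  have h := hU.card_mul_le_of_exchange
    (V' := U.filter fun A => T ∈ traces t A ∧ T' ∈ traces t A)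
    (Finset.filter_subset (fun A => T ∈ traces t A) U) hxy (Z := Tᶜ) ?_ ?_
  · rwa [Finset.card_compl, Fintype.card_fin, hT] at h
  · intro A hA
    rw [Finset.mem_filter] at hA
    exact ((mem_traces_iff (by omega) (hU.isPartition A hA.1)).1 hA.2.2).2 x hx y hyT'
  · intro A hA z hz
    rw [Finset.mem_filter] at hA ⊢
    exact ⟨hU.exchange_mem A hA.1 _ _,
      (mem_traces_exchange hyT (Finset.mem_compl.1 hz)).2 hA.2.1⟩

/-- A common trace can be destroyed by an exchange that creates no new one. -/
lemma Admissible.exists_exchange (hU : Admissible k t U) (ht : 2 ≤ t) (hn : 2 * k ^ 2 + t < n)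
    {A B : Finset (Finset (Fin n))} (hA : A ∈ U) (hB : B ∈ U) {T T' : Finset (Fin n)}
    (hT : T ∈ traces t A) (hT' : T' ∈ traces t A ∩ traces t B) (hne : T ≠ T') :
    ∃ y z, T ∈ traces t (exchange y z A) ∧
      traces t (exchange y z A) ∩ traces t B ⊆ (traces t A ∩ traces t B).erase T' := by
  have hPA := hU.isPartition A hA
  have hPB := hU.isPartition B hB
  have hTt := ((mem_traces_iff (by omega) hPA).1 hT).1
  have hTt' := ((mem_traces_iff (by omega) hPA).1 (Finset.mem_inter.1 hT').1).1
  have hsub : ¬ T' ⊆ T := fun h => hne (Finset.eq_of_subset_of_card_le h (by omega)).symm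
  obtain ⟨y, hyT', hyT⟩ := Finset.not_subset.1 hsub
  set W := T ∪ ((part A y).biUnion (part B) ∪ (part B y).biUnion (part A)) with hWdef
  have hW : W.card < n := by
    have h1 : ((part A y).biUnion (part B)).card ≤ k * k :=
      (Finset.card_biUnion_le_card_mul _ _ k fun x _ => hU.card_part_le hB x).trans
        (by gcongr; exact hU.card_part_le hA y)
    have h2 : ((part B y).biUnion (part A)).card ≤ k * k :=
      (Finset.card_biUnion_le_card_mul _ _ k fun x _ => hU.card_part_le hA x).trans
        (by gcongr; exact hU.card_part_le hB y)
    have h3 := Finset.card_union_le T ((part A y).biUnion (part B) ∪ (part B y).biUnion (part A))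
    have h4 := Finset.card_union_le ((part A y).biUnion (part B)) ((part B y).biUnion (part A))
    rw [← hWdef] at h3
    rw [pow_two] at hn
    omega
  obtain ⟨z, hz⟩ : ∃ z, z ∉ W := by
    by_contra! h
    rw [Finset.eq_univ_iff_forall.2 h, Finset.card_univ, Fintype.card_fin] at hW
    exact lt_irrefl _ hW
  simp only [hWdef, Finset.mem_union, Finset.mem_biUnion, mem_part, not_or, not_exists,
    not_and] at hz
  obtain ⟨hzT, hzAB, hzBA⟩ := hz
  refine ⟨y, z, (mem_traces_exchange hyT hzT).2 hT, fun S hS => ?_⟩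
  rw [Finset.mem_inter] at hS
  have hSA := (mem_traces_iff (by omega) (hPA.exchange y z)).1 hS.1
  have hSB := (mem_traces_iff (by omega) hPB).1 hS.2
  have hyS : y ∉ S := by
    intro hy
    obtain ⟨w, hw, hwy⟩ := Finset.exists_mem_ne (by omega : 1 < S.card) y
    by_cases hwz : w = z
    · exact hzAB y (hPA.same_refl y) (hwz ▸ hSB.2 y hy w hw)
    · have h := hSA.2 y hy w hw
      rw [same_exchange, Equiv.swap_apply_left, Equiv.swap_apply_of_ne_of_ne hwy hwz] at h
      exact hzBA w (hSB.2 y hy w hw) h.symm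
  have hzS : z ∉ S := by
    intro hz
    obtain ⟨w, hw, hwz⟩ := Finset.exists_mem_ne (by omega : 1 < S.card) z
    have hwy : w ≠ y := fun h => hyS (h ▸ hw)
    have h := hSA.2 z hz w hw
    rw [same_exchange, Equiv.swap_apply_right, Equiv.swap_apply_of_ne_of_ne hwy hwz] at h
    exact hzAB w h (hSB.2 w hw z hz)
  rw [Finset.mem_erase, Finset.mem_inter]
  exact ⟨fun h => hyS (h ▸ hyT'), (mem_traces_exchange hyS hzS).1 hS.1, hS.2⟩

lemma Admissible.card_filter_inter_le (hU : Admissible k t U) (ht : 2 ≤ t)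
    (hn : 2 * k ^ 2 + t < n) {B : Finset (Finset (Fin n))} (hB : B ∈ U) {T : Finset (Fin n)}
    (hT : T ∉ traces t B) (m : ℕ) :
    (U.filter fun A => T ∈ traces t A ∧ (traces t A ∩ traces t B).card ≤ m).card ≤
      n ^ (2 * m) * (U.filter fun A => T ∈ traces t A ∧
        Disjoint (traces t A) (traces t B)).card := by
  induction m with
  | zero => simp [Finset.disjoint_iff_inter_eq_empty]
  | succ m ih =>
    set V := U.filter fun A => T ∈ traces t A ∧ (traces t A ∩ traces t B).card ≤ m
    have hsub : (U.filter fun A => T ∈ traces t A ∧ (traces t A ∩ traces t B).card ≤ m + 1) ⊆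
        (V ×ˢ ((Finset.univ : Finset (Fin n)) ×ˢ (Finset.univ : Finset (Fin n)))).image
          fun a => exchange a.2.1 a.2.2 a.1 := by
      intro A hA
      rw [Finset.mem_filter] at hA
      suffices ∃ y z, exchange y z A ∈ V by
        obtain ⟨y, z, h⟩ := this
        refine Finset.mem_image.2 ⟨(exchange y z A, y, z), by simpa using h, ?_⟩
        exact exchange_exchange y z A
      by_cases hm : (traces t A ∩ traces t B).card ≤ m
      · refine ⟨⟨0, by omega⟩, ⟨0, by omega⟩, ?_⟩
        rw [exchange_self]
        exact Finset.mem_filter.2 ⟨hA.1, hA.2.1, hm⟩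
      · obtain ⟨T', hT'⟩ := Finset.card_pos.1 (by omega : 0 < (traces t A ∩ traces t B).card)
        obtain ⟨y, z, h1, h2⟩ := hU.exists_exchange ht hn hA.1 hB hA.2.1 hT'
          (fun h => hT (h ▸ (Finset.mem_inter.1 hT').2))
        refine ⟨y, z, Finset.mem_filter.2 ⟨hU.exchange_mem A hA.1 y z, h1, ?_⟩⟩
        refine (Finset.card_le_card h2).trans ?_
        rw [Finset.card_erase_of_mem hT']
        omega
    refine (Finset.card_le_card hsub).trans (Finset.card_image_le.trans ?_)
    rw [Finset.card_product, Finset.card_product, Finset.card_univ, Fintype.card_fin]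
    calc V.card * (n * n) ≤ n ^ (2 * m) * _ * (n * n) := by gcongr
      _ = _ := by ring

/-- A positive proportion (up to a polynomial factor) of the members of `U` with trace `T` have
no trace in common with a given member of `U` not having trace `T`. -/
lemma Admissible.card_filter_trace_le (hU : Admissible k t U) (ht : 2 ≤ t)
    (hn : 2 * k ^ 2 + t < n) (hnt : 2 * t ≤ n) {B : Finset (Finset (Fin n))} (hB : B ∈ U)
    {T : Finset (Fin n)} (hTt : T.card = t) (hT : T ∉ traces t B) :
    (U.filter fun A => T ∈ traces t A).card ≤ 2 * n ^ (2 * (2 ^ (k + 2) * k)) *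
      (U.filter fun A => T ∈ traces t A ∧ Disjoint (traces t A) (traces t B)).card := by
  set m := 2 ^ (k + 2) * k with hm
  set V := U.filter fun A => T ∈ traces t A with hV
  have hsum : (∑ A ∈ V, (traces t A ∩ traces t B).card) * (n - t) ≤
      2 ^ (k + 1) * k * V.card * (n - t) := by
    calc (∑ A ∈ V, (traces t A ∩ traces t B).card) * (n - t)
        = ∑ T' ∈ traces t B, (V.filter fun A => T' ∈ traces t A).card * (n - t) := by
          rw [← Finset.sum_mul]
          congr 1
          refine Eq.trans (Finset.sum_congr rfl fun A _ => ?_)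
            (Finset.sum_card_bipartiteAbove_eq_sum_card_bipartiteBelow
              (s := V) (t := traces t B) fun A T' => T' ∈ traces t A)
          congr 1
          ext T'
          simp [Finset.bipartiteAbove, and_comm]
      _ ≤ ∑ _T' ∈ traces t B, k * V.card := by
          refine Finset.sum_le_sum fun T' hT' => ?_
          have := hU.card_filter_pair_le ht hTt
            ((mem_traces_iff (by omega) (hU.isPartition B hB)).1 hT').1 (fun h => hT (h ▸ hT'))
          rwa [← Finset.filter_filter] at this
      _ = (traces t B).card * (k * V.card) := by simp
      _ ≤ (n * 2 ^ k) * (k * V.card) := by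
          gcongr
          exact hU.card_traces_le (by omega) hB
      _ ≤ (2 * (n - t) * 2 ^ k) * (k * V.card) := by
          gcongr
          omega
      _ = _ := by ring
  have hsum := Nat.le_of_mul_le_mul_right hsum (by omega)
  have hmarkov : (V.filter fun A => ¬ (traces t A ∩ traces t B).card ≤ m).card * (m + 1) ≤
      ∑ A ∈ V, (traces t A ∩ traces t B).card := by
    rw [← smul_eq_mul]
    refine (Finset.card_nsmul_le_sum _ (fun A => (traces t A ∩ traces t B).card) _
      fun A hA => ?_).trans (Finset.sum_le_sum_of_subset (Finset.filter_subset _ _))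
    have := (Finset.mem_filter.1 hA).2
    omega
  have hsplit := Finset.card_filter_add_card_filter_not (s := V)
    (fun A => (traces t A ∩ traces t B).card ≤ m)
  have hlow := hU.card_filter_inter_le ht hn hB hT m
  rw [← Finset.filter_filter, ← hV] at hlow
  have hhalf : 2 * (V.filter fun A => ¬ (traces t A ∩ traces t B).card ≤ m).card ≤ V.card := by
    obtain hm0 | hm0 := Nat.eq_zero_or_pos (2 ^ (k + 1) * k)
    · rw [hm0] at hsum
      have : (V.filter fun A => ¬ (traces t A ∩ traces t B).card ≤ m).card = 0 := by
        nlinarith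
      omega
    · refine Nat.le_of_mul_le_mul_left ?_ hm0
      have : m = 2 * (2 ^ (k + 1) * k) := by rw [hm]; ring
      nlinarith
  rw [mul_assoc]
  omega

lemma Admissible.card_le_mul (hU : Admissible k t U) {u : ℕ}
    (h : ∀ T : Finset (Fin n), T.card = t → (U.filter fun A => T ∈ traces t A).card ≤ u) :
    U.card ≤ n ^ t * u := by
  have hsub : U ⊆ (Finset.powersetCard t Finset.univ).biUnion
      fun T => U.filter fun A => T ∈ traces t A := by
    intro A hA
    obtain ⟨p, hp, hpt⟩ := hU.le_card A hA
    obtain ⟨T, hTp, hT⟩ := Finset.exists_subset_card_eq hpt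
    simp only [Finset.mem_biUnion, Finset.mem_powersetCard, Finset.mem_filter]
    exact ⟨T, ⟨Finset.subset_univ T, hT⟩, hA, by
      simp only [traces, Finset.mem_filter]
      exact ⟨Finset.mem_univ T, hT, p, hp, hTp⟩⟩
  refine (Finset.card_le_card hsub).trans ((Finset.card_biUnion_le_card_mul _ _ u
    fun T hT => h T (Finset.mem_powersetCard.1 hT).2).trans ?_)
  rw [Finset.card_powersetCard, Finset.card_univ, Fintype.card_fin]
  gcongr
  exact Nat.choose_le_pow n t

/-- An intersecting family with few members free of small kernels, where small kernels have no
common element, is small. -/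
lemma Admissible.card_filter_kernel_mul_le (hU : Admissible k t U) (ht : 2 ≤ t)
    {F : Finset (Finset (Finset (Fin n)))} (hF : F ⊆ U) {R q : ℕ}
    (hmax : ∀ T : Finset (Fin n), T.card = t → (U.filter fun A => T ∈ traces t A).card ≤ F.card)
    (hker : ∀ X Y, X.card < q → Y.card < q → IsKernel F (traces t) R X →
      IsKernel F (traces t) R Y → ¬ Disjoint X Y)
    (hex : ∃ X, X.card < q ∧ IsKernel F (traces t) R X)
    (hno : ∀ T, ∃ X, X.card < q ∧ IsKernel F (traces t) R X ∧ T ∉ X) :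
    (F.filter fun A => ∃ X, X.card < q ∧ IsKernel F (traces t) R X ∧ X ⊆ traces t A).card *
      (n - t) ≤ q ^ 2 * k * F.card := by
  obtain ⟨X, hXq, hX⟩ := hex
  choose Y hYq hY hTY using hno
  have hcard : ∀ Z, IsKernel F (traces t) R Z → ∀ T ∈ Z, T.card = t := by
    rintro Z ⟨G, hG, ⟨A, hA⟩, hZ, -⟩ T hT
    exact ((mem_traces_iff (by omega) (hU.isPartition A (hF (hG hA)))).1 (hZ A hA hT)).1
  have hsub : (F.filter fun A => ∃ X, X.card < q ∧ IsKernel F (traces t) R X ∧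
      X ⊆ traces t A) ⊆ X.biUnion fun T => (Y T).biUnion fun T' =>
        U.filter fun A => T ∈ traces t A ∧ T' ∈ traces t A := by
    intro A hA
    obtain ⟨hAF, Z, hZq, hZ, hZA⟩ := Finset.mem_filter.1 hA
    obtain ⟨T, hTZ, hTX⟩ := Finset.not_disjoint_iff.1 (hker Z X hZq hXq hZ hX)
    obtain ⟨T', hTZ', hTY'⟩ := Finset.not_disjoint_iff.1 (hker Z (Y T) hZq (hYq T) hZ (hY T))
    simp only [Finset.mem_biUnion, Finset.mem_filter]
    exact ⟨T, hTX, T', hTY', hF hAF, hZA hTZ, hZA hTZ'⟩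
  calc _ ≤ (∑ T ∈ X, ∑ T' ∈ Y T,
          (U.filter fun A => T ∈ traces t A ∧ T' ∈ traces t A).card) * (n - t) := by
        gcongr
        refine (Finset.card_le_card hsub).trans (Finset.card_biUnion_le.trans ?_)
        exact Finset.sum_le_sum fun T _ => Finset.card_biUnion_le
    _ = ∑ T ∈ X, ∑ T' ∈ Y T,
          (U.filter fun A => T ∈ traces t A ∧ T' ∈ traces t A).card * (n - t) := by
        rw [Finset.sum_mul]
        exact Finset.sum_congr rfl fun T _ => Finset.sum_mul _ _ _
    _ ≤ ∑ T ∈ X, ∑ _T' ∈ Y T, k * F.card := by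
        refine Finset.sum_le_sum fun T hT => Finset.sum_le_sum fun T' hT' => ?_
        refine (hU.card_filter_pair_le ht (hcard X hX T hT) (hcard _ (hY T) T' hT')
          fun h => hTY T (h ▸ hT')).trans ?_
        exact Nat.mul_le_mul_left k (hmax T (hcard X hX T hT))
    _ ≤ ∑ _T ∈ X, q * (k * F.card) := by
        refine Finset.sum_le_sum fun T _ => ?_
        rw [Finset.sum_const, smul_eq_mul]
        gcongr
        exact (hYq T).le
    _ ≤ q * (q * (k * F.card)) := by
        rw [Finset.sum_const, smul_eq_mul]
        gcongr
    _ = _ := by ring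

/-- The theorem for admissible families, with explicit conditions on the parameters. -/
lemma Admissible.exists_trace (hU : Admissible k t U) (ht : 2 ≤ t) (hk : 0 < k)
    {F : Finset (Finset (Finset (Fin n)))} (hF : F ⊆ U) (hFne : F.Nonempty)
    (hint : ∀ A ∈ F, ∀ B ∈ F, ¬ Disjoint (traces t A) (traces t B))
    (hmax : ∀ T : Finset (Fin n), T.card = t → (U.filter fun A => T ∈ traces t A).card ≤ F.card)
    {L s R q : ℕ} (hL : 0 < L) (hs : 0 < s) (hR : R = L * 2 ^ (s + 5) * (2 * s))
    (hqR : 2 * q ≤ R) (hLs : n * 2 ^ k < L ^ s) (hRn : 2 * k * R ^ 2 ^ (k + 4) ≤ n)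
    (hRq : 3 * n ^ (2 * (2 ^ (k + 2) * k) + t) < R ^ q) (hn : 2 * k ^ 2 + t < n)
    (hqn : 2 * q ^ 2 * k < n - t) (hnt : 2 * t ≤ n) :
    ∃ T : Finset (Fin n), T.card = t ∧ ∀ A ∈ F, T ∈ traces t A := by
  have hRpos : 0 < R := by rw [hR]; positivity
  have hUF : U.card ≤ n ^ t * F.card := hU.card_le_mul hmax
  have hker : ∀ X Y, X.card < q → Y.card < q → IsKernel F (traces t) R X →
      IsKernel F (traces t) R Y → ¬ Disjoint X Y := by
    intro X Y hXq hYq hX hY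
    rw [hR] at hX hY
    exact hX.not_disjoint hL hs
      (fun A hA => (hU.card_traces_le (by omega) (hF hA)).trans_lt hLs) hint hY
      (by rw [← hR]; omega) (by rw [← hR]; omega)
  set F₀ := F.filter fun A => ¬ ∃ X, X.card < q ∧ IsKernel F (traces t) R X ∧ X ⊆ traces t A
    with hF₀
  set F₁ := F.filter fun A => ∃ X, X.card < q ∧ IsKernel F (traces t) R X ∧ X ⊆ traces t A
    with hF₁
  have hsplit : F₁.card + F₀.card = F.card := by
    convert Finset.card_filter_add_card_filter_not _
  have hrest : F₀.card * R ^ q ≤ n ^ t * F.card := by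
    have hspread : ∀ X, (F.filter fun A => X ⊆ traces t A).card * R ^ (2 * X.card) ≤ U.card :=
      fun X => (Nat.mul_le_mul_right _ (Finset.card_le_card
        (Finset.filter_subset_filter _ hF))).trans
          (hU.card_superset_traces_le ht hk hRpos (by omega) hRn X)
    have hfree := card_no_kernel_le (E := traces t) (q := q) hRpos
      fun X => le_of_eq_of_le (by congr!) (hspread X)
    refine (le_of_eq_of_le ?_ hfree).trans hUF
    congr!
  have hFpos : 0 < F.card := hFne.card_pos
  have hnpos : 0 < n := by omega
  have hntpos : 0 < n ^ t := by positivity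
  have hmpos : 0 < n ^ (2 * (2 ^ (k + 2) * k)) := by positivity
  rw [pow_add] at hRq
  have hthird : 3 * F₀.card ≤ F.card := by
    refine Nat.le_of_mul_le_mul_left ?_ hntpos
    refine le_trans ?_ hrest
    have : 3 * n ^ t ≤ R ^ q := by nlinarith
    nlinarith
  have hex : ∃ X, X.card < q ∧ IsKernel F (traces t) R X := by
    obtain ⟨A, hA⟩ := Finset.card_pos.1 (by omega : 0 < F₁.card)
    obtain ⟨X, hXq, hX, -⟩ := (Finset.mem_filter.1 hA).2
    exact ⟨X, hXq, hX⟩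
  by_cases hcommon : ∃ T, ∀ X, X.card < q → IsKernel F (traces t) R X → T ∈ X
  · obtain ⟨T, hT⟩ := hcommon
    have hTt : T.card = t := by
      obtain ⟨X, hXq, hX⟩ := hex
      obtain ⟨G, hG, ⟨A, hA⟩, hXG, -⟩ := id hX
      exact ((mem_traces_iff (by omega) (hU.isPartition A (hF (hG hA)))).1
        (hXG A hA (hT X hXq hX))).1
    refine ⟨T, hTt, ?_⟩
    by_contra! hB
    obtain ⟨B, hB, hTB⟩ := hB
    have hder := hU.card_filter_trace_le ht hn hnt (hF hB) hTt hTB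
    set D := U.filter fun A => T ∈ traces t A ∧ Disjoint (traces t A) (traces t B)
    set F₂ := F.filter fun A => T ∈ traces t A
    have hF₁₂ : F₁.card ≤ F₂.card := by
      refine Finset.card_le_card fun A hA => ?_
      obtain ⟨hAF, X, hXq, hX, hXA⟩ := Finset.mem_filter.1 hA
      exact Finset.mem_filter.2 ⟨hAF, hXA (hT X hXq hX)⟩
    have hsum : F₂.card + D.card ≤ (U.filter fun A => T ∈ traces t A).card := by
      rw [← Finset.card_union_of_disjoint]
      · refine Finset.card_le_card (Finset.union_subset (fun A hA => ?_) fun A hA => ?_)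
        · rw [Finset.mem_filter] at hA ⊢
          exact ⟨hF hA.1, hA.2⟩
        · rw [Finset.mem_filter] at hA ⊢
          exact ⟨hA.1, hA.2.1⟩
      · refine Finset.disjoint_left.2 fun A hA hA' => ?_
        exact hint A (Finset.mem_filter.1 hA).1 B hB (Finset.mem_filter.1 hA').2.2
    have hDF : D.card ≤ F₀.card := by
      have := hmax T hTt
      omega
    have hFle : F.card ≤ 3 * n ^ (2 * (2 ^ (k + 2) * k)) * F₀.card := by
      have h2 := Nat.mul_le_mul_left (2 * n ^ (2 * (2 ^ (k + 2) * k))) hDF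
      have h3 := Nat.mul_le_mul_right F₀.card hmpos
      linarith
    have hF₀pos : 0 < F₀.card := by
      by_contra! h
      simp only [Nat.le_zero.1 h, mul_zero] at hFle
      omega
    refine absurd hRq (not_lt.2 (Nat.le_of_mul_le_mul_left ?_ hF₀pos))
    calc _ ≤ n ^ t * F.card := hrest
      _ ≤ n ^ t * (3 * n ^ (2 * (2 ^ (k + 2) * k)) * F₀.card) := by gcongr
      _ = _ := by ring
  · exfalso
    push Not at hcommon
    have h := hU.card_filter_kernel_mul_le ht hF hmax hker hex hcommon
    rw [← hF₁] at h
    have h2 : 2 * F.card * (n - t) ≤ 3 * F₁.card * (n - t) := Nat.mul_le_mul_right _ (by omega)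
    have h3 : 2 * q ^ 2 * k * F.card < (n - t) * F.card := Nat.mul_lt_mul_of_pos_right hqn hFpos
    have h4 : 0 ≤ q ^ 2 * k * F.card := Nat.zero_le _
    linarith

end Partitions

section Parameters

lemma exists_scale {a c b : ℕ} (ha : 0 < a) (hc : 0 < c) (hb : 0 < b) (L₀ : ℕ) :
    ∃ n₀ : ℕ, ∀ n, n₀ ≤ n → ∃ L, L₀ ≤ L ∧ a * (L * c) ^ b ≤ n ∧ n < L ^ (2 * b) := by
  have hgrow : ∀ L, L ≤ a * (L * c) ^ b := fun L => by
    calc L ≤ (L * c) ^ 1 := by rw [pow_one]; exact Nat.le_mul_of_pos_right L hc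
      _ ≤ (L * c) ^ b := by
        obtain rfl | hL := Nat.eq_zero_or_pos L
        · simp
        · exact Nat.pow_le_pow_right (by positivity) hb
      _ ≤ _ := Nat.le_mul_of_pos_left _ ha
  set L₁ := max L₀ (a * (2 * c) ^ b) with hL₁
  refine ⟨a * (L₁ * c) ^ b, fun n hn => ?_⟩
  set L := Nat.findGreatest (fun L => a * (L * c) ^ b ≤ n) n with hL
  have hle : L₁ ≤ L := Nat.le_findGreatest ((hgrow L₁).trans hn) hn
  have hspec : a * (L * c) ^ b ≤ n :=
    Nat.findGreatest_spec (P := fun L => a * (L * c) ^ b ≤ n) ((hgrow L₁).trans hn) hn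
  have hnot : n < a * ((L + 1) * c) ^ b := by
    by_contra! h
    exact Nat.findGreatest_is_greatest (Nat.lt_succ_self L) ((hgrow (L + 1)).trans h) h
  have hapos : 0 < a * (2 * c) ^ b := by positivity
  have hLa : a * (2 * c) ^ b ≤ L := (le_max_right _ _).trans hle
  refine ⟨L, (le_max_left _ _).trans hle, hspec, hnot.trans_le ?_⟩
  calc a * ((L + 1) * c) ^ b ≤ a * ((2 * L) * c) ^ b := by gcongr; omega
    _ = a * (2 * c) ^ b * L ^ b := by rw [mul_pow, mul_pow, mul_pow]; ring
    _ ≤ L ^ 1 * L ^ b := by rw [pow_one]; gcongr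
    _ = L ^ (1 + b) := (pow_add _ _ _).symm
    _ ≤ L ^ (2 * b) := Nat.pow_le_pow_right (by omega) (by omega)

/-- For large `n`, the conditions on the parameters in `Admissible.exists_trace` can be met. -/
lemma exists_parameters {k : ℕ} (hk : 0 < k) (t : ℕ) :
    ∃ n₀ : ℕ, ∀ n, n₀ ≤ n → ∃ L s R q : ℕ, 0 < L ∧ 0 < s ∧ R = L * 2 ^ (s + 5) * (2 * s) ∧
      2 * q ≤ R ∧ n * 2 ^ k < L ^ s ∧ 2 * k * R ^ 2 ^ (k + 4) ≤ n ∧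
      3 * n ^ (2 * (2 ^ (k + 2) * k) + t) < R ^ q ∧ 2 * k ^ 2 + t < n ∧
      2 * q ^ 2 * k < n - t ∧ 2 * t ≤ n := by
  set b := 2 ^ (k + 4)
  have hb : 0 < b := by positivity
  set s := 2 * b + 1
  set c := 2 ^ (s + 5) * (2 * s)
  have hc : 0 < c := by positivity
  set M := 2 * (2 ^ (k + 2) * k) + t
  set q := 2 * b * M + 2 with hq
  obtain ⟨n₀, hn₀⟩ := exists_scale (a := 2 * k) (by omega) hc hb (2 * q + 2 ^ k)
  refine ⟨n₀ + 2 * k ^ 2 + 2 * q ^ 2 * k + 2 * t + 1, fun n hn => ?_⟩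
  obtain ⟨L, hL, hLn, hnL⟩ := hn₀ n (by omega)
  have hLR : L ≤ L * c := Nat.le_mul_of_pos_right L hc
  have hpow : 0 < 2 ^ k := by positivity
  have hq2 : 2 ≤ q := by omega
  have hL0 : 0 < L := by omega
  refine ⟨L, s, L * c, q, hL0, by omega, (mul_assoc _ _ _).symm, by omega, ?_, hLn, ?_,
    by omega, by omega, by omega⟩
  · calc n * 2 ^ k < L ^ (2 * b) * 2 ^ k := by gcongr
      _ ≤ L ^ (2 * b) * L := by gcongr; omega
      _ = L ^ s := (pow_succ _ _).symm
  · calc 3 * n ^ M ≤ 3 * (L ^ (2 * b)) ^ M := by gcongr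
      _ ≤ 3 * ((L * c) ^ (2 * b)) ^ M := by gcongr
      _ = 3 * (L * c) ^ (2 * b * M) := by rw [← pow_mul]
      _ < (L * c) ^ 2 * (L * c) ^ (2 * b * M) := by
        gcongr
        exact (by norm_num : 3 < 2 ^ 2).trans_le (Nat.pow_le_pow_left (by omega) 2)
      _ = (L * c) ^ q := by rw [← pow_add, hq, add_comm]

end Parameters

lemma admissible_filter {n k t ℓ : ℕ} {kseq : Fin ℓ → ℕ} (hle : ∀ i, kseq i ≤ k) {i₀ : Fin ℓ}
    (hi₀ : t ≤ kseq i₀) :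
    Admissible k t (Finset.univ.filter fun P : Finset (Finset (Fin n)) =>
      IsPartition P ∧ Multiset.map Finset.card P.val = Multiset.map kseq Finset.univ.val) where
  isPartition A hA := (Finset.mem_filter.1 hA).2.1
  card_le A hA p hp := by
    have h : p.card ∈ Multiset.map Finset.card A.val := Multiset.mem_map_of_mem _ hp
    rw [(Finset.mem_filter.1 hA).2.2] at h
    obtain ⟨i, -, hi⟩ := Multiset.mem_map.1 h
    exact hi ▸ hle i
  le_card A hA := by
    have h : kseq i₀ ∈ Multiset.map kseq Finset.univ.val :=
      Multiset.mem_map_of_mem _ (Finset.mem_univ i₀)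
    rw [← (Finset.mem_filter.1 hA).2.2] at h
    obtain ⟨p, hp, hpi⟩ := Multiset.mem_map.1 h
    exact ⟨p, hp, hpi ▸ hi₀⟩
  exchange_mem A hA y z := by
    obtain ⟨-, hA, hcard⟩ := Finset.mem_filter.1 hA
    exact Finset.mem_filter.2 ⟨Finset.mem_univ _, hA.exchange y z,
      (map_card_exchange y z A).trans hcard⟩

/-- The theorem for an admissible family `U` in place of `𝓤_P`. -/
lemma Admissible.eq_filter {n k t : ℕ} {U : Finset (Finset (Finset (Fin n)))}
    (hU : Admissible k t U) (ht : 2 ≤ t)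
    {L s R q : ℕ} (hL : 0 < L) (hs : 0 < s) (hR : R = L * 2 ^ (s + 5) * (2 * s))
    (hqR : 2 * q ≤ R) (hLs : n * 2 ^ k < L ^ s) (hRn : 2 * k * R ^ 2 ^ (k + 4) ≤ n)
    (hRq : 3 * n ^ (2 * (2 ^ (k + 2) * k) + t) < R ^ q) (hn : 2 * k ^ 2 + t < n)
    (hqn : 2 * q ^ 2 * k < n - t) (hnt : 2 * t ≤ n)
    {F : Finset (Finset (Finset (Fin n)))} (hF : F ⊆ U)
    (hint : ∀ A ∈ F, ∀ B ∈ F, ¬ Disjoint (traces t A) (traces t B))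
    (hmax : ∀ G ⊆ U, (∀ A ∈ G, ∀ B ∈ G, ¬ Disjoint (traces t A) (traces t B)) →
      G.card ≤ F.card) :
    ∃ T : Finset (Fin n), T.card = t ∧ F = U.filter fun A => T ∈ traces t A := by
  have hstar : ∀ T : Finset (Fin n), (U.filter fun A => T ∈ traces t A).card ≤ F.card := by
    refine fun T => hmax _ (Finset.filter_subset _ _) fun A hA B hB => ?_
    exact Finset.not_disjoint_iff.2 ⟨T, (Finset.mem_filter.1 hA).2, (Finset.mem_filter.1 hB).2⟩
  obtain rfl | hFne := F.eq_empty_or_nonempty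
  · obtain ⟨T, -, hT⟩ := Finset.exists_subset_card_eq
      (by rw [Finset.card_univ, Fintype.card_fin]; omega : t ≤ (Finset.univ : Finset (Fin n)).card)
    refine ⟨T, hT, ?_⟩
    have h := hstar T
    rw [Finset.card_empty, Nat.le_zero, Finset.card_eq_zero] at h
    exact h.symm
  · have hk : 0 < k := by
      obtain ⟨A, hA⟩ := hFne
      obtain ⟨p, hp, htp⟩ := hU.le_card A (hF hA)
      have := hU.card_le A (hF hA) p hp
      omega
    obtain ⟨T, hTt, hT⟩ := hU.exists_trace ht hk hF hFne hint (fun T _ => hstar T)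
      hL hs hR hqR hLs hRn hRq hn hqn hnt
    exact ⟨T, hTt, Finset.eq_of_subset_of_card_le
      (fun A hA => Finset.mem_filter.2 ⟨hF hA, hT A hA⟩) (hstar T)⟩

lemma _root_.IsPartition.exists_one_le_card_inter {n : ℕ} {A B : Finset (Finset (Fin n))}
    (hA : IsPartition A) (hB : IsPartition B) (x : Fin n) :
    ∃ p ∈ A, ∃ q ∈ B, 1 ≤ (p ∩ q).card := by
  obtain ⟨p, hp, hxp⟩ := hA.2.2 x
  obtain ⟨q, hq, hxq⟩ := hB.2.2 x
  exact ⟨p, hp, q, hq, Finset.card_pos.2 ⟨x, Finset.mem_inter.2 ⟨hxp, hxq⟩⟩⟩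

end PartiallyIntersecting

theorem stmt4 (k t : ℕ) (ht : 1 ≤ t) (htk : t ≤ k) :
    ∃ ℓ₀ : ℕ, ∀ ℓ : ℕ, ℓ₀ ≤ ℓ → ∀ hℓ : 1 ≤ ℓ,
      ∀ kseq : Fin ℓ → ℕ, Monotone kseq → (∀ i, 1 ≤ kseq i) →
        kseq ⟨ℓ - 1, by omega⟩ = k →
        ∀ n : ℕ, n = ∑ i, kseq i →
          ∀ 𝓕 : Finset (Finset (Finset (Fin n))),
            -- `𝓕 ⊆ 𝓤_P`
            (∀ P ∈ 𝓕, IsPartition P ∧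
              Multiset.map Finset.card P.val = Multiset.map kseq Finset.univ.val) →
            -- `𝓕` is partially `t`-intersecting
            (∀ P ∈ 𝓕, ∀ Q ∈ 𝓕, ∃ p ∈ P, ∃ q ∈ Q, t ≤ (p ∩ q).card) →
            -- `𝓕` has maximum size among such families
            (∀ 𝓖 : Finset (Finset (Finset (Fin n))),
              (∀ P ∈ 𝓖, IsPartition P ∧
                Multiset.map Finset.card P.val = Multiset.map kseq Finset.univ.val) →
              (∀ P ∈ 𝓖, ∀ Q ∈ 𝓖, ∃ p ∈ P, ∃ q ∈ Q, t ≤ (p ∩ q).card) →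
              𝓖.card ≤ 𝓕.card) →
            -- conclusion: `𝓕 = 𝓒_P^T` for some `t`-element `T`
            ∃ T : Finset (Fin n), T.card = t ∧
              𝓕 = Finset.univ.filter fun P : Finset (Finset (Fin n)) =>
                (IsPartition P ∧
                  Multiset.map Finset.card P.val = Multiset.map kseq Finset.univ.val) ∧
                ∃ p ∈ P, T ⊆ p := by
  obtain ⟨n₀, hn₀⟩ := PartiallyIntersecting.exists_parameters (k := k) (by omega) t
  refine ⟨n₀, fun ℓ hℓ₀ hℓ kseq hmono hpos hlast n hn 𝓕 h𝓕 hint hmax => ?_⟩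
  have hℓn : ℓ ≤ n := by
    rw [hn]
    simpa using Finset.card_nsmul_le_sum Finset.univ kseq 1 fun i _ => hpos i
  set U := Finset.univ.filter fun P : Finset (Finset (Fin n)) =>
    IsPartition P ∧ Multiset.map Finset.card P.val = Multiset.map kseq Finset.univ.val with hUdef
  have hmem : ∀ P, P ∈ U ↔ IsPartition P ∧
      Multiset.map Finset.card P.val = Multiset.map kseq Finset.univ.val := by simp [hUdef]
  obtain rfl | ht2 : t = 1 ∨ 2 ≤ t := by omega
  · have hpart : ∀ P ∈ U, ∀ Q ∈ U, ∃ p ∈ P, ∃ q ∈ Q, 1 ≤ (p ∩ q).card := fun P hP Q hQ =>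
      ((hmem P).1 hP).1.exists_one_le_card_inter ((hmem Q).1 hQ).1 ⟨0, by omega⟩
    have h𝓕U : 𝓕 = U := Finset.eq_of_subset_of_card_le (fun P hP => (hmem P).2 (h𝓕 P hP))
      (hmax U (fun P hP => (hmem P).1 hP) hpart)
    refine ⟨{⟨0, by omega⟩}, Finset.card_singleton _, ?_⟩
    rw [h𝓕U]
    ext P
    simp only [hmem, Finset.mem_filter, Finset.mem_univ, true_and, Finset.singleton_subset_iff]
    exact ⟨fun h => ⟨h, h.1.2.2 _⟩, fun h => h.1⟩
  · have hle : ∀ i, kseq i ≤ k := fun i => by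
      rw [← hlast]
      exact hmono (Fin.mk_le_mk.2 (by omega) : (i : Fin ℓ) ≤ ⟨ℓ - 1, by omega⟩)
    have hU : PartiallyIntersecting.Admissible k t U :=
      PartiallyIntersecting.admissible_filter hle (hlast ▸ htk)
    obtain ⟨L, s, R, q, hL, hs, hR, hqR, hLs, hRn, hRq, hnk, hqn, hnt⟩ := hn₀ n (by omega)
    obtain ⟨T, hT, h⟩ := hU.eq_filter ht2 hL hs hR hqR hLs hRn hRq hnk hqn hnt
      (fun P hP => (hmem P).2 (h𝓕 P hP))
      (fun P hP Q hQ => PartiallyIntersecting.not_disjoint_traces.2 (hint P hP Q hQ))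
      (fun G hG hGint => hmax G (fun P hP => (hmem P).1 (hG hP))
        fun P hP Q hQ => PartiallyIntersecting.not_disjoint_traces.1 (hGint P hP Q hQ))
    refine ⟨T, hT, h.trans ?_⟩
    ext P
    simp [hUdef, PartiallyIntersecting.traces, hT]
end

section
/- Let ε ∈ (0,1] be real and n, r, q, t ≥ 1 be such that ε·r ≥ 24·q. Let 𝓐 be a family of subsets of [n] that is weakly (r,t)-spread, and let 𝓢 be a non-trivial t-intersecting family of subsets of [n], each of size at most q. Then there exists a t-element set T ⊆ [n] such that |𝓐[𝓢]| ≤ ε·|𝓐[T]|. -/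
open scoped Classical

/-- `𝓖(X) = {A \ X : A ∈ 𝓖, X ⊆ A}`. -/
def famRes {n : ℕ} (𝓖 : Finset (Finset (Fin n))) (X : Finset (Fin n)) :
    Finset (Finset (Fin n)) :=
  (𝓖.filter fun A => X ⊆ A).image fun A => A \ X

/-- Any two members of `𝓢` (possibly equal) meet in at least `t` elements. -/
def IsTIntersecting {α : Type*} [DecidableEq α] (t : ℕ) (𝓢 : Finset (Finset α)) : Prop :=
  ∀ S ∈ 𝓢, ∀ S' ∈ 𝓢, t ≤ (S ∩ S').card

/-- Some `t`-element set is contained in all members of `𝓢`. -/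
def IsTTrivial {α : Type*} (t : ℕ) (𝓢 : Finset (Finset α)) : Prop :=
  ∃ T : Finset α, T.card = t ∧ ∀ S ∈ 𝓢, T ⊆ S

/-- No member of `𝓢` can be replaced by a proper subset meeting all members in `t` elements. -/
def IsTIrreducible {α : Type*} [DecidableEq α] (t : ℕ) (𝓢 : Finset (Finset α)) : Prop :=
  ∀ S ∈ 𝓢, ∀ X, X ⊂ S → ∃ S' ∈ 𝓢, (X ∩ S').card < t

/-- The members of `𝓐` that contain some member of `𝓢`. -/
def famAbove {α : Type*} [DecidableEq α] (𝓐 𝓢 : Finset (Finset α)) : Finset (Finset α) :=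
  𝓐.filter fun A => ∃ S ∈ 𝓢, S ⊆ A

theorem IsTIntersecting.mono {α : Type*} [DecidableEq α] {t : ℕ} {𝓢 𝓢' : Finset (Finset α)}
    (h : IsTIntersecting t 𝓢) (hsub : 𝓢' ⊆ 𝓢) : IsTIntersecting t 𝓢' :=
  fun S hS S' hS' => h S (hsub hS) S' (hsub hS')

theorem card_famAbove_le_sum {α : Type*} [DecidableEq α] (𝓐 𝓢 : Finset (Finset α)) :
    (famAbove 𝓐 𝓢).card ≤ ∑ S ∈ 𝓢, (𝓐.filter fun A => S ⊆ A).card := by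
  refine (Finset.card_le_card ?_).trans Finset.card_biUnion_le
  intro A hA
  simp only [famAbove, Finset.mem_filter, Finset.mem_biUnion] at hA ⊢
  obtain ⟨hA, S, hS, hSA⟩ := hA
  exact ⟨S, hS, hA, hSA⟩

theorem famAbove_subset_of_refines {α : Type*} [DecidableEq α] (𝓐 : Finset (Finset α)) {𝓢 𝓢' : Finset (Finset α)}
    (h : ∀ S ∈ 𝓢, ∃ S' ∈ 𝓢', S' ⊆ S) : famAbove 𝓐 𝓢 ⊆ famAbove 𝓐 𝓢' := by
  intro A hA
  simp only [famAbove, Finset.mem_filter] at hA ⊢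
  obtain ⟨hA, S, hS, hSA⟩ := hA
  obtain ⟨S', hS', hS'S⟩ := h S hS
  exact ⟨hA, S', hS', hS'S.trans hSA⟩

theorem famAbove_union {α : Type*} [DecidableEq α] (𝓐 𝓢 𝓢' : Finset (Finset α)) :
    famAbove 𝓐 (𝓢 ∪ 𝓢') = famAbove 𝓐 𝓢 ∪ famAbove 𝓐 𝓢' := by
  ext A
  simp only [famAbove, Finset.mem_filter, Finset.mem_union]
  grind

/-- Branching: a set `X` missing `m` elements extends to at most `Q ^ m` members of the `k`-th
layer of an irreducible `t`-intersecting family of sets of size at most `Q`. -/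
theorem card_layer_above_le {α : Type*} [DecidableEq α] {t Q k : ℕ} {𝓢 : Finset (Finset α)}
    (hint : IsTIntersecting t 𝓢) (hirr : IsTIrreducible t 𝓢) (hQ : ∀ S ∈ 𝓢, S.card ≤ Q) (m : ℕ) :
    ∀ X : Finset α, X.card + m = k →
      (𝓢.filter fun S => S.card = k ∧ X ⊆ S).card ≤ Q ^ m := by
  induction m with
  | zero =>
    intro X hX
    rw [pow_zero, Finset.card_le_one]
    intro A hA B hB
    simp only [Finset.mem_filter] at hA hB
    rw [← Finset.eq_of_subset_of_card_le hA.2.2 (by omega),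
      ← Finset.eq_of_subset_of_card_le hB.2.2 (by omega)]
  | succ m ih =>
    intro X hX
    rcases (𝓢.filter fun S => S.card = k ∧ X ⊆ S).eq_empty_or_nonempty with h | ⟨W, hW⟩
    · rw [h]; simp
    · simp only [Finset.mem_filter] at hW
      have hXW : X ⊂ W := by
        refine Finset.ssubset_iff_subset_ne.2 ⟨hW.2.2, ?_⟩
        rintro rfl
        omega
      obtain ⟨S', hS', hlt⟩ := hirr W hW.1 X hXW
      have hcover : (𝓢.filter fun S => S.card = k ∧ X ⊆ S) ⊆
          (S' \ X).biUnion fun x => 𝓢.filter fun S => S.card = k ∧ insert x X ⊆ S := by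
        intro B hB
        simp only [Finset.mem_filter, Finset.mem_biUnion, Finset.mem_sdiff] at hB ⊢
        have hBS' := hint B hB.1 S' hS'
        have hnot : ¬ B ∩ S' ⊆ X ∩ S' := fun h => by
          have := Finset.card_le_card h
          omega
        obtain ⟨x, hx, hx'⟩ := Finset.not_subset.1 hnot
        simp only [Finset.mem_inter] at hx hx'
        exact ⟨x, ⟨hx.2, fun h => hx' ⟨h, hx.2⟩⟩, hB.1, hB.2.1,
          Finset.insert_subset hx.1 hB.2.2⟩
      calc _ ≤ _ := Finset.card_le_card hcover
        _ ≤ (S' \ X).card * Q ^ m := by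
          refine Finset.card_biUnion_le_card_mul _ _ _ fun x hx => ih _ ?_
          rw [Finset.card_insert_of_notMem (Finset.mem_sdiff.1 hx).2]
          omega
        _ ≤ Q * Q ^ m := by
          gcongr
          exact (Finset.card_le_card Finset.sdiff_subset).trans (hQ S' hS')
        _ = Q ^ (m + 1) := by ring

theorem card_top_layer_le {α : Type*} [DecidableEq α] {t j Q : ℕ} {𝓢 : Finset (Finset α)} (hj : 0 < j)
    (hint : IsTIntersecting t 𝓢) (hirr : IsTIrreducible t 𝓢) (hQ : ∀ S ∈ 𝓢, S.card ≤ Q)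
    (hcard : ∀ S ∈ 𝓢, S.card ≤ t + j) :
    (𝓢.filter fun S => S.card = t + j).card ≤ (4 * Q) ^ j := by
  rcases (𝓢.filter fun S => S.card = t + j).eq_empty_or_nonempty with h | ⟨S₁, hS₁⟩
  · rw [h]; simp
  simp only [Finset.mem_filter] at hS₁
  obtain ⟨hS₁, hS₁card⟩ := hS₁
  obtain ⟨S₂, hS₂, hC⟩ : ∃ S₂ ∈ 𝓢, (S₁ ∩ S₂).card = t := by
    obtain ⟨x, hx⟩ : S₁.Nonempty := Finset.card_pos.1 (by omega)
    obtain ⟨S₂, hS₂, hlt⟩ := hirr S₁ hS₁ _ (Finset.erase_ssubset hx)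
    refine ⟨S₂, hS₂, le_antisymm ?_ (hint _ hS₁ _ hS₂)⟩
    rw [Finset.erase_inter] at hlt
    have := Finset.pred_card_le_card_erase (s := S₁ ∩ S₂) (a := x)
    omega
  set C := S₁ ∩ S₂ with hCdef
  have hC₁ : C ⊆ S₁ := Finset.inter_subset_left
  have hC₂ : C ⊆ S₂ := Finset.inter_subset_right
  have htQ : t ≤ Q := hC ▸ (Finset.card_le_card hC₁).trans (hQ _ hS₁)
  have hpetal : ∀ S ∈ 𝓢, C ⊆ S → (S \ C).card ≤ j := fun S hS hCS => by
    rw [Finset.card_sdiff_of_subset hCS]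
    have := hcard S hS
    omega
  let I : ℕ → Finset (Finset α × Finset α × Finset α) := fun l =>
    C.powersetCard l ×ˢ ((S₁ \ C).powersetCard l ×ˢ (S₂ \ C).powersetCard l)
  let F : Finset α × Finset α × Finset α → Finset (Finset α) := fun p =>
    𝓢.filter fun S => S.card = t + j ∧ (C \ p.1) ∪ (p.2.1 ∪ p.2.2) ⊆ S
  have hdisj : Disjoint (S₁ \ C) (S₂ \ C) := by
    rw [Finset.disjoint_left]
    intro x hx hx'
    simp only [hCdef, Finset.mem_sdiff, Finset.mem_inter] at hx hx'
    tauto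
  have hcover : (𝓢.filter fun S => S.card = t + j) ⊆
      (Finset.range (j + 1)).biUnion fun l => (I l).biUnion F := by
    intro W hW
    obtain ⟨hW, hWcard⟩ := Finset.mem_filter.1 hW
    have hkey : ∀ S ∈ 𝓢, C ⊆ S → (C \ W).card ≤ (W ∩ (S \ C)).card := fun S hS hCS => by
      have h1 := hint W hW S hS
      have h2 : W ∩ S = (C ∩ W) ∪ (W ∩ (S \ C)) := by
        ext x
        have := @hCS x
        simp only [Finset.mem_union, Finset.mem_inter, Finset.mem_sdiff]
        tauto
      have h3 := Finset.card_union_le (C ∩ W) (W ∩ (S \ C))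
      have h4 := Finset.card_inter_add_card_sdiff C W
      rw [← h2] at h3
      omega
    obtain ⟨B₁, hB₁, hB₁card⟩ := Finset.exists_subset_card_eq (hkey S₁ hS₁ hC₁)
    obtain ⟨B₂, hB₂, hB₂card⟩ := Finset.exists_subset_card_eq (hkey S₂ hS₂ hC₂)
    have hB₁' := Finset.subset_inter_iff.1 hB₁
    have hB₂' := Finset.subset_inter_iff.1 hB₂
    simp only [Finset.mem_biUnion, Finset.mem_range]
    refine ⟨(C \ W).card, ?_, (C \ W, B₁, B₂), ?_, ?_⟩
    · have := Finset.card_le_card hB₁'.2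
      have := hpetal S₁ hS₁ hC₁
      omega
    · simp only [I, Finset.mem_product, Finset.mem_powersetCard]
      exact ⟨⟨Finset.sdiff_subset, trivial⟩, ⟨hB₁'.2, hB₁card⟩, hB₂'.2, hB₂card⟩
    · simp only [F, Finset.mem_filter]
      refine ⟨hW, hWcard, Finset.union_subset ?_ (Finset.union_subset hB₁'.1 hB₂'.1)⟩
      intro x hx
      simp only [Finset.mem_sdiff] at hx
      tauto
  have hfiber : ∀ l ∈ Finset.range (j + 1), ((I l).biUnion F).card ≤ 2 ^ j * Q ^ j * j.choose l := by
    intro l hl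
    have hlj : l ≤ j := by simpa [Nat.lt_succ_iff] using hl
    have hF : ∀ p ∈ I l, (F p).card ≤ Q ^ (j - l) := by
      rintro ⟨D, B₁, B₂⟩ hp
      simp only [I, Finset.mem_product, Finset.mem_powersetCard] at hp
      obtain ⟨⟨hD, hDcard⟩, ⟨hB₁, hB₁card⟩, hB₂, hB₂card⟩ := hp
      refine card_layer_above_le hint hirr hQ _ _ ?_
      rw [Finset.card_union_of_disjoint, Finset.card_union_of_disjoint,
        Finset.card_sdiff_of_subset hD]
      · have := Finset.card_le_card hD
        dsimp only
        omega
      · exact hdisj.mono hB₁ hB₂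
      · exact Finset.disjoint_union_right.2
          ⟨Finset.disjoint_sdiff.mono Finset.sdiff_subset hB₁,
            Finset.disjoint_sdiff.mono Finset.sdiff_subset hB₂⟩
    calc ((I l).biUnion F).card ≤ (I l).card * Q ^ (j - l) :=
          Finset.card_biUnion_le_card_mul _ _ _ hF
      _ = t.choose l * ((S₁ \ C).card.choose l * (S₂ \ C).card.choose l) * Q ^ (j - l) := by
          simp only [I, Finset.card_product, Finset.card_powersetCard, hC]
      _ ≤ Q ^ l * (2 ^ j * j.choose l) * Q ^ (j - l) := by
          gcongr
          · exact (Nat.choose_le_pow t l).trans (Nat.pow_le_pow_left htQ l)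
          · exact (Nat.choose_le_choose l (hpetal S₁ hS₁ hC₁)).trans (Nat.choose_le_two_pow j l)
          · exact hpetal S₂ hS₂ hC₂
      _ = 2 ^ j * Q ^ j * j.choose l := by
          rw [← Nat.add_sub_of_le hlj, pow_add Q]
          simp only [Nat.add_sub_cancel_left]
          ring
  calc _ ≤ _ := Finset.card_le_card hcover
    _ ≤ _ := Finset.card_biUnion_le
    _ ≤ ∑ l ∈ Finset.range (j + 1), 2 ^ j * Q ^ j * j.choose l := Finset.sum_le_sum hfiber
    _ = (4 * Q) ^ j := by
      rw [← Finset.mul_sum, Nat.sum_range_choose, mul_pow, show 4 = 2 * 2 from rfl, mul_pow]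
      ring

/-- If a `t`-intersecting family is not irreducible, it refines to one with fewer incidences. -/
theorem IsTIntersecting.exists_refinement {α : Type*} [DecidableEq α] {t : ℕ} {𝓢 : Finset (Finset α)}
    (hint : IsTIntersecting t 𝓢) (hirr : ¬ IsTIrreducible t 𝓢) :
    ∃ 𝓢' : Finset (Finset α), IsTIntersecting t 𝓢' ∧ ∑ S ∈ 𝓢', S.card < ∑ S ∈ 𝓢, S.card ∧
      (∀ S ∈ 𝓢, ∃ S' ∈ 𝓢', S' ⊆ S) ∧ ∀ S' ∈ 𝓢', ∃ S ∈ 𝓢, S' ⊆ S := by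
  simp only [IsTIrreducible] at hirr
  push Not at hirr
  obtain ⟨S, hS, X, hXS, hX⟩ := hirr
  refine ⟨insert X (𝓢.erase S), ?_, ?_, ?_, ?_⟩
  · intro A hA B hB
    rw [Finset.mem_insert, Finset.mem_erase] at hA hB
    rcases hA with rfl | hA <;> rcases hB with rfl | hB
    · have := hX S hS
      rwa [Finset.inter_eq_left.2 hXS.subset, ← Finset.inter_self B] at this
    · exact hX B hB.2
    · rw [Finset.inter_comm]
      exact hX A hA.2
    · exact hint A hA.2 B hB.2
  · have h1 := Finset.card_lt_card hXS
    have h2 := Finset.add_sum_erase 𝓢 Finset.card hS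
    by_cases hmem : X ∈ 𝓢.erase S
    · rw [Finset.insert_eq_of_mem hmem]
      omega
    · rw [Finset.sum_insert hmem]
      omega
  · intro A hA
    by_cases h : A = S
    · exact ⟨X, Finset.mem_insert_self _ _, h ▸ hXS.subset⟩
    · exact ⟨A, Finset.mem_insert_of_mem (Finset.mem_erase.2 ⟨h, hA⟩), subset_rfl⟩
  · intro A hA
    rw [Finset.mem_insert, Finset.mem_erase] at hA
    rcases hA with rfl | hA
    · exact ⟨S, hS, hXS.subset⟩
    · exact ⟨A, hA.2, subset_rfl⟩

theorem card_famAbove_le_of_uniform {α : Type*} [DecidableEq α] {t s : ℕ} {r M : ℝ} (hr : 0 < r)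
    {𝓐 𝓢 : Finset (Finset α)}
    (hspread : ∀ (s : ℕ) (U : Finset α), U.card = t + s →
      ((𝓐.filter fun A => U ⊆ A).card : ℝ) * r ^ s ≤ M)
    (hcard : ∀ S ∈ 𝓢, S.card = t + s) :
    ((famAbove 𝓐 𝓢).card : ℝ) ≤ 𝓢.card * (M / r ^ s) := by
  calc ((famAbove 𝓐 𝓢).card : ℝ) ≤ ∑ S ∈ 𝓢, ((𝓐.filter fun A => S ⊆ A).card : ℝ) := by
        exact_mod_cast card_famAbove_le_sum 𝓐 𝓢
    _ ≤ ∑ S ∈ 𝓢, M / r ^ s := by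
        refine Finset.sum_le_sum fun S hS => ?_
        rw [le_div_iff₀ (by positivity)]
        exact hspread s S (hcard S hS)
    _ = 𝓢.card * (M / r ^ s) := by rw [Finset.sum_const, nsmul_eq_mul]

theorem card_famAbove_le_of_nontrivial {α : Type*} [DecidableEq α] {t Q : ℕ} {r M : ℝ} (hr : 0 < r) (hM : 0 ≤ M)
    {𝓐 : Finset (Finset α)} (hex : ∃ T : Finset α, T.card = t)
    (hspread : ∀ (s : ℕ) (U : Finset α), U.card = t + s →
      ((𝓐.filter fun A => U ⊆ A).card : ℝ) * r ^ s ≤ M) (j : ℕ) :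
    ∀ 𝓢 : Finset (Finset α), IsTIntersecting t 𝓢 → ¬ IsTTrivial t 𝓢 → (∀ S ∈ 𝓢, S.card ≤ Q) →
      (∀ S ∈ 𝓢, S.card ≤ t + j) →
      ((famAbove 𝓐 𝓢).card : ℝ) ≤ (∑ l ∈ Finset.range j, (4 * Q / r) ^ (l + 1) + Q / r) * M := by
  induction j with
  | zero =>
    intro 𝓢 hint hnon _ hcard
    refine absurd ?_ hnon
    rcases 𝓢.eq_empty_or_nonempty with rfl | ⟨S, hS⟩
    · obtain ⟨T, hT⟩ := hex
      exact ⟨T, hT, by simp⟩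
    · have h1 := hint S hS S hS
      rw [Finset.inter_self] at h1
      have h2 := hcard S hS
      refine ⟨S, by omega, fun S' hS' => ?_⟩
      rw [← Finset.inter_eq_left]
      exact Finset.eq_of_subset_of_card_le Finset.inter_subset_left
        (by have := hint S hS S' hS'; omega)
  | succ j ih =>
    intro 𝓢
    induction hw : ∑ S ∈ 𝓢, S.card using Nat.strong_induction_on generalizing 𝓢 with
    | _ w ihw =>
      intro hint hnon hQ hcard
      by_cases hirr : IsTIrreducible t 𝓢
      swap
      · obtain ⟨𝓢', hint', hlt, hdown, hup⟩ := hint.exists_refinement hirr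
        refine le_trans ?_ (ihw _ (hw ▸ hlt) 𝓢' rfl hint' ?_ ?_ ?_)
        · exact_mod_cast Finset.card_le_card (famAbove_subset_of_refines 𝓐 hdown)
        · rintro ⟨T, hT, hTS⟩
          refine hnon ⟨T, hT, fun S hS => ?_⟩
          obtain ⟨S', hS', hle⟩ := hdown S hS
          exact (hTS S' hS').trans hle
        · intro S' hS'
          obtain ⟨S, hS, hle⟩ := hup S' hS'
          exact (Finset.card_le_card hle).trans (hQ S hS)
        · intro S' hS'
          obtain ⟨S, hS, hle⟩ := hup S' hS'
          exact (Finset.card_le_card hle).trans (hcard S hS)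
      set 𝓦 := 𝓢.filter fun S => S.card = t + (j + 1) with h𝓦
      set 𝓡 := 𝓢.filter fun S => ¬ S.card = t + (j + 1) with h𝓡
      have hRS : 𝓡 ⊆ 𝓢 := Finset.filter_subset _ _
      have hW : ((famAbove 𝓐 𝓦).card : ℝ) ≤ (4 * Q / r) ^ (j + 1) * M := by
        calc ((famAbove 𝓐 𝓦).card : ℝ) ≤ 𝓦.card * (M / r ^ (j + 1)) :=
              card_famAbove_le_of_uniform hr hspread fun S hS => (Finset.mem_filter.1 hS).2
          _ ≤ ((4 * Q) ^ (j + 1) : ℝ) * (M / r ^ (j + 1)) := by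
              gcongr
              exact_mod_cast card_top_layer_le j.succ_pos hint hirr hQ hcard
          _ = (4 * Q / r) ^ (j + 1) * M := by rw [div_pow]; ring
      have hR : ((famAbove 𝓐 𝓡).card : ℝ) ≤
          (∑ l ∈ Finset.range j, (4 * Q / r) ^ (l + 1) + Q / r) * M := by
        by_cases htriv : IsTTrivial t 𝓡
        · obtain ⟨T, hT, hTR⟩ := htriv
          obtain ⟨W, hWS, hTW⟩ : ∃ W ∈ 𝓢, ¬ T ⊆ W := by
            by_contra! h
            exact hnon ⟨T, hT, h⟩
          have hrefine : ∀ R ∈ 𝓡, ∃ R' ∈ (W \ T).image (fun x => insert x T), R' ⊆ R := by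
            intro R hR
            have h1 := hint R (hRS hR) W hWS
            have hnot : ¬ R ∩ W ⊆ T := fun h => by
              have h2 := Finset.eq_of_subset_of_card_le h (by omega)
              exact hTW (h2 ▸ Finset.inter_subset_right)
            obtain ⟨x, hx, hxT⟩ := Finset.not_subset.1 hnot
            obtain ⟨hxR, hxW⟩ := Finset.mem_inter.1 hx
            exact ⟨insert x T, Finset.mem_image_of_mem _ (Finset.mem_sdiff.2 ⟨hxW, hxT⟩),
              Finset.insert_subset hxR (hTR R hR)⟩
          calc ((famAbove 𝓐 𝓡).card : ℝ)
              ≤ (famAbove 𝓐 ((W \ T).image fun x => insert x T)).card := by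
                exact_mod_cast Finset.card_le_card (famAbove_subset_of_refines 𝓐 hrefine)
            _ ≤ ((W \ T).image fun x => insert x T).card * (M / r ^ 1) := by
                refine card_famAbove_le_of_uniform hr hspread fun S hS => ?_
                obtain ⟨x, hx, rfl⟩ := Finset.mem_image.1 hS
                rw [Finset.card_insert_of_notMem (Finset.mem_sdiff.1 hx).2, hT]
            _ ≤ Q * (M / r ^ 1) := by
                gcongr
                exact Finset.card_image_le.trans
                  ((Finset.card_le_card Finset.sdiff_subset).trans (hQ W hWS))
            _ = (0 + Q / r) * M := by ring
            _ ≤ _ := by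
                gcongr
                positivity
        · refine ih 𝓡 (hint.mono hRS) htriv (fun S hS => hQ S (hRS hS)) fun S hS => ?_
          have h1 := hcard S (hRS hS)
          have h2 := (Finset.mem_filter.1 hS).2
          omega
      have hsplit : 𝓢 = 𝓦 ∪ 𝓡 := (Finset.filter_union_filter_not_eq _ _).symm
      calc ((famAbove 𝓐 𝓢).card : ℝ) ≤ (famAbove 𝓐 𝓦).card + (famAbove 𝓐 𝓡).card := by
            rw [hsplit, famAbove_union]
            exact_mod_cast Finset.card_union_le _ _
        _ ≤ _ := add_le_add hW hR
        _ = _ := by rw [Finset.sum_range_succ]; ring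

theorem card_famRes {n : ℕ} (𝓖 : Finset (Finset (Fin n))) (X : Finset (Fin n)) :
    (famRes 𝓖 X).card = (𝓖.filter fun A => X ⊆ A).card := by
  refine Finset.card_image_of_injOn fun A hA B hB hAB => ?_
  have hA' := (Finset.mem_filter.1 hA).2
  have hB' := (Finset.mem_filter.1 hB).2
  rw [← Finset.sdiff_union_of_subset hA', ← Finset.sdiff_union_of_subset hB']
  exact congrArg (· ∪ X) hAB

theorem stmt6 (n t : ℕ) (hn : 1 ≤ n) (ht : 1 ≤ t)
    (ε r q : ℝ) (hε0 : 0 < ε) (hε1 : ε ≤ 1) (hr : 1 ≤ r) (hq : 1 ≤ q)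
    (hεr : 24 * q ≤ ε * r)
    (𝓐 𝓢 : Finset (Finset (Fin n)))
    -- `𝓐` is weakly `(r,t)`-spread
    (hweak : ∃ T : Finset (Fin n), T.card = t ∧
      ∀ (s : ℕ) (U : Finset (Fin n)), U.card = t + s →
        ((famRes 𝓐 U).card : ℝ) * r ^ s ≤ ((famRes 𝓐 T).card : ℝ))
    -- sets in `𝓢` have size at most `q`
    (hSsize : ∀ S ∈ 𝓢, (S.card : ℝ) ≤ q)
    -- `𝓢` is `t`-intersecting
    (hSint : ∀ S ∈ 𝓢, ∀ S' ∈ 𝓢, t ≤ (S ∩ S').card)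
    -- `𝓢` is non-trivial: no `t`-element set is contained in all members of `𝓢`
    (hnontriv : ¬∃ T : Finset (Fin n), T.card = t ∧ ∀ S ∈ 𝓢, T ⊆ S) :
    ∃ T : Finset (Fin n), T.card = t ∧
      (((𝓐.filter fun A => ∃ S ∈ 𝓢, S ⊆ A).card : ℝ) ≤
        ε * ((𝓐.filter fun A => T ⊆ A).card : ℝ)) := by
  obtain ⟨T, hT, hspread⟩ := hweak
  simp only [card_famRes] at hspread
  refine ⟨T, hT, ?_⟩
  have hr0 : 0 < r := by linarith
  have hbound := card_famAbove_le_of_nontrivial (Q := ⌊q⌋₊) hr0 (Nat.cast_nonneg _) ⟨T, hT⟩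
    hspread ⌊q⌋₊ 𝓢 hSint hnontriv (fun S hS => Nat.le_floor (hSsize S hS))
    (fun S hS => (Nat.le_floor (hSsize S hS)).trans (Nat.le_add_left _ _))
  refine hbound.trans (mul_le_mul_of_nonneg_right ?_ (Nat.cast_nonneg _))
  set x : ℝ := 4 * ⌊q⌋₊ / r with hx
  have hx0 : 0 ≤ x := by positivity
  have hxε : x ≤ ε / 6 := by
    rw [hx, div_le_iff₀ hr0]
    have := Nat.floor_le (show 0 ≤ q by linarith)
    linarith
  have hQr : (⌊q⌋₊ : ℝ) / r = x / 4 := by rw [hx]; ring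
  have hgeom : ∑ l ∈ Finset.range ⌊q⌋₊, x ^ l ≤ 6 / 5 := by
    have h1 := mul_neg_geom_sum x ⌊q⌋₊
    have h2 : 0 ≤ x ^ ⌊q⌋₊ := by positivity
    have h3 : 0 ≤ ∑ l ∈ Finset.range ⌊q⌋₊, x ^ l := by positivity
    nlinarith
  have hsum : ∑ l ∈ Finset.range ⌊q⌋₊, x ^ (l + 1) = (∑ l ∈ Finset.range ⌊q⌋₊, x ^ l) * x := by
    rw [Finset.sum_mul]
    exact Finset.sum_congr rfl fun l _ => pow_succ x l
  rw [hsum, hQr]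
  nlinarith
end

section
/- Let r > 1 be a real number, let 𝓕 be a finite family of subsets of [n], and let X ⊆ [n] be a set, inclusion-maximal among sets satisfying |𝓕(X)| ≥ r^{−|X|}·|𝓕|. Then the family 𝓕(X), viewed as a family of subsets of [n] \ X, is r-spread. -/
open scoped Classical

/-- A family `𝓖` is `r`-spread if `|𝓖(Y)| ≤ r^{-|Y|}·|𝓖|` for every set `Y`. -/
def RSpread {n : ℕ} (r : ℝ) (𝓖 : Finset (Finset (Fin n))) : Prop :=
  ∀ Y : Finset (Fin n), ((famRes 𝓖 Y).card : ℝ) * r ^ Y.card ≤ (𝓖.card : ℝ)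

/-- Restricting first to `X` and then to a set `Y` disjoint from `X` is restricting to `X ∪ Y`. -/
theorem famRes_famRes_of_disjoint {n : ℕ} (𝓖 : Finset (Finset (Fin n))) {X Y : Finset (Fin n)}
    (h : Disjoint X Y) : famRes (famRes 𝓖 X) Y = famRes 𝓖 (X ∪ Y) := by
  ext B
  simp only [famRes, Finset.mem_image, Finset.mem_filter]
  constructor
  · rintro ⟨_, ⟨⟨A, ⟨hA, hXA⟩, rfl⟩, hY⟩, rfl⟩
    exact ⟨A, ⟨hA, Finset.union_subset hXA (hY.trans Finset.sdiff_subset)⟩, sdiff_sdiff_left.symm⟩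
  · rintro ⟨A, ⟨hA, hXY⟩, rfl⟩
    have hXA : X ⊆ A := Finset.subset_union_left.trans hXY
    have hYA : Y ⊆ A := Finset.subset_union_right.trans hXY
    exact ⟨A \ X, ⟨⟨A, ⟨hA, hXA⟩, rfl⟩, Finset.subset_sdiff.2 ⟨hYA, h.symm⟩⟩, sdiff_sdiff_left⟩

theorem famRes_famRes_of_not_disjoint {n : ℕ} (𝓖 : Finset (Finset (Fin n)))
    {X Y : Finset (Fin n)} (h : ¬Disjoint X Y) : famRes (famRes 𝓖 X) Y = ∅ := by
  refine Finset.eq_empty_of_forall_notMem fun B hB => h ?_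
  simp only [famRes, Finset.mem_image, Finset.mem_filter] at hB
  obtain ⟨_, ⟨⟨A, _, rfl⟩, hY⟩, _⟩ := hB
  exact (Finset.subset_sdiff.1 hY).2.symm

theorem famRes_empty {n : ℕ} (𝓖 : Finset (Finset (Fin n))) : famRes 𝓖 ∅ = 𝓖 := by
  simp [famRes]

theorem stmt7 (n : ℕ) (r : ℝ) (hr : 1 < r)
    (𝓕 : Finset (Finset (Fin n))) (X : Finset (Fin n))
    -- `X` satisfies `|𝓕(X)| ≥ r^{-|X|}·|𝓕|`
    (hX : (𝓕.card : ℝ) ≤ ((famRes 𝓕 X).card : ℝ) * r ^ X.card)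
    -- and is inclusion-maximal among such sets
    (hmax : ∀ Y : Finset (Fin n), X ⊂ Y →
      ¬((𝓕.card : ℝ) ≤ ((famRes 𝓕 Y).card : ℝ) * r ^ Y.card)) :
    RSpread r (famRes 𝓕 X) := by
  intro Y
  by_cases hXY : Disjoint X Y
  · obtain rfl | hY := Y.eq_empty_or_nonempty
    · simp [famRes_empty]
    have hss : X ⊂ X ∪ Y := by
      refine Finset.ssubset_iff_subset_ne.2 ⟨Finset.subset_union_left, fun h => hY.ne_empty ?_⟩
      exact disjoint_self.1 (hXY.mono_left (Finset.union_eq_left.1 h.symm))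
    have hlt := (not_le.1 (hmax _ hss)).trans_le hX
    rw [Finset.card_union_of_disjoint hXY, pow_add, mul_left_comm, mul_comm (r ^ X.card)] at hlt
    rw [famRes_famRes_of_disjoint 𝓕 hXY]
    exact (lt_of_mul_lt_mul_right hlt (by positivity)).le
  · simp [famRes_famRes_of_not_disjoint 𝓕 hXY]
end

section
/- Let n, p, t be positive integers, let 𝓐 be a family of subsets of [n], and let 𝓢 be a t-intersecting family of subsets of [n] each of size at most p. Then there exists a t-intersecting family 𝓣 of subsets of [n], each of size at most p, such that 𝓐[𝓢] ⊆ 𝓐[𝓣] and, for every T ∈ 𝓣 and every proper subset X ⊊ T, there exists T′ ∈ 𝓣 with |X ∩ T′| < t. -/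
open scoped Classical

/-- Every `t`-intersecting family can be refined to one from which no member can be shrunk. -/
theorem exists_unshrinkable_refinement {α : Type*} (t : ℕ) (𝓢 : Finset (Finset α))
    (hS : ∀ S ∈ 𝓢, ∀ S' ∈ 𝓢, t ≤ (S ∩ S').card) :
    ∃ 𝓣 : Finset (Finset α),
      (∀ T ∈ 𝓣, ∃ S ∈ 𝓢, T ⊆ S) ∧
      (∀ S ∈ 𝓢, ∃ T ∈ 𝓣, T ⊆ S) ∧
      (∀ T ∈ 𝓣, ∀ T' ∈ 𝓣, t ≤ (T ∩ T').card) ∧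
      (∀ T ∈ 𝓣, ∀ X : Finset α, X ⊂ T → ∃ T' ∈ 𝓣, (X ∩ T').card < t) := by
  induction hm : ∑ S ∈ 𝓢, S.card using Nat.strong_induction_on generalizing 𝓢 with
  | _ m ih =>
    by_cases h : ∀ T ∈ 𝓢, ∀ X : Finset α, X ⊂ T → ∃ T' ∈ 𝓢, (X ∩ T').card < t
    · exact ⟨𝓢, fun T hT => ⟨T, hT, subset_rfl⟩, fun S hS => ⟨S, hS, subset_rfl⟩, hS, h⟩
    push Not at h
    obtain ⟨T, hT, X, hXT, hX⟩ := h
    have hXX : t ≤ (X ∩ X).card := by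
      have := hX T hT
      rwa [Finset.inter_eq_left.2 hXT.subset, ← Finset.inter_self X] at this
    have hlt : ∑ S ∈ insert X (𝓢.erase T), S.card < m := by
      have h₁ : ∑ S ∈ insert X (𝓢.erase T), S.card ≤ X.card + ∑ S ∈ 𝓢.erase T, S.card := by
        by_cases hmem : X ∈ 𝓢.erase T
        · rw [Finset.insert_eq_of_mem hmem]
          exact Nat.le_add_left _ _
        · rw [Finset.sum_insert hmem]
      have h₂ := Finset.add_sum_erase 𝓢 Finset.card hT
      have h₃ := Finset.card_lt_card hXT
      omega
    have hint : ∀ S ∈ insert X (𝓢.erase T), ∀ S' ∈ insert X (𝓢.erase T),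
        t ≤ (S ∩ S').card := by
      intro S hS₁ S' hS₂
      rcases Finset.mem_insert.1 hS₁ with rfl | hS₃ <;>
        rcases Finset.mem_insert.1 hS₂ with rfl | hS₄
      · exact hXX
      · exact hX _ (Finset.mem_of_mem_erase hS₄)
      · rw [Finset.inter_comm]
        exact hX _ (Finset.mem_of_mem_erase hS₃)
      · exact hS _ (Finset.mem_of_mem_erase hS₃) _ (Finset.mem_of_mem_erase hS₄)
    obtain ⟨𝓣, hsub, hcov, h𝓣, hmin⟩ := ih _ hlt _ hint rfl
    refine ⟨𝓣, fun A hA => ?_, fun S hS => ?_, h𝓣, hmin⟩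
    · obtain ⟨S, hS, hAS⟩ := hsub A hA
      rcases Finset.mem_insert.1 hS with rfl | hS
      · exact ⟨T, hT, hAS.trans hXT.subset⟩
      · exact ⟨S, Finset.mem_of_mem_erase hS, hAS⟩
    · by_cases hST : S = T
      · obtain ⟨A, hA, hAX⟩ := hcov X (Finset.mem_insert_self _ _)
        exact ⟨A, hA, hST ▸ hAX.trans hXT.subset⟩
      · exact hcov S (Finset.mem_insert_of_mem (Finset.mem_erase.2 ⟨hST, hS⟩))

theorem stmt9 (n p t : ℕ) (hn : 1 ≤ n) (hp : 1 ≤ p) (ht : 1 ≤ t)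
    (𝓐 𝓢 : Finset (Finset (Fin n)))
    (hSsize : ∀ S ∈ 𝓢, S.card ≤ p)
    (hSint : ∀ S ∈ 𝓢, ∀ S' ∈ 𝓢, t ≤ (S ∩ S').card) :
    ∃ 𝓣 : Finset (Finset (Fin n)),
      (∀ T ∈ 𝓣, T.card ≤ p) ∧
      (∀ T ∈ 𝓣, ∀ T' ∈ 𝓣, t ≤ (T ∩ T').card) ∧
      ((𝓐.filter fun A => ∃ S ∈ 𝓢, S ⊆ A) ⊆ 𝓐.filter fun A => ∃ T ∈ 𝓣, T ⊆ A) ∧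
      (∀ T ∈ 𝓣, ∀ X : Finset (Fin n), X ⊂ T → ∃ T' ∈ 𝓣, (X ∩ T').card < t) := by
  obtain ⟨𝓣, hsub, hcov, hint, hmin⟩ := exists_unshrinkable_refinement t 𝓢
    (fun S hS S' hS' => by convert hSint S hS S' hS')
  refine ⟨𝓣, fun T hT => ?_, fun T hT T' hT' => by convert hint T hT T' hT', ?_,
    fun T hT X hX => ?_⟩
  · obtain ⟨S, hS, hTS⟩ := hsub T hT
    exact (Finset.card_le_card hTS).trans (hSsize S hS)
  · refine Finset.monotone_filter_right 𝓐 ?_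
    rintro A - ⟨S, hS, hSA⟩
    obtain ⟨T, hT, hTS⟩ := hcov S hS
    exact ⟨T, hT, hTS.trans hSA⟩
  · obtain ⟨T', hT', h⟩ := hmin T hT X hX
    exact ⟨T', hT', by convert h⟩
end
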